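/- Let Φ : ℝⁿ → ℝ be C⁵ and convex with everywhere positive definite Hessian, let V : ℝⁿ → ℝ be C³ with D²V(x) ≥ c·Id for all x for some c > 0 and μ = e^{−V}dx a probability measure, and let ν = c_Q e^{−⟨Qx, x⟩}dx be a Gaussian probability measure, where Q is a symmetric positive definite matrix and c_Q a normalizing constant. Assume the Monge–Ampère equation e^{−V(x)} = c_Q e^{−⟨Q∇Φ(x), ∇Φ(x)⟩} · det D²Φ(x) holds on ℝⁿ, and that S := sup { Tr[ (D²V(x))⁻¹ · (∂_e D²V(x))² ] : x ∈ ℝⁿ, e ∈ ℝⁿ, |e| = 1 } is finite. Then for every x ∈ ℝⁿ: (‖g‖_h(x))² ≤ (‖Q‖/c) · S, where ‖Q‖ is the Euclidean operator norm of Q. -/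

import Mathlib

noncomputable section
open scoped BigOperators
open Filter MeasureTheory

/-- Partial derivative `∂_i f`. -/
def pd {n : ℕ} (f : (Fin n → ℝ) → ℝ) (i : Fin n) : (Fin n → ℝ) → ℝ :=
  fun x => fderiv ℝ f x (Pi.single i 1)

/-- Second partial derivative `f_{ij}`. -/
def pd2 {n : ℕ} (f : (Fin n → ℝ) → ℝ) (i j : Fin n) : (Fin n → ℝ) → ℝ :=
  pd (pd f i) j

/-- Third partial derivative `f_{ijk}`. -/
def pd3 {n : ℕ} (f : (Fin n → ℝ) → ℝ) (i j k : Fin n) : (Fin n → ℝ) → ℝ :=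
  pd (pd2 f i j) k

/-- Fourth partial derivative `f_{ijkl}`. -/
def pd4 {n : ℕ} (f : (Fin n → ℝ) → ℝ) (i j k l : Fin n) : (Fin n → ℝ) → ℝ :=
  pd (pd3 f i j k) l

/-- Fifth partial derivative. -/
def pd5 {n : ℕ} (f : (Fin n → ℝ) → ℝ) (i j k l m : Fin n) : (Fin n → ℝ) → ℝ :=
  pd (pd4 f i j k l) m

/-- The Hessian matrix `D²Φ(x)`, with entries `Φ_{ij}(x)`. -/
def hess {n : ℕ} (Φ : (Fin n → ℝ) → ℝ) (x : Fin n → ℝ) : Matrix (Fin n) (Fin n) ℝ :=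
  Matrix.of fun i j => pd2 Φ i j x

/-- The inverse Hessian matrix, with entries `Φ^{ij}(x)`. -/
def ihess {n : ℕ} (Φ : (Fin n → ℝ) → ℝ) (x : Fin n → ℝ) : Matrix (Fin n) (Fin n) ℝ :=
  (hess Φ x)⁻¹

/-- The gradient `∇Φ(x)`. -/
def grad {n : ℕ} (Φ : (Fin n → ℝ) → ℝ) (x : Fin n → ℝ) : Fin n → ℝ :=
  fun i => pd Φ i x

/-- The Calabi tensor `g_{ij} = Σ Φ_{iab} Φ_{jcd} Φ^{ac} Φ^{bd}`. -/
def calabi {n : ℕ} (Φ : (Fin n → ℝ) → ℝ) (i j : Fin n) (x : Fin n → ℝ) : ℝ :=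
  ∑ a, ∑ b, ∑ c, ∑ d,
    pd3 Φ i a b x * pd3 Φ j c d x * ihess Φ x a c * ihess Φ x b d

/-- `W^i := (∂_i W)(∇Φ)`. -/
def Wop {n : ℕ} (Φ W : (Fin n → ℝ) → ℝ) (i : Fin n) (x : Fin n → ℝ) : ℝ :=
  pd W i (grad Φ x)

/-- `Ŵ_{ij} := Σ_{a,b} W^{ab} Φ_{ai} Φ_{bj}` where `W^{ab} = (∂²_{ab}W)(∇Φ)`. -/
def What2 {n : ℕ} (Φ W : (Fin n → ℝ) → ℝ) (i j : Fin n) (x : Fin n → ℝ) : ℝ :=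
  ∑ a, ∑ b, pd2 W a b (grad Φ x) * pd2 Φ a i x * pd2 Φ b j x

/-- `Ŵ_{ijk} := Σ_{a,b,c} W^{abc} Φ_{ai} Φ_{bj} Φ_{ck}` where `W^{abc} = (∂³_{abc}W)(∇Φ)`. -/
def What3 {n : ℕ} (Φ W : (Fin n → ℝ) → ℝ) (i j k : Fin n) (x : Fin n → ℝ) : ℝ :=
  ∑ a, ∑ b, ∑ c, pd3 W a b c (grad Φ x) * pd2 Φ a i x * pd2 Φ b j x * pd2 Φ c k x

/-- Christoffel symbols `Γ^k_{pq} = ½ Σ_m Φ^{km} Φ_{mpq}` of the Hessian metric. -/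
def Γh {n : ℕ} (Φ : (Fin n → ℝ) → ℝ) (k p q : Fin n) (x : Fin n → ℝ) : ℝ :=
  (1/2) * ∑ m, ihess Φ x k m * pd3 Φ m p q x

/-- Covariant derivative of a (0,1)-tensor: `(∇T)_{p i}`. -/
def covD1 {n : ℕ} (Φ : (Fin n → ℝ) → ℝ) (T : Fin n → (Fin n → ℝ) → ℝ)
    (p i : Fin n) (x : Fin n → ℝ) : ℝ :=
  pd (T i) p x - ∑ m, Γh Φ m p i x * T m x

/-- Covariant derivative of a (0,2)-tensor: `(∇T)_{p i j}`. -/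
def covD2 {n : ℕ} (Φ : (Fin n → ℝ) → ℝ) (T : Fin n → Fin n → (Fin n → ℝ) → ℝ)
    (p i j : Fin n) (x : Fin n → ℝ) : ℝ :=
  pd (T i j) p x - ∑ m, Γh Φ m p i x * T m j x - ∑ m, Γh Φ m p j x * T i m x

/-- Covariant derivative of a (0,3)-tensor: `(∇T)_{p i j k}`. -/
def covD3 {n : ℕ} (Φ : (Fin n → ℝ) → ℝ) (T : Fin n → Fin n → Fin n → (Fin n → ℝ) → ℝ)
    (p i j k : Fin n) (x : Fin n → ℝ) : ℝ :=
  pd (T i j k) p x - ∑ m, Γh Φ m p i x * T m j k x - ∑ m, Γh Φ m p j x * T i m k x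
    - ∑ m, Γh Φ m p k x * T i j m x

/-- Covariant derivative of a (0,4)-tensor: `(∇T)_{p i j k l}`. -/
def covD4 {n : ℕ} (Φ : (Fin n → ℝ) → ℝ)
    (T : Fin n → Fin n → Fin n → Fin n → (Fin n → ℝ) → ℝ)
    (p i j k l : Fin n) (x : Fin n → ℝ) : ℝ :=
  pd (T i j k l) p x - ∑ m, Γh Φ m p i x * T m j k l x - ∑ m, Γh Φ m p j x * T i m k l x
    - ∑ m, Γh Φ m p k x * T i j m l x - ∑ m, Γh Φ m p l x * T i j k m x

/-- Weighted tensor Laplacian of a (0,1)-tensor: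
`(LT)_i = Σ Φ^{pq}(∇∇T)_{pq i} − ½ Σ_p (Σ_m Φ^{pm} V_m + W^p)(∇T)_{p i}`. -/
def LT1 {n : ℕ} (Φ V W : (Fin n → ℝ) → ℝ) (T : Fin n → (Fin n → ℝ) → ℝ)
    (i : Fin n) (x : Fin n → ℝ) : ℝ :=
  (∑ p, ∑ q, ihess Φ x p q * covD2 Φ (covD1 Φ T) p q i x)
    - (1/2) * ∑ p, ((∑ m, ihess Φ x p m * pd V m x) + Wop Φ W p x) * covD1 Φ T p i x

/-- Weighted tensor Laplacian of a (0,2)-tensor. -/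
def LT2 {n : ℕ} (Φ V W : (Fin n → ℝ) → ℝ) (T : Fin n → Fin n → (Fin n → ℝ) → ℝ)
    (i j : Fin n) (x : Fin n → ℝ) : ℝ :=
  (∑ p, ∑ q, ihess Φ x p q * covD3 Φ (covD2 Φ T) p q i j x)
    - (1/2) * ∑ p, ((∑ m, ihess Φ x p m * pd V m x) + Wop Φ W p x) * covD2 Φ T p i j x

/-- Weighted tensor Laplacian of a (0,3)-tensor. -/
def LT3 {n : ℕ} (Φ V W : (Fin n → ℝ) → ℝ) (T : Fin n → Fin n → Fin n → (Fin n → ℝ) → ℝ)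
    (i j k : Fin n) (x : Fin n → ℝ) : ℝ :=
  (∑ p, ∑ q, ihess Φ x p q * covD4 Φ (covD3 Φ T) p q i j k x)
    - (1/2) * ∑ p, ((∑ m, ihess Φ x p m * pd V m x) + Wop Φ W p x) * covD3 Φ T p i j k x

/-- `N_{piab} := Φ_{piab} − ½ Σ_{k,m} Φ^{km}(Φ_{mpi}Φ_{kab} + Φ_{mpa}Φ_{kib} + Φ_{mpb}Φ_{kia})`. -/
def Ncal {n : ℕ} (Φ : (Fin n → ℝ) → ℝ) (p i a b : Fin n) (x : Fin n → ℝ) : ℝ :=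
  pd4 Φ p i a b x - (1/2) * ∑ k, ∑ m, ihess Φ x k m *
    (pd3 Φ m p i x * pd3 Φ k a b x + pd3 Φ m p a x * pd3 Φ k i b x
      + pd3 Φ m p b x * pd3 Φ k i a x)

/-- Riemann curvature `R_{ikjl} := ¼ Σ_{a,m} Φ^{am}(Φ_{ila}Φ_{mkj} − Φ_{ija}Φ_{mkl})`. -/
def Rcal {n : ℕ} (Φ : (Fin n → ℝ) → ℝ) (i k j l : Fin n) (x : Fin n → ℝ) : ℝ :=
  (1/4) * ∑ a, ∑ m, ihess Φ x a m *
    (pd3 Φ i l a x * pd3 Φ m k j x - pd3 Φ i j a x * pd3 Φ m k l x)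

/-- The `h`-norm of a quadratic form `Q` at `x`:
`‖Q‖_h(x) = sup { Σ Q_{ij} v_i v_j : Σ Φ_{ij}(x) v_i v_j = 1 }`. -/
def hnorm {n : ℕ} (Φ : (Fin n → ℝ) → ℝ) (Q : Fin n → Fin n → ℝ) (x : Fin n → ℝ) : ℝ :=
  sSup {r | ∃ v : Fin n → ℝ,
    (∑ i, ∑ j, pd2 Φ i j x * v i * v j) = 1 ∧ r = ∑ i, ∑ j, Q i j * v i * v j}

/-- The matrix `A(x)` with entries `V_{ab} + Ŵ_{ab}`. -/
def Amat {n : ℕ} (Φ V W : (Fin n → ℝ) → ℝ) (x : Fin n → ℝ) : Matrix (Fin n) (Fin n) ℝ :=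
  Matrix.of fun a b => pd2 V a b x + What2 Φ W a b x

/-- The matrix `S_i(x)` with entries `V_{iab} − Ŵ_{iab}`. -/
def Smat {n : ℕ} (Φ V W : (Fin n → ℝ) → ℝ) (i : Fin n) (x : Fin n → ℝ) :
    Matrix (Fin n) (Fin n) ℝ :=
  Matrix.of fun a b => pd3 V i a b x - What3 Φ W i a b x

/-- `H_{ij}(x) := Tr[A(x)⁻¹ · S_i(x) · (D²Φ(x))⁻¹ · S_j(x)]`. -/
def Hten {n : ℕ} (Φ V W : (Fin n → ℝ) → ℝ) (i j : Fin n) (x : Fin n → ℝ) : ℝ :=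
  ((Amat Φ V W x)⁻¹ * Smat Φ V W i x * (hess Φ x)⁻¹ * Smat Φ V W j x).trace

/-- Euclidean operator norm of a matrix. -/
def eOpNorm {n : ℕ} (M : Matrix (Fin n) (Fin n) ℝ) : ℝ :=
  ‖LinearMap.toContinuousLinearMap (Matrix.toEuclideanLin M)‖

/-- Directional derivative of the Hessian: the matrix `∂_e D²F(x)`. -/
def dirHess {n : ℕ} (F : (Fin n → ℝ) → ℝ) (e : Fin n → ℝ) (x : Fin n → ℝ) :
    Matrix (Fin n) (Fin n) ℝ :=
  Matrix.of fun i j => ∑ k, e k * pd3 F k i j x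

/-- The quadratic form `⟨Qy, y⟩`. -/
def qform {n : ℕ} (Q : Matrix (Fin n) (Fin n) ℝ) (y : Fin n → ℝ) : ℝ :=
  ∑ i, ∑ j, Q i j * y j * y i

open scoped Matrix

open Topology in
/-- `f` is twice differentiable at `0` with value `a`, first derivative `b`, second derivative `c`. -/
def HasJet (f : ℝ → ℝ) (a b c : ℝ) : Prop :=
  ∃ f' : ℝ → ℝ, (∀ᶠ t in 𝓝 0, HasDerivAt f (f' t) t) ∧ f 0 = a ∧ f' 0 = b ∧ HasDerivAt f' c 0

namespace HasJet
open Topology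
variable {f g : ℝ → ℝ} {a b c a' b' c' : ℝ}

theorem value (h : HasJet f a b c) : f 0 = a := h.choose_spec.2.1

theorem hasDerivAt (h : HasJet f a b c) : HasDerivAt f b 0 := by
  obtain ⟨f', h1, -, h3, -⟩ := h
  exact h3 ▸ h1.self_of_nhds

theorem congr_jet (h : HasJet f a b c) (ha : a = a') (hb : b = b') (hc : c = c') :
    HasJet f a' b' c' := by
  subst ha hb hc; exact h

theorem const (k : ℝ) : HasJet (fun _ => k) k 0 0 :=
  ⟨fun _ => 0, Eventually.of_forall fun t => hasDerivAt_const t k, rfl, rfl, hasDerivAt_const 0 _⟩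

theorem linear (k l : ℝ) : HasJet (fun t => k + t * l) k l 0 := by
  refine ⟨fun _ => l, Eventually.of_forall fun t => ?_, by simp, rfl, hasDerivAt_const 0 _⟩
  simpa using ((hasDerivAt_id t).mul_const l).const_add k

theorem add (hf : HasJet f a b c) (hg : HasJet g a' b' c') :
    HasJet (fun t => f t + g t) (a + a') (b + b') (c + c') := by
  obtain ⟨f', f1, f2, f3, f4⟩ := hf
  obtain ⟨g', g1, g2, g3, g4⟩ := hg
  refine ⟨fun t => f' t + g' t, ?_, by simp [f2, g2], by simp [f3, g3], f4.add g4⟩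
  filter_upwards [f1, g1] with t h1 h2 using h1.add h2

theorem mul (hf : HasJet f a b c) (hg : HasJet g a' b' c') :
    HasJet (fun t => f t * g t) (a * a') (a * b' + b * a') (a * c' + 2 * (b * b') + c * a') := by
  have hfd := hf.hasDerivAt
  have hgd := hg.hasDerivAt
  obtain ⟨f', f1, f2, f3, f4⟩ := hf
  obtain ⟨g', g1, g2, g3, g4⟩ := hg
  refine ⟨fun t => f' t * g t + f t * g' t, ?_, by simp [f2, g2], ?_, ?_⟩
  · filter_upwards [f1, g1] with t h1 h2 using h1.mul h2
  · simp only [f2, g2, f3, g3]; ring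
  · have := (f4.mul hgd).add (hfd.mul g4)
    refine this.congr_deriv ?_
    simp only [f2, g2, f3, g3]; ring

theorem const_mul (k : ℝ) (hf : HasJet f a b c) :
    HasJet (fun t => k * f t) (k * a) (k * b) (k * c) :=
  ((const k).mul hf).congr_jet rfl (by ring) (by ring)

theorem sub (hf : HasJet f a b c) (hg : HasJet g a' b' c') :
    HasJet (fun t => f t - g t) (a - a') (b - b') (c - c') := by
  have := hf.add (hg.const_mul (-1))
  simp only [neg_mul, one_mul, ← sub_eq_add_neg] at this
  exact this

theorem sum {ι : Type*} (s : Finset ι) {F : ι → ℝ → ℝ} {A B C : ι → ℝ}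
    (h : ∀ i ∈ s, HasJet (F i) (A i) (B i) (C i)) :
    HasJet (fun t => ∑ i ∈ s, F i t) (∑ i ∈ s, A i) (∑ i ∈ s, B i) (∑ i ∈ s, C i) := by
  classical
  induction s using Finset.induction_on with
  | empty => simpa using const 0
  | insert i s hi ih =>
    simp only [Finset.sum_insert hi]
    exact (h i (by simp)).add (ih fun j hj => h j (by simp [hj]))

theorem inv (hf : HasJet f a b c) (ha : a ≠ 0) :
    HasJet (fun t => (f t)⁻¹) a⁻¹ (-b / a ^ 2) (2 * b ^ 2 / a ^ 3 - c / a ^ 2) := by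
  have hfd := hf.hasDerivAt
  obtain ⟨f', f1, f2, f3, f4⟩ := hf
  have hne : ∀ᶠ t in 𝓝 0, f t ≠ 0 :=
    hfd.continuousAt.eventually_ne (by rwa [f2])
  refine ⟨fun t => -f' t / f t ^ 2, ?_, by simp [f2], by simp [f2, f3], ?_⟩
  · filter_upwards [f1, hne] with t h1 h2 using h1.fun_inv h2
  · have := f4.neg.div (hfd.pow 2) (by simpa [f2] using ha)
    refine this.congr_deriv ?_
    simp only [Pi.neg_apply, Pi.pow_apply, f2, f3]
    field_simp
    ring

theorem of_isLocalMax (h : HasJet f a b c) (hmax : ∀ᶠ t in 𝓝 0, f t ≤ a) : b = 0 ∧ c ≤ 0 := by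
  have hv := h.value
  have hm : IsLocalMax f 0 := by simpa [IsLocalMax, IsMaxFilter, hv] using hmax
  have hb : b = 0 := hm.hasDerivAt_eq_zero h.hasDerivAt
  refine ⟨hb, ?_⟩
  by_contra! hc
  obtain ⟨f', f1, f2, f3, f4⟩ := h
  have hd : deriv f =ᶠ[𝓝 0] f' := f1.mono fun t ht => ht.deriv
  have hdd : deriv (deriv f) 0 = c := by rw [hd.deriv_eq, f4.deriv]
  have hd0 : deriv f 0 = 0 := by rw [hd.self_of_nhds, f3, hb]
  have hmin := isLocalMin_of_deriv_deriv_pos (by rw [hdd]; exact hc) hd0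
    f1.self_of_nhds.continuousAt
  have hconst : f =ᶠ[𝓝 0] fun _ => f 0 := by
    filter_upwards [hmin, hm] with t h1 h2 using le_antisymm h2 h1
  have : deriv f =ᶠ[𝓝 0] fun _ => 0 := by
    have := hconst.deriv
    simpa using this
  rw [this.deriv_eq] at hdd
  simp at hdd
  linarith

end HasJet

section pdCalculus
variable {n : ℕ}

theorem contDiff_pd {f : (Fin n → ℝ) → ℝ} {k m : WithTop ℕ∞} (hf : ContDiff ℝ m f)
    (hk : k + 1 ≤ m) (i : Fin n) : ContDiff ℝ k (pd f i) :=
  (hf.fderiv_right hk).clm_apply contDiff_const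

theorem fderiv_apply_eq_sum_pd (f : (Fin n → ℝ) → ℝ) (x d : Fin n → ℝ) :
    fderiv ℝ f x d = ∑ i, d i * pd f i x := by
  conv_lhs => rw [pi_eq_sum_univ' d]
  simp [pd, map_sum]

theorem hasDerivAt_line {f : (Fin n → ℝ) → ℝ} {x d : Fin n → ℝ} {t : ℝ}
    (hf : DifferentiableAt ℝ f (x + t • d)) :
    HasDerivAt (fun s : ℝ => f (x + s • d)) (∑ i, d i * pd f i (x + t • d)) t := by
  have h1 : HasDerivAt (fun s : ℝ => x + s • d) d t := by
    simpa using ((hasDerivAt_id t).smul_const d).const_add x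
  rw [← fderiv_apply_eq_sum_pd]
  exact hf.hasFDerivAt.comp_hasDerivAt t h1

theorem pd2_symm {f : (Fin n → ℝ) → ℝ} (hf : ContDiff ℝ 2 f) (i j : Fin n) :
    pd2 f i j = pd2 f j i := by
  have key : ∀ (i j : Fin n) x, pd2 f i j x
      = fderiv ℝ (fderiv ℝ f) x (Pi.single j 1) (Pi.single i 1) := by
    intro i j x
    have hd : DifferentiableAt ℝ (fderiv ℝ f) x :=
      ((hf.fderiv_right (m := 1) (by norm_num)).differentiable (by norm_num)) x
    have : HasFDerivAt (pd f i)
        ((fderiv ℝ (fderiv ℝ f) x).flip (Pi.single i 1)) x := by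
      have := hd.hasFDerivAt.clm_apply (hasFDerivAt_const (Pi.single i (1 : ℝ)) x)
      rw [ContinuousLinearMap.comp_zero, zero_add] at this
      exact this
    unfold pd2
    rw [pd, this.fderiv]
    rfl
  funext x
  rw [key, key]
  exact (hf.contDiffAt.isSymmSndFDerivAt (by simp)).eq _ _

theorem hasJet_line {f : (Fin n → ℝ) → ℝ} (hf : ContDiff ℝ 2 f) (x d : Fin n → ℝ) :
    HasJet (fun t : ℝ => f (x + t • d)) (f x) (∑ i, d i * pd f i x)
      (∑ i, d i * ∑ j, d j * pd2 f i j x) := by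
  refine ⟨fun t => ∑ i, d i * pd f i (x + t • d), Eventually.of_forall fun t =>
    hasDerivAt_line ((hf.differentiable (by norm_num)) _), by simp, by simp, ?_⟩
  refine HasDerivAt.fun_sum fun i _ => ?_
  have := hasDerivAt_line (f := pd f i) (x := x) (d := d) (t := 0)
    (((contDiff_pd hf (k := 1) (by norm_num) i).differentiable (by norm_num)) _)
  simp only [zero_smul, add_zero] at this
  exact this.const_mul (d i)

theorem hasJet_coord {f : (Fin n → ℝ) → ℝ} (hf : ContDiff ℝ 2 f) (x : Fin n → ℝ) (p : Fin n) :
    HasJet (fun t : ℝ => f (x + t • Pi.single p 1)) (f x) (pd f p x) (pd2 f p p x) := by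
  refine (hasJet_line hf x (Pi.single p 1)).congr_jet rfl ?_ ?_ <;>
  simp [Pi.single_apply]

theorem pd_comp_affine {f : (Fin n → ℝ) → ℝ} (hf : Differentiable ℝ f) (x₀ : Fin n → ℝ)
    (R : Matrix (Fin n) (Fin n) ℝ) (i : Fin n) (x : Fin n → ℝ) :
    pd (fun y => f (x₀ + R.mulVec y)) i x = ∑ a, R a i * pd f a (x₀ + R.mulVec x) := by
  have h1 : HasFDerivAt (fun y => x₀ + R.mulVec y) (Matrix.mulVecLin R).toContinuousLinearMap x :=
    ((Matrix.mulVecLin R).toContinuousLinearMap.hasFDerivAt).const_add x₀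
  have := (hf (x₀ + R.mulVec x)).hasFDerivAt.comp x h1
  rw [pd, show (fun y => f (x₀ + R.mulVec y)) = f ∘ (fun y => x₀ + R.mulVec y) from rfl,
    this.fderiv, ContinuousLinearMap.comp_apply, fderiv_apply_eq_sum_pd]
  simp

theorem pd_eq_of_hasDerivAt {f : (Fin n → ℝ) → ℝ} {x : Fin n → ℝ} {i : Fin n} {a : ℝ}
    (hf : DifferentiableAt ℝ f x)
    (h : HasDerivAt (fun t : ℝ => f (x + t • Pi.single i 1)) a 0) : pd f i x = a := by
  have h2 := hasDerivAt_line (f := f) (x := x) (d := Pi.single i 1) (t := 0) (by simpa using hf)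
  have := h2.unique h
  simpa [Pi.single_apply] using this

theorem hasDerivAt_coord {f : (Fin n → ℝ) → ℝ} {x : Fin n → ℝ} (i : Fin n)
    (hf : DifferentiableAt ℝ f x) :
    HasDerivAt (fun t : ℝ => f (x + t • Pi.single i 1)) (pd f i x) 0 := by
  have h2 := hasDerivAt_line (f := f) (x := x) (d := Pi.single i 1) (t := 0) (by simpa using hf)
  simpa [Pi.single_apply] using h2

end pdCalculus

/-- Entrywise derivative at `0` of a curve of matrices. -/
def MDeriv {n : ℕ} (A : ℝ → Matrix (Fin n) (Fin n) ℝ) (A' : Matrix (Fin n) (Fin n) ℝ) : Prop :=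
  ∀ i j, HasDerivAt (fun t => A t i j) (A' i j) 0

namespace MDeriv
open Topology
variable {n : ℕ} {A B : ℝ → Matrix (Fin n) (Fin n) ℝ} {A' B' : Matrix (Fin n) (Fin n) ℝ}

theorem mul (hA : MDeriv A A') (hB : MDeriv B B') :
    MDeriv (fun t => A t * B t) (A' * B 0 + A 0 * B') := by
  intro i j
  simp only [Matrix.mul_apply, Matrix.add_apply]
  rw [← Finset.sum_add_distrib]
  exact HasDerivAt.fun_sum fun k _ => (hA i k).mul (hB k j)

theorem trace (hA : MDeriv A A') : HasDerivAt (fun t => (A t).trace) A'.trace 0 := by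
  simp only [Matrix.trace, Matrix.diag_apply]
  exact HasDerivAt.fun_sum fun k _ => hA k k

theorem differentiableAt_det_entries (hA : ∀ i j, DifferentiableAt ℝ (fun t => A t i j) 0) :
    DifferentiableAt ℝ (fun t => (A t).det) 0 := by
  simp only [Matrix.det_apply]
  refine DifferentiableAt.fun_sum fun σ _ => ?_
  refine DifferentiableAt.const_smul ?_ _
  exact DifferentiableAt.fun_finsetProd fun i _ => hA _ _

theorem det_ne_zero (hA : MDeriv A A') (h0 : (A 0).det ≠ 0) : ∀ᶠ t in 𝓝 0, (A t).det ≠ 0 :=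
  (differentiableAt_det_entries fun i j => (hA i j).differentiableAt).continuousAt.eventually_ne h0

theorem inv (hA : MDeriv A A') (h0 : (A 0).det ≠ 0) :
    MDeriv (fun t => (A t)⁻¹) (-((A 0)⁻¹ * A' * (A 0)⁻¹)) := by
  have hd : ∀ i j, DifferentiableAt ℝ (fun t => (A t)⁻¹ i j) 0 := by
    intro i j
    simp only [Matrix.inv_def, Matrix.smul_apply, smul_eq_mul, Ring.inverse_eq_inv',
      Matrix.adjugate_apply]
    refine DifferentiableAt.mul ?_ ?_
    · exact (differentiableAt_det_entries fun i j => (hA i j).differentiableAt).inv h0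
    · refine differentiableAt_det_entries fun k l => ?_
      by_cases hk : k = j
      · subst hk; simp
      · simp only [Matrix.updateRow_ne hk]; exact (hA k l).differentiableAt
  set D : Matrix (Fin n) (Fin n) ℝ := Matrix.of fun i j => deriv (fun t => (A t)⁻¹ i j) 0 with hD
  have hinv : MDeriv (fun t => (A t)⁻¹) D := fun i j => (hd i j).hasDerivAt
  have hprod := hA.mul hinv
  have hz : A' * (A 0)⁻¹ + A 0 * D = 0 := by
    ext i j
    have h1 := hprod i j
    have h2 : HasDerivAt (fun t => (A t * (A t)⁻¹) i j) 0 0 := by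
      refine (hasDerivAt_const (0 : ℝ) ((1 : Matrix (Fin n) (Fin n) ℝ) i j)).congr_of_eventuallyEq ?_
      filter_upwards [hA.det_ne_zero h0] with t ht
      rw [Matrix.mul_nonsing_inv _ (isUnit_iff_ne_zero.2 ht)]
    exact h1.unique h2
  have hDe : D = -((A 0)⁻¹ * A' * (A 0)⁻¹) := by
    have hu := Matrix.nonsing_inv_mul (A 0) (isUnit_iff_ne_zero.2 h0)
    have : (A 0)⁻¹ * (A' * (A 0)⁻¹ + A 0 * D) = 0 := by rw [hz, mul_zero]
    rw [mul_add, ← mul_assoc, ← mul_assoc, hu, one_mul] at this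
    exact eq_neg_of_add_eq_zero_right this
  rw [← hDe]; exact hinv

theorem hasDerivAt_det (hA : MDeriv A A') (h0 : (A 0).det ≠ 0) :
    HasDerivAt (fun t => (A t).det) ((A 0).det * ((A 0)⁻¹ * A').trace) 0 := by
  have hdet : Differentiable ℝ (fun X : Fin n → Fin n → ℝ => (Matrix.of X).det) := by
    intro X
    simp only [Matrix.det_apply]
    refine DifferentiableAt.fun_sum fun σ _ => ?_
    refine DifferentiableAt.const_smul ?_ _
    have : ContDiff ℝ 1 fun X : Fin n → Fin n → ℝ => ∏ i, X (σ i) i :=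
      contDiff_prod fun i _ => by fun_prop
    exact this.differentiable (by norm_num) X
  have curve : ∀ {C : ℝ → Matrix (Fin n) (Fin n) ℝ}, MDeriv C A' → C 0 = A 0 →
      HasDerivAt (fun t => (C t).det)
        (fderiv ℝ (fun X : Fin n → Fin n → ℝ => (Matrix.of X).det) (A 0) A') 0 := by
    intro C hC h
    have h1 : HasDerivAt (fun t => (fun i j => C t i j : Fin n → Fin n → ℝ)) A' 0 :=
      hasDerivAt_pi.2 fun i => hasDerivAt_pi.2 fun j => hC i j
    have h2 := (hdet (fun i j => C 0 i j)).hasFDerivAt.comp_hasDerivAt 0 h1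
    rw [h] at h2
    exact h2
  have hlin : MDeriv (fun t => A 0 + t • A') A' := by
    intro i j
    simpa using ((hasDerivAt_id (0 : ℝ)).mul_const (A' i j)).const_add (A 0 i j)
  have e1 := curve hlin (by simp)
  have e2 : HasDerivAt (fun t : ℝ => (A 0 + t • A').det)
      ((A 0).det * ((A 0)⁻¹ * A').trace) 0 := by
    have hu := Matrix.mul_nonsing_inv (A 0) (isUnit_iff_ne_zero.2 h0)
    have : ∀ t : ℝ, (A 0 + t • A').det = (A 0).det * (1 + t • ((A 0)⁻¹ * A')).det := by
      intro t
      rw [← Matrix.det_mul, mul_add, mul_one, mul_smul_comm, ← mul_assoc, hu, one_mul]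
    simp only [this]
    refine HasDerivAt.const_mul _ ?_
    generalize (A 0)⁻¹ * A' = Y
    set p := (1 + (Polynomial.X : Polynomial ℝ) • Y.map Polynomial.C).det with hp
    have hpe : ∀ t : ℝ, (1 + t • Y).det = p.eval t := by
      intro t
      rw [hp, ← Polynomial.coe_evalRingHom, RingHom.map_det]
      congr 1
      ext i j
      simp only [Matrix.add_apply, Matrix.smul_apply, RingHom.mapMatrix_apply, Matrix.map_apply,
        smul_eq_mul, Polynomial.coe_evalRingHom, Polynomial.eval_add, Polynomial.eval_mul,
        Polynomial.eval_X, Polynomial.eval_C, Matrix.one_apply]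
      split_ifs <;> simp
    simp only [hpe]
    have := p.hasDerivAt 0
    rwa [hp, Matrix.derivative_det_one_add_X_smul] at this
  rw [← e1.unique e2]
  exact curve hA rfl

theorem hasDerivAt_log_det (hA : MDeriv A A') (h0 : (A 0).det ≠ 0) :
    HasDerivAt (fun t => Real.log (A t).det) ((A 0)⁻¹ * A').trace 0 := by
  refine ((hA.hasDerivAt_det h0).log h0).congr_deriv ?_
  field_simp

end MDeriv

section symmetry
variable {n : ℕ} {f : (Fin n → ℝ) → ℝ}

theorem pd3_swap12 (hf : ContDiff ℝ 2 f) (i j k : Fin n) : pd3 f i j k = pd3 f j i k := by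
  unfold pd3; rw [pd2_symm hf]

theorem pd3_swap23 (hf : ContDiff ℝ 3 f) (i j k : Fin n) : pd3 f i j k = pd3 f i k j :=
  pd2_symm (f := pd f i) (contDiff_pd hf (by norm_num) i) j k

theorem pd4_swap12 (hf : ContDiff ℝ 2 f) (i j k l : Fin n) : pd4 f i j k l = pd4 f j i k l := by
  unfold pd4; rw [pd3_swap12 hf]

theorem pd4_swap23 (hf : ContDiff ℝ 3 f) (i j k l : Fin n) : pd4 f i j k l = pd4 f i k j l := by
  unfold pd4; rw [pd3_swap23 hf]

theorem contDiff_pd2 {k m : WithTop ℕ∞} (hf : ContDiff ℝ m f)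
    (hk : k + 1 + 1 ≤ m) (i j : Fin n) : ContDiff ℝ k (pd2 f i j) :=
  contDiff_pd (contDiff_pd hf hk i) le_rfl j

theorem contDiff_pd3 {k m : WithTop ℕ∞} (hf : ContDiff ℝ m f)
    (hk : k + 1 + 1 + 1 ≤ m) (i j l : Fin n) : ContDiff ℝ k (pd3 f i j l) :=
  contDiff_pd (contDiff_pd2 hf hk i j) le_rfl l

theorem contDiff_pd4 {k m : WithTop ℕ∞} (hf : ContDiff ℝ m f)
    (hk : k + 1 + 1 + 1 + 1 ≤ m) (i j l r : Fin n) : ContDiff ℝ k (pd4 f i j l r) :=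
  contDiff_pd (contDiff_pd3 hf hk i j l) le_rfl r

theorem pd4_swap34 (hf : ContDiff ℝ 4 f) (i j k l : Fin n) : pd4 f i j k l = pd4 f i j l k :=
  pd2_symm (f := pd2 f i j) (contDiff_pd2 hf (by norm_num) i j) k l

theorem pd5_swap23 (hf : ContDiff ℝ 3 f) (i j k l m : Fin n) :
    pd5 f i j k l m = pd5 f i k j l m := by
  unfold pd5; rw [pd4_swap23 hf]

theorem pd5_swap34 (hf : ContDiff ℝ 4 f) (i j k l m : Fin n) :
    pd5 f i j k l m = pd5 f i j l k m := by
  unfold pd5; rw [pd4_swap34 hf]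

theorem pd5_swap45 (hf : ContDiff ℝ 5 f) (i j k l m : Fin n) :
    pd5 f i j k l m = pd5 f i j k m l :=
  pd2_symm (f := pd3 f i j k) (contDiff_pd3 hf (by norm_num) i j k) l m

end symmetry

section MongeAmpere
variable {n : ℕ}

/-- The matrix of third derivatives `f_{k··}`. -/
def mat3 (f : (Fin n → ℝ) → ℝ) (k : Fin n) (x : Fin n → ℝ) : Matrix (Fin n) (Fin n) ℝ :=
  Matrix.of fun a b => pd3 f k a b x

/-- The matrix of fourth derivatives `f_{kl··}`. -/
def mat4 (f : (Fin n → ℝ) → ℝ) (k l : Fin n) (x : Fin n → ℝ) : Matrix (Fin n) (Fin n) ℝ :=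
  Matrix.of fun a b => pd4 f k l a b x

/-- The matrix of fifth derivatives `f_{klm··}`. -/
def mat5 (f : (Fin n → ℝ) → ℝ) (k l m : Fin n) (x : Fin n → ℝ) : Matrix (Fin n) (Fin n) ℝ :=
  Matrix.of fun a b => pd5 f k l m a b x

variable {Φ V : (Fin n → ℝ) → ℝ}

theorem mDeriv_hess (hΦ : ContDiff ℝ 3 Φ) (x : Fin n → ℝ) (l : Fin n) :
    MDeriv (fun t : ℝ => hess Φ (x + t • Pi.single l 1)) (mat3 Φ l x) := by
  intro a b
  have := hasDerivAt_coord (f := pd2 Φ a b) (x := x) l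
    (((contDiff_pd2 hΦ (k := 1) (by norm_num) a b).differentiable (by norm_num)) x)
  simp only [hess, mat3, Matrix.of_apply]
  rw [pd3_swap12 (hΦ.of_le (by norm_num)), pd3_swap23 hΦ]
  exact this

theorem mDeriv_mat3 (hΦ : ContDiff ℝ 4 Φ) (x : Fin n → ℝ) (k l : Fin n) :
    MDeriv (fun t : ℝ => mat3 Φ k (x + t • Pi.single l 1)) (mat4 Φ k l x) := by
  intro a b
  have := hasDerivAt_coord (f := pd3 Φ k a b) (x := x) l
    (((contDiff_pd3 hΦ (k := 1) (by norm_num) k a b).differentiable (by norm_num)) x)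
  simp only [mat3, mat4, Matrix.of_apply]
  rw [pd4_swap23 (hΦ.of_le (by norm_num)), pd4_swap34 hΦ]
  exact this

theorem mDeriv_mat4 (hΦ : ContDiff ℝ 5 Φ) (x : Fin n → ℝ) (k l m : Fin n) :
    MDeriv (fun t : ℝ => mat4 Φ k l (x + t • Pi.single m 1)) (mat5 Φ k l m x) := by
  intro a b
  have := hasDerivAt_coord (f := pd4 Φ k l a b) (x := x) m
    (((contDiff_pd4 hΦ (k := 1) (by norm_num) k l a b).differentiable (by norm_num)) x)
  simp only [mat4, mat5, Matrix.of_apply]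
  rw [pd5_swap34 (hΦ.of_le (by norm_num)), pd5_swap45 hΦ]
  exact this

variable {Q : Matrix (Fin n) (Fin n) ℝ} {C : ℝ}

/-- First derivative of the logarithmic Monge–Ampère equation. -/
theorem pd_of_mongeAmpere (hΦ : ContDiff ℝ 5 Φ) (hV : ContDiff ℝ 3 V) (hQ : Q.IsSymm)
    (hdet : ∀ x, (hess Φ x).det ≠ 0)
    (hMA : ∀ x, V x = C + qform Q (grad Φ x) - Real.log (hess Φ x).det) (k : Fin n)
    (x : Fin n → ℝ) :
    pd V k x = 2 * ∑ b, ∑ j, Q b j * (pd Φ j x * pd2 Φ b k x)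
      - ((hess Φ x)⁻¹ * mat3 Φ k x).trace := by
  refine pd_eq_of_hasDerivAt ((hV.differentiable (by norm_num)) x) ?_
  simp only [hMA]
  have h1 := (mDeriv_hess (hΦ.of_le (by norm_num)) x k).hasDerivAt_log_det (by simpa using hdet x)
  simp only [zero_smul, add_zero] at h1
  refine HasDerivAt.sub ?_ h1
  have hg : ∀ j, HasDerivAt (fun t : ℝ => pd Φ j (x + t • Pi.single k 1)) (pd2 Φ j k x) 0 :=
    fun j => hasDerivAt_coord k
      (((contDiff_pd hΦ (k := 1) (by norm_num) j).differentiable (by norm_num)) x)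
  have h2 : HasDerivAt (fun t : ℝ => qform Q (grad Φ (x + t • Pi.single k 1)))
      (∑ i, ∑ j, (Q i j * pd2 Φ j k x * pd Φ i x + Q i j * pd Φ j x * pd2 Φ i k x)) 0 := by
    unfold qform grad
    refine HasDerivAt.fun_sum fun i _ => HasDerivAt.fun_sum fun j _ => ?_
    have := ((hg j).const_mul (Q i j)).mul (hg i)
    simp only [zero_smul, add_zero] at this
    exact this
  refine (h2.const_add C).congr_deriv ?_
  simp only [Finset.sum_add_distrib]
  have : ∑ i, ∑ j, Q i j * pd2 Φ j k x * pd Φ i x = ∑ i, ∑ j, Q i j * pd Φ j x * pd2 Φ i k x := by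
    rw [Finset.sum_comm]
    refine Finset.sum_congr rfl fun i _ => Finset.sum_congr rfl fun j _ => ?_
    rw [hQ.apply]; ring
  rw [this, ← two_mul]
  simp only [mul_assoc]

/-- Second derivative of the logarithmic Monge–Ampère equation. -/
theorem pd2_of_mongeAmpere (hΦ : ContDiff ℝ 5 Φ) (hV : ContDiff ℝ 3 V) (hQ : Q.IsSymm)
    (hdet : ∀ x, (hess Φ x).det ≠ 0)
    (hMA : ∀ x, V x = C + qform Q (grad Φ x) - Real.log (hess Φ x).det) (k l : Fin n)
    (x : Fin n → ℝ) :
    pd2 V k l x = 2 * ∑ b, ∑ j, Q b j * (pd2 Φ j l x * pd2 Φ b k x + pd Φ j x * pd3 Φ b k l x)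
      + ((hess Φ x)⁻¹ * mat3 Φ l x * (hess Φ x)⁻¹ * mat3 Φ k x).trace
      - ((hess Φ x)⁻¹ * mat4 Φ k l x).trace := by
  unfold pd2
  refine pd_eq_of_hasDerivAt
    (((contDiff_pd hV (k := 2) (by norm_num) k).differentiable (by norm_num)) x) ?_
  simp only [pd_of_mongeAmpere hΦ hV hQ hdet hMA]
  have h1 := ((mDeriv_hess (hΦ.of_le (by norm_num)) x l).inv (by simpa using hdet x)).mul
    (mDeriv_mat3 (hΦ.of_le (by norm_num)) x k l)
  have h1 := h1.trace
  simp only [zero_smul, add_zero] at h1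
  have hg : ∀ j, HasDerivAt (fun t : ℝ => pd Φ j (x + t • Pi.single l 1)) (pd2 Φ j l x) 0 :=
    fun j => hasDerivAt_coord l
      (((contDiff_pd hΦ (k := 1) (by norm_num) j).differentiable (by norm_num)) x)
  have hg2 : ∀ j, HasDerivAt (fun t : ℝ => pd2 Φ j k (x + t • Pi.single l 1)) (pd3 Φ j k l x) 0 :=
    fun j => hasDerivAt_coord l
      (((contDiff_pd2 hΦ (k := 1) (by norm_num) j k).differentiable (by norm_num)) x)
  have h2 : HasDerivAt (fun t : ℝ => ∑ b, ∑ j, Q b j *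
        (pd Φ j (x + t • Pi.single l 1) * pd2 Φ b k (x + t • Pi.single l 1)))
      (∑ b, ∑ j, Q b j * (pd2 Φ j l x * pd2 Φ b k x + pd Φ j x * pd3 Φ b k l x)) 0 := by
    refine HasDerivAt.fun_sum fun i _ => HasDerivAt.fun_sum fun j _ => ?_
    have := ((hg j).mul (hg2 i)).const_mul (Q i j)
    simp only [zero_smul, add_zero] at this
    exact this
  refine ((h2.const_mul 2).sub h1).congr_deriv ?_
  simp only [neg_mul, Matrix.trace_add, Matrix.trace_neg, pd2]
  ring

/-- Third derivative of the logarithmic Monge–Ampère equation at a point with unit Hessian. -/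
theorem pd3_of_mongeAmpere (hΦ : ContDiff ℝ 5 Φ) (hV : ContDiff ℝ 3 V) (hQ : Q.IsSymm)
    (hdet : ∀ x, (hess Φ x).det ≠ 0)
    (hMA : ∀ x, V x = C + qform Q (grad Φ x) - Real.log (hess Φ x).det) (k l m : Fin n)
    (x : Fin n → ℝ) (h1 : hess Φ x = 1) :
    pd3 V k l m x = 2 * ∑ b, (Q b k * pd3 Φ b l m x + Q b l * pd3 Φ b k m x + Q b m * pd3 Φ b k l x)
      + ∑ b, (2 * ∑ j, Q b j * pd Φ j x) * pd4 Φ b k l m x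
      - (mat3 Φ m x * mat3 Φ l x * mat3 Φ k x).trace - (mat3 Φ l x * mat3 Φ m x * mat3 Φ k x).trace
      + (mat4 Φ l m x * mat3 Φ k x).trace + (mat3 Φ l x * mat4 Φ k m x).trace
      + (mat3 Φ m x * mat4 Φ k l x).trace - (mat5 Φ k l m x).trace := by
  unfold pd3
  refine pd_eq_of_hasDerivAt
    (((contDiff_pd2 hV (k := 1) (by norm_num) k l).differentiable (by norm_num)) x) ?_
  simp only [pd2_of_mongeAmpere hΦ hV hQ hdet hMA]
  have hN := (mDeriv_hess (hΦ.of_le (by norm_num)) x m).inv (by simpa using hdet x)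
  have ht1 := (hN.mul (mDeriv_mat4 hΦ x k l m)).trace
  have ht2 := (((hN.mul (mDeriv_mat3 (hΦ.of_le (by norm_num)) x l m)).mul hN).mul
    (mDeriv_mat3 (hΦ.of_le (by norm_num)) x k m)).trace
  simp only [zero_smul, add_zero, h1, inv_one, one_mul, mul_one] at ht1 ht2
  have hg : ∀ j, HasDerivAt (fun t : ℝ => pd Φ j (x + t • Pi.single m 1)) (pd2 Φ j m x) 0 :=
    fun j => hasDerivAt_coord m
      (((contDiff_pd hΦ (k := 1) (by norm_num) j).differentiable (by norm_num)) x)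
  have hg2 : ∀ j k, HasDerivAt (fun t : ℝ => pd2 Φ j k (x + t • Pi.single m 1)) (pd3 Φ j k m x) 0 :=
    fun j k => hasDerivAt_coord m
      (((contDiff_pd2 hΦ (k := 1) (by norm_num) j k).differentiable (by norm_num)) x)
  have hg3 : ∀ j k l,
      HasDerivAt (fun t : ℝ => pd3 Φ j k l (x + t • Pi.single m 1)) (pd4 Φ j k l m x) 0 :=
    fun j k l => hasDerivAt_coord m
      (((contDiff_pd3 hΦ (k := 1) (by norm_num) j k l).differentiable (by norm_num)) x)
  have h2 : HasDerivAt (fun t : ℝ => ∑ b, ∑ j, Q b j *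
        (pd2 Φ j l (x + t • Pi.single m 1) * pd2 Φ b k (x + t • Pi.single m 1)
          + pd Φ j (x + t • Pi.single m 1) * pd3 Φ b k l (x + t • Pi.single m 1)))
      (∑ b, ∑ j, Q b j * ((pd3 Φ j l m x * pd2 Φ b k x + pd2 Φ j l x * pd3 Φ b k m x)
        + (pd2 Φ j m x * pd3 Φ b k l x + pd Φ j x * pd4 Φ b k l m x))) 0 := by
    refine HasDerivAt.fun_sum fun i _ => HasDerivAt.fun_sum fun j _ => ?_
    have := (((hg2 j l).mul (hg2 i k)).add ((hg j).mul (hg3 i k l))).const_mul (Q i j)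
    simp only [zero_smul, add_zero] at this
    exact this
  refine (((h2.const_mul 2).add ht2).sub ht1).congr_deriv ?_
  have hδ : ∀ a b, pd2 Φ a b x = if a = b then 1 else 0 := by
    intro a b
    have := congrFun (congrFun h1 a) b
    simpa [hess, Matrix.one_apply] using this
  have e1 : ∑ b, ∑ j, Q b j * ((pd3 Φ j l m x * pd2 Φ b k x + pd2 Φ j l x * pd3 Φ b k m x)
        + (pd2 Φ j m x * pd3 Φ b k l x + pd Φ j x * pd4 Φ b k l m x))
      = ∑ b, (Q b k * pd3 Φ b l m x + Q b l * pd3 Φ b k m x + Q b m * pd3 Φ b k l x)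
        + ∑ b, (∑ j, Q b j * pd Φ j x) * pd4 Φ b k l m x := by
    simp only [hδ, mul_add, Finset.sum_add_distrib, Finset.sum_mul]
    simp only [mul_ite, ite_mul, mul_one, mul_zero, one_mul, zero_mul, Finset.sum_ite_eq',
      Finset.mem_univ, if_true]
    have : ∑ b, ∑ j, (if b = k then Q b j * pd3 Φ j l m x else 0) = ∑ b, Q b k * pd3 Φ b l m x := by
      rw [Finset.sum_comm]
      refine Finset.sum_congr rfl fun j _ => ?_
      simp [hQ.apply k j]
    rw [this]
    simp only [mul_assoc]
    ring
  rw [e1]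
  simp only [neg_mul, mul_neg, add_mul, Matrix.trace_add, Matrix.trace_neg, mul_assoc,
    ← Finset.mul_sum]
  simp only [pd3]
  ring

end MongeAmpere

section SumRearrangement
variable {ι : Type*} [Fintype ι]

theorem sum3_swap23 (f : ι → ι → ι → ℝ) :
    ∑ a, ∑ b, ∑ c, f a b c = ∑ a, ∑ b, ∑ c, f a c b :=
  Finset.sum_congr rfl fun _ _ => Finset.sum_comm

theorem sum3_swap12 (f : ι → ι → ι → ℝ) :
    ∑ a, ∑ b, ∑ c, f a b c = ∑ a, ∑ b, ∑ c, f b a c :=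
  Finset.sum_comm

theorem sum3_rot (f : ι → ι → ι → ℝ) :
    ∑ a, ∑ b, ∑ c, f a b c = ∑ a, ∑ b, ∑ c, f c a b := by
  rw [sum3_swap12, sum3_swap23]

/-- The quadratic form in the fourth and third order data that appears in the second variation
of the Calabi tensor is nonnegative. -/
theorem second_variation_nonneg (A P : ι → ι → ι → ℝ)
    (hA1 : ∀ a b c, A a b c = A b a c) (hA2 : ∀ a b c, A a b c = A a c b)
    (hP : ∀ a b c, P a b c = P a c b) :
    0 ≤ ∑ p, ∑ a, ∑ b, (2 * ((A p a b - 1 / 2 * P p a b) * (A p b a - 1 / 2 * P p b a))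
        - 8 * ((A p a b - 1 / 2 * P p a b) * P b p a)
        + 2 * (P a p b * P b p a) + 4 * (P a p b * P a p b))
      + 4 * ∑ p, ∑ a, ∑ b, A p a b * P p a b
      - 4 * ∑ p, ∑ a, ∑ b, P p a b * P a p b
      - 2 * ∑ p, ∑ a, ∑ b, P p a b * P p a b := by
  have h1 : ∑ p, ∑ a, ∑ b, A p a b * P b p a = ∑ p, ∑ a, ∑ b, A p a b * P p a b := by
    rw [sum3_rot (fun p a b => A p a b * P p a b)]
    refine Finset.sum_congr rfl fun p _ => Finset.sum_congr rfl fun a _ =>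
      Finset.sum_congr rfl fun b _ => ?_
    rw [hA1 b p a, hA2 p b a]
  have h2 : ∑ p, ∑ a, ∑ b, P p a b * P b p a = ∑ p, ∑ a, ∑ b, P p a b * P a p b := by
    rw [sum3_swap23]
    refine Finset.sum_congr rfl fun p _ => Finset.sum_congr rfl fun a _ =>
      Finset.sum_congr rfl fun b _ => ?_
    rw [hP p b a]
  have h3 : ∑ p, ∑ a, ∑ b, P a p b * P b p a = ∑ p, ∑ a, ∑ b, P p a b * P a p b := by
    rw [sum3_swap12]
    refine Eq.trans ?_ h2
    refine Finset.sum_congr rfl fun p _ => Finset.sum_congr rfl fun a _ =>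
      Finset.sum_congr rfl fun b _ => ?_
    rw [hP b a p]
  have h4 : ∑ p, ∑ a, ∑ b, P a p b * P a p b = ∑ p, ∑ a, ∑ b, P p a b * P p a b :=
    sum3_swap12 _
  have h5 : ∑ p, ∑ a, ∑ b, A p a b * P a p b = ∑ p, ∑ a, ∑ b, A p a b * P p a b := by
    rw [sum3_swap12]
    refine Finset.sum_congr rfl fun p _ => Finset.sum_congr rfl fun a _ =>
      Finset.sum_congr rfl fun b _ => ?_
    rw [hA1]
  have h6 : ∑ p, ∑ a, ∑ b, P b p a * P b p a = ∑ p, ∑ a, ∑ b, P p a b * P p a b := by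
    rw [← h4, sum3_swap23]
  have key : 0 ≤ ∑ p, ∑ a, ∑ b, (2 * (A p a b - 1 / 2 * (P p a b + P a p b + P b p a)) ^ 2
      + 1 / 2 * (P p a b - P a p b) ^ 2) :=
    Finset.sum_nonneg fun p _ => Finset.sum_nonneg fun a _ => Finset.sum_nonneg fun b _ => by
      positivity
  have e1 : ∑ p, ∑ a, ∑ b, (2 * ((A p a b - 1 / 2 * P p a b) * (A p b a - 1 / 2 * P p b a))
        - 8 * ((A p a b - 1 / 2 * P p a b) * P b p a)
        + 2 * (P a p b * P b p a) + 4 * (P a p b * P a p b))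
      = 2 * ∑ p, ∑ a, ∑ b, A p a b * A p a b - 2 * ∑ p, ∑ a, ∑ b, A p a b * P p a b
        + 1 / 2 * ∑ p, ∑ a, ∑ b, P p a b * P p a b
        - 8 * ∑ p, ∑ a, ∑ b, A p a b * P b p a + 4 * ∑ p, ∑ a, ∑ b, P p a b * P b p a
        + 2 * ∑ p, ∑ a, ∑ b, P a p b * P b p a + 4 * ∑ p, ∑ a, ∑ b, P a p b * P a p b := by
    simp only [Finset.mul_sum, ← Finset.sum_add_distrib, ← Finset.sum_sub_distrib]
    refine Finset.sum_congr rfl fun p _ => Finset.sum_congr rfl fun a _ =>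
      Finset.sum_congr rfl fun b _ => ?_
    rw [hA2 p b a, hP p b a]; ring
  have e2 : ∑ p, ∑ a, ∑ b, (2 * (A p a b - 1 / 2 * (P p a b + P a p b + P b p a)) ^ 2
      + 1 / 2 * (P p a b - P a p b) ^ 2)
      = 2 * ∑ p, ∑ a, ∑ b, A p a b * A p a b - 2 * ∑ p, ∑ a, ∑ b, A p a b * P p a b
        - 2 * ∑ p, ∑ a, ∑ b, A p a b * P a p b - 2 * ∑ p, ∑ a, ∑ b, A p a b * P b p a
        + ∑ p, ∑ a, ∑ b, P p a b * P p a b + ∑ p, ∑ a, ∑ b, P a p b * P a p b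
        + 1 / 2 * ∑ p, ∑ a, ∑ b, P b p a * P b p a
        + ∑ p, ∑ a, ∑ b, P p a b * P b p a + ∑ p, ∑ a, ∑ b, P a p b * P b p a := by
    simp only [Finset.mul_sum, ← Finset.sum_add_distrib, ← Finset.sum_sub_distrib]
    refine Finset.sum_congr rfl fun p _ => Finset.sum_congr rfl fun a _ =>
      Finset.sum_congr rfl fun b _ => ?_
    ring
  rw [e2, h1, h2, h3, h4, h5, h6] at key
  rw [e1, h1, h2, h3, h4]
  linarith

end SumRearrangement

/-- Entrywise jet of a curve of matrices. -/
def MJet {n : ℕ} (A : ℝ → Matrix (Fin n) (Fin n) ℝ) (A0 A1 A2 : Matrix (Fin n) (Fin n) ℝ) : Prop :=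
  ∀ i j, HasJet (fun t => A t i j) (A0 i j) (A1 i j) (A2 i j)

/-- Entrywise jet of a curve of vectors. -/
def VJet {n : ℕ} (w : ℝ → Fin n → ℝ) (w0 w1 w2 : Fin n → ℝ) : Prop :=
  ∀ i, HasJet (fun t => w t i) (w0 i) (w1 i) (w2 i)

section Jets
variable {n : ℕ} {A B : ℝ → Matrix (Fin n) (Fin n) ℝ}
  {A0 A1 A2 B0 B1 B2 : Matrix (Fin n) (Fin n) ℝ}
  {w z : ℝ → Fin n → ℝ} {w0 w1 w2 z0 z1 z2 : Fin n → ℝ}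

theorem MJet.mul (hA : MJet A A0 A1 A2) (hB : MJet B B0 B1 B2) :
    MJet (fun t => A t * B t) (A0 * B0) (A0 * B1 + A1 * B0)
      (A0 * B2 + (2 : ℝ) • (A1 * B1) + A2 * B0) := by
  intro i j
  simp only [Matrix.mul_apply, Matrix.add_apply, Matrix.smul_apply, smul_eq_mul, Finset.mul_sum,
    ← Finset.sum_add_distrib]
  exact HasJet.sum _ fun k _ => (hA i k).mul (hB k j)

theorem MJet.trace (hA : MJet A A0 A1 A2) :
    HasJet (fun t => (A t).trace) A0.trace A1.trace A2.trace :=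
  HasJet.sum _ fun k _ => hA k k

theorem MJet.linear (A0 A1 : Matrix (Fin n) (Fin n) ℝ) : MJet (fun t => A0 + t • A1) A0 A1 0 :=
  fun i j => HasJet.linear (A0 i j) (A1 i j)

theorem MJet.const (A0 : Matrix (Fin n) (Fin n) ℝ) : MJet (fun _ => A0) A0 0 0 :=
  fun i j => HasJet.const (A0 i j)

theorem VJet.linear (w0 w1 : Fin n → ℝ) : VJet (fun t => w0 + t • w1) w0 w1 0 :=
  fun i => HasJet.linear (w0 i) (w1 i)

theorem MJet.mulVec (hA : MJet A A0 A1 A2) (hw : VJet w w0 w1 w2) :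
    VJet (fun t => (A t).mulVec (w t)) (A0.mulVec w0) (A0.mulVec w1 + A1.mulVec w0)
      (A0.mulVec w2 + (2 : ℝ) • A1.mulVec w1 + A2.mulVec w0) := by
  intro i
  simp only [Matrix.mulVec, dotProduct, Pi.add_apply, Pi.smul_apply, smul_eq_mul, Finset.mul_sum,
    ← Finset.sum_add_distrib]
  exact HasJet.sum _ fun k _ => (hA i k).mul (hw k)

theorem VJet.dot (hw : VJet w w0 w1 w2) (hz : VJet z z0 z1 z2) :
    HasJet (fun t => w t ⬝ᵥ z t) (w0 ⬝ᵥ z0) (w0 ⬝ᵥ z1 + w1 ⬝ᵥ z0)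
      (w0 ⬝ᵥ z2 + 2 * (w1 ⬝ᵥ z1) + w2 ⬝ᵥ z0) := by
  simp only [dotProduct, Finset.mul_sum, ← Finset.sum_add_distrib]
  exact HasJet.sum _ fun k _ => (hw k).mul (hz k)

theorem MJet.sum_smul {D : Fin n → ℝ → Matrix (Fin n) (Fin n) ℝ}
    {D0 D1 D2 : Fin n → Matrix (Fin n) (Fin n) ℝ} (hw : VJet w w0 w1 w2)
    (hD : ∀ k, MJet (D k) (D0 k) (D1 k) (D2 k)) :
    MJet (fun t => ∑ k, w t k • D k t) (∑ k, w0 k • D0 k) (∑ k, (w0 k • D1 k + w1 k • D0 k))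
      (∑ k, (w0 k • D2 k + (2 * w1 k) • D1 k + w2 k • D0 k)) := by
  intro i j
  simp only [Matrix.sum_apply, Matrix.add_apply, Matrix.smul_apply, smul_eq_mul]
  refine HasJet.sum _ fun k _ => ((hw k).mul (hD k i j)).congr_jet rfl rfl ?_
  ring

/-- Second order expansion of the test function for the Calabi tensor. -/
theorem hasJet_calabi_test {M : ℝ → Matrix (Fin n) (Fin n) ℝ} {M1 M2 : Matrix (Fin n) (Fin n) ℝ}
    {D : Fin n → ℝ → Matrix (Fin n) (Fin n) ℝ} {D0 D1 D2 : Fin n → Matrix (Fin n) (Fin n) ℝ}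
    {ψ : ℝ → ℝ} {ψ0 ψ1 ψ2 : ℝ} (hM : MJet M 1 M1 M2)
    (hD : ∀ k, MJet (D k) (D0 k) (D1 k) (D2 k)) (hψ : HasJet ψ ψ0 ψ1 ψ2)
    (hM1 : M1.IsSymm) {E : Matrix (Fin n) (Fin n) ℝ} (hE : E.IsSymm) (α β : ℝ)
    (v v1 : Fin n → ℝ) (X0 X1 : Matrix (Fin n) (Fin n) ℝ) :
    HasJet (fun s => α * (2 * ((∑ k, (v + s • v1) k • D k s) * (X0 + s • X1)).trace
        - (M s * (X0 + s • X1) * (M s * (X0 + s • X1))).trace)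
        + β * ((v + s • v1) ⬝ᵥ E.mulVec (v + s • v1))
        - ψ s * ((v + s • v1) ⬝ᵥ (M s).mulVec (v + s • v1)))
      (α * (2 * ((∑ k, v k • D0 k) * X0).trace - (X0 * X0).trace) + β * (v ⬝ᵥ E.mulVec v)
        - ψ0 * (v ⬝ᵥ v))
      (α * (2 * (((∑ k, v k • D0 k) * X1).trace + ((∑ k, (v k • D1 k + v1 k • D0 k)) * X0).trace)
          - 2 * (X0 * (M1 * X0 + X1)).trace) + 2 * β * (v1 ⬝ᵥ E.mulVec v)
        - (ψ1 * (v ⬝ᵥ v) + ψ0 * (v ⬝ᵥ M1.mulVec v + 2 * (v1 ⬝ᵥ v))))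
      (α * (2 * (2 * ((∑ k, (v k • D1 k + v1 k • D0 k)) * X1).trace
            + ((∑ k, (v k • D2 k + (2 * v1 k) • D1 k)) * X0).trace)
          - (2 * (X0 * (M2 * X0 + (2 : ℝ) • (M1 * X1))).trace
            + 2 * ((M1 * X0 + X1) * (M1 * X0 + X1)).trace)) + 2 * β * (v1 ⬝ᵥ E.mulVec v1)
        - (ψ2 * (v ⬝ᵥ v) + 2 * ψ1 * (v ⬝ᵥ M1.mulVec v + 2 * (v1 ⬝ᵥ v))
          + ψ0 * (v ⬝ᵥ M2.mulVec v + 4 * (v1 ⬝ᵥ M1.mulVec v) + 2 * (v1 ⬝ᵥ v1)))) := by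
  have hv := VJet.linear v v1
  have hX := MJet.linear X0 X1
  have hT := MJet.sum_smul hv hD
  have hK := hM.mul hX
  have j1 := ((hT.mul hX).trace).const_mul 2
  have j2 := (hK.mul hK).trace
  have j3 := (hv.dot ((MJet.const E).mulVec hv)).const_mul β
  have j4 := hψ.mul (hv.dot (hM.mulVec hv))
  have hEs : ∀ a b : Fin n → ℝ, a ⬝ᵥ E.mulVec b = b ⬝ᵥ E.mulVec a := by
    intro a b
    rw [Matrix.dotProduct_mulVec, ← Matrix.mulVec_transpose, hE.eq, dotProduct_comm]
  have hMs : ∀ a b : Fin n → ℝ, a ⬝ᵥ M1.mulVec b = b ⬝ᵥ M1.mulVec a := by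
    intro a b
    rw [Matrix.dotProduct_mulVec, ← Matrix.mulVec_transpose, hM1.eq, dotProduct_comm]
  refine ((((j1.sub j2).const_mul α).add j3).sub j4).congr_jet ?_ ?_ ?_
  · simp
  · simp only [one_mul, mul_add, add_mul, Matrix.trace_add, Matrix.zero_mulVec, add_zero,
      Matrix.one_mulVec, dotProduct_add, hEs v v1, dotProduct_comm v v1,
      Matrix.trace_mul_comm X1 X0, Matrix.trace_mul_comm (M1 * X0) X0]
    ring
  · simp only [one_mul, mul_add, add_mul, Matrix.trace_add, Matrix.zero_mulVec, add_zero, zero_add,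
      Matrix.one_mulVec, dotProduct_add, dotProduct_comm v v1, smul_zero, zero_smul, Pi.zero_apply,
      Matrix.mulVec_zero, mul_zero, dotProduct_zero, zero_dotProduct,
      Matrix.trace_smul, smul_eq_mul, Matrix.mul_smul, Matrix.smul_mul, dotProduct_smul,
      hMs v v1, Matrix.trace_mul_comm (M2 * X0) X0, Matrix.trace_mul_comm (M1 * X1) X0,
      Matrix.trace_mul_comm X1 (M1 * X0)]
    ring

end Jets

section CalabiAlgebra
variable {n : ℕ}

theorem sum_mul_trace_left (v : Fin n → ℝ) (A : Matrix (Fin n) (Fin n) ℝ)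
    (T : Fin n → Matrix (Fin n) (Fin n) ℝ) :
    ∑ k, v k * (A * T k).trace = (A * ∑ k, v k • T k).trace := by
  simp [Matrix.mul_sum, Matrix.trace_sum, Matrix.trace_smul]

theorem sum_mul_trace_right (v : Fin n → ℝ) (A : Matrix (Fin n) (Fin n) ℝ)
    (T : Fin n → Matrix (Fin n) (Fin n) ℝ) :
    ∑ k, v k * (T k * A).trace = ((∑ k, v k • T k) * A).trace := by
  simp [Matrix.sum_mul, Matrix.trace_sum, Matrix.trace_smul]

variable {T : Fin n → Matrix (Fin n) (Fin n) ℝ} {F : Fin n → Fin n → Matrix (Fin n) (Fin n) ℝ}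
  {D5 : Fin n → Fin n → Fin n → Matrix (Fin n) (Fin n) ℝ}
  {Q V2 t : Matrix (Fin n) (Fin n) ℝ} {V3 : Fin n → Fin n → Fin n → ℝ} {w v : Fin n → ℝ}

theorem isSymm_of_contract (hT23 : ∀ i j k, T i j k = T i k j) (ht : t = ∑ k, v k • T k) :
    t.IsSymm := by
  ext i j
  simp only [ht, Matrix.transpose_apply, Matrix.sum_apply, Matrix.smul_apply]
  exact Finset.sum_congr rfl fun k _ => by rw [hT23]

/-- Contraction of the once more differentiated Monge–Ampère equation with `v ⊗ t`. -/
theorem contract_third (hT12 : ∀ i j k, T i j k = T j i k) (hT23 : ∀ i j k, T i j k = T i k j)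
    (hF12 : ∀ i j, F i j = F j i)
    (hD5 : ∀ k l m a b, D5 k l m a b = D5 k a b l m)
    (ht : t = ∑ k, v k • T k)
    (h3 : ∀ k l m, V3 k l m = 2 * ∑ b, (Q b k * T b l m + Q b l * T b k m + Q b m * T b k l)
      + ∑ b, w b * F b k l m - (T m * T l * T k).trace - (T l * T m * T k).trace
      + (F l m * T k).trace + (T l * F k m).trace + (T m * F k l).trace - (D5 k l m).trace) :
    ∑ l, ∑ m, t l m * ∑ k, v k * V3 k l m
      = 4 * (t * (Q * t)).trace
        + 2 * ((∑ b, (Q.mulVec v) b • T b) * t).trace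
        + ∑ b, w b * ((∑ k, v k • F k b) * t).trace
        + 2 * ∑ p, ((∑ i, t p i • T i) * ∑ k, v k • F k p).trace
        + ∑ l, ∑ m, t l m * (F l m * t).trace
        - 2 * ∑ p, ((∑ i, t p i • T i) * (T p * t)).trace
        - ∑ p, ((∑ k, v k • D5 k p p) * t).trace := by
  have tsymm := isSymm_of_contract hT23 ht
  have ts : ∀ i j, t i j = t j i := fun i j => tsymm.apply j i
  have te : ∀ a b, t a b = ∑ k, v k * T k a b := by
    intro a b; simp [ht, Matrix.sum_apply]
  have split : ∀ l m, ∑ k, v k * V3 k l m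
      = 2 * (∑ b, (Q.mulVec v) b * T b l m) + 2 * (∑ b, Q b l * t b m) + 2 * (∑ b, Q b m * t b l)
        + ∑ b, w b * ∑ k, v k * F b k l m
        - (T m * T l * t).trace - (T l * T m * t).trace + (F l m * t).trace
        + (T l * ∑ k, v k • F k m).trace + (T m * ∑ k, v k • F k l).trace
        - ∑ k, v k * (D5 k l m).trace := by
    intro l m
    have e1 : ∑ k, v k * ∑ b, Q b k * T b l m = ∑ b, (Q.mulVec v) b * T b l m := by
      simp only [Finset.mul_sum, Matrix.mulVec, dotProduct, Finset.sum_mul]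
      rw [Finset.sum_comm]
      exact Finset.sum_congr rfl fun b _ => Finset.sum_congr rfl fun k _ => by ring
    have e2 : ∀ l m, ∑ k, v k * ∑ b, Q b l * T b k m = ∑ b, Q b l * t b m := by
      intro l m
      simp only [Finset.mul_sum, te]
      rw [Finset.sum_comm]
      exact Finset.sum_congr rfl fun b _ => Finset.sum_congr rfl fun k _ => by rw [hT12 b k m]; ring
    have e4 : ∑ k, v k * ∑ b, w b * F b k l m = ∑ b, w b * ∑ k, v k * F b k l m := by
      simp only [Finset.mul_sum]
      rw [Finset.sum_comm]
      exact Finset.sum_congr rfl fun b _ => Finset.sum_congr rfl fun k _ => by ring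
    simp only [h3, mul_add, mul_sub, Finset.sum_add_distrib, Finset.sum_sub_distrib]
    rw [e4]
    simp only [mul_left_comm (v _) 2, ← Finset.mul_sum, e1, e2 l m, e2 m l,
      sum_mul_trace_left, ← ht]
  have s1 : ∑ l, ∑ m, t l m * ∑ b, (Q.mulVec v) b * T b l m
      = ((∑ b, (Q.mulVec v) b • T b) * t).trace := by
    simp only [Matrix.trace, Matrix.diag_apply, Matrix.mul_apply, Matrix.sum_apply,
      Matrix.smul_apply, smul_eq_mul]
    exact Finset.sum_congr rfl fun l _ => Finset.sum_congr rfl fun m _ => by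
      rw [ts m l]; ring
  have s2 : ∑ l, ∑ m, t l m * ∑ b, Q b l * t b m = (t * (Q * t)).trace := by
    rw [Finset.sum_comm]
    simp only [Matrix.trace, Matrix.diag_apply, Matrix.mul_apply, Finset.mul_sum]
    refine Finset.sum_congr rfl fun m _ => ?_
    rw [Finset.sum_comm]
    refine Finset.sum_congr rfl fun b _ => Finset.sum_congr rfl fun l _ => ?_
    rw [ts m b]; ring
  have s3 : ∑ l, ∑ m, t l m * ∑ b, Q b m * t b l = (t * (Q * t)).trace := by
    rw [← s2, Finset.sum_comm]
    exact Finset.sum_congr rfl fun l _ => Finset.sum_congr rfl fun m _ => by rw [ts m l]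
  have s4 : ∑ l, ∑ m, t l m * ∑ b, w b * ∑ k, v k * F b k l m
      = ∑ b, w b * ((∑ k, v k • F k b) * t).trace := by
    simp only [Matrix.trace, Matrix.diag_apply, Matrix.mul_apply, Matrix.sum_apply,
      Matrix.smul_apply, smul_eq_mul]
    have : ∀ l m, t l m * ∑ b, w b * ∑ k, v k * F b k l m
        = ∑ b, w b * ((∑ k, v k * F k b l m) * t m l) := by
      intro l m
      rw [Finset.mul_sum]
      exact Finset.sum_congr rfl fun b _ => by simp only [hF12 b, ts m l]; ring
    simp only [this]
    simp only [Finset.mul_sum]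
    rw [← sum3_rot (fun b l m => w b * ((∑ k, v k * F k b l m) * t m l))]
  have s5 : ∑ l, ∑ m, t l m * (T l * T m * t).trace
      = ∑ p, ((∑ i, t p i • T i) * (T p * t)).trace := by
    rw [Finset.sum_comm]
    refine Finset.sum_congr rfl fun m _ => ?_
    rw [← sum_mul_trace_right]
    exact Finset.sum_congr rfl fun l _ => by rw [Matrix.mul_assoc, ts l m]
  have s6 : ∑ l, ∑ m, t l m * (T m * T l * t).trace
      = ∑ p, ((∑ i, t p i • T i) * (T p * t)).trace := by
    rw [← s5, Finset.sum_comm]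
    exact Finset.sum_congr rfl fun l _ => Finset.sum_congr rfl fun m _ => by rw [ts m l]
  have s8 : ∑ l, ∑ m, t l m * (T m * ∑ k, v k • F k l).trace
      = ∑ p, ((∑ i, t p i • T i) * ∑ k, v k • F k p).trace :=
    Finset.sum_congr rfl fun l _ => sum_mul_trace_right _ _ _
  have s7 : ∑ l, ∑ m, t l m * (T l * ∑ k, v k • F k m).trace
      = ∑ p, ((∑ i, t p i • T i) * ∑ k, v k • F k p).trace := by
    rw [← s8, Finset.sum_comm]
    exact Finset.sum_congr rfl fun l _ => Finset.sum_congr rfl fun m _ => by rw [ts m l]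
  have s9 : ∑ l, ∑ m, t l m * ∑ k, v k * (D5 k l m).trace
      = ∑ p, ((∑ k, v k • D5 k p p) * t).trace := by
    simp only [Matrix.trace, Matrix.diag_apply, Matrix.mul_apply, Matrix.sum_apply,
      Matrix.smul_apply, smul_eq_mul]
    have : ∀ l m, t l m * ∑ k, v k * ∑ p, D5 k l m p p
        = ∑ p, (∑ k, v k * D5 k p p l m) * t m l := by
      intro l m
      simp only [Finset.mul_sum, Finset.sum_mul]
      rw [Finset.sum_comm]
      exact Finset.sum_congr rfl fun b _ => Finset.sum_congr rfl fun k _ => by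
        rw [hD5 k l m b b, ts m l]; ring
    simp only [this]
    rw [← sum3_rot (fun p l m => (∑ k, v k * D5 k p p l m) * t m l)]
  simp only [split, mul_add, mul_sub, Finset.sum_add_distrib, Finset.sum_sub_distrib]
  simp only [mul_left_comm (t _ _) 2, ← Finset.mul_sum]
  rw [s1, s2, s3, s4, s5, s6, s7, s8, s9]
  ring

/-- Algebraic part of the maximum principle for the Calabi tensor. -/
theorem calabi_second_order_algebra {E : Matrix (Fin n) (Fin n) ℝ} {α β φ0 : ℝ}
    {φ1 φ2 : Fin n → ℝ} (hα : 0 ≤ α) (hβ : 0 ≤ β) (hE : E.PosSemidef)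
    (hT12 : ∀ i j k, T i j k = T j i k) (hT23 : ∀ i j k, T i j k = T i k j)
    (hF34 : ∀ i j k l, F i j k l = F i j l k) (hF12 : ∀ i j, F i j = F j i)
    (hF23 : ∀ i j k l, F i j k l = F i k j l)
    (hD5 : ∀ k l m a b, D5 k l m a b = D5 k a b l m)
    (ht : t = ∑ k, v k • T k) (hv : v ⬝ᵥ v = 1)
    (h2 : ∀ k l, V2 k l = 2 * Q k l + ∑ b, w b * T b k l + (T l * T k).trace - (F k l).trace)
    (h3 : ∀ k l m, V3 k l m = 2 * ∑ b, (Q b k * T b l m + Q b l * T b k m + Q b m * T b k l)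
      + ∑ b, w b * F b k l m - (T m * T l * T k).trace - (T l * T m * T k).trace
      + (F l m * T k).trace + (T l * F k m).trace + (T m * F k l).trace - (D5 k l m).trace)
    (hgrad : ∀ b, α * (2 * ((∑ k, v k • F k b) * t).trace - 2 * (t * (T b * t)).trace)
      = φ1 b + φ0 * (v ⬝ᵥ (T b).mulVec v))
    (hstat : α * ((∑ b, (Q.mulVec v) b • T b) * t).trace + β * (Q.mulVec v ⬝ᵥ E.mulVec v)
      = φ0 * (Q.mulVec v ⬝ᵥ v))
    (hsec : ∀ p (v1 : Fin n → ℝ) (X1 : Matrix (Fin n) (Fin n) ℝ), X1.IsSymm →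
      α * (2 * (2 * ((∑ k, (v k • F k p + v1 k • T k)) * X1).trace
            + ((∑ k, (v k • D5 k p p + (2 * v1 k) • F k p)) * t).trace)
          - (2 * (t * (F p p * t + (2 : ℝ) • (T p * X1))).trace
            + 2 * ((T p * t + X1) * (T p * t + X1)).trace)) + 2 * β * (v1 ⬝ᵥ E.mulVec v1)
        - (φ2 p * (v ⬝ᵥ v) + 2 * φ1 p * (v ⬝ᵥ (T p).mulVec v + 2 * (v1 ⬝ᵥ v))
          + φ0 * (v ⬝ᵥ (F p p).mulVec v + 4 * (v1 ⬝ᵥ (T p).mulVec v) + 2 * (v1 ⬝ᵥ v1))) ≤ 0) :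
    α * (2 * (t * (V2 * t)).trace + 4 * (t * (Q * t)).trace
        - 2 * ∑ l, ∑ m, t l m * ∑ k, v k * V3 k l m)
      + φ0 * (2 * (Q.mulVec v ⬝ᵥ v) + v ⬝ᵥ V2.mulVec v + 1 / 2 * (t * t).trace)
      - 4 * β * (Q.mulVec v ⬝ᵥ E.mulVec v) ≤ ∑ p, φ2 p - ∑ p, w p * φ1 p := by
  have tsymm := isSymm_of_contract hT23 ht
  have ts : ∀ i j, t i j = t j i := fun i j => tsymm.apply j i
  have te : ∀ a b, t a b = ∑ k, v k * T k a b := by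
    intro a b; simp [ht, Matrix.sum_apply]
  have hTsymm : ∀ p, (T p).IsSymm := fun p => by ext i j; exact hT23 p j i
  have hTv : ∀ p, (T p).mulVec v = fun i => t p i := by
    intro p; funext i
    simp only [Matrix.mulVec, dotProduct, te]
    exact Finset.sum_congr rfl fun k _ => by rw [mul_comm, hT23 p i k, hT12 p k i]
  set Fv : Fin n → Matrix (Fin n) (Fin n) ℝ := fun p => ∑ k, v k • F k p with hFv
  set P : Fin n → Matrix (Fin n) (Fin n) ℝ := fun p => ∑ i, t p i • T i with hP
  have hFvsymm : ∀ p, (Fv p).IsSymm := fun p => by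
    ext i j
    simp only [hFv, Matrix.transpose_apply, Matrix.sum_apply, Matrix.smul_apply]
    exact Finset.sum_congr rfl fun k _ => by rw [hF34]
  have hPsymm : ∀ p, (P p).IsSymm := fun p => isSymm_of_contract hT23 rfl
  set B : Fin n → Matrix (Fin n) (Fin n) ℝ := fun p => Fv p - (1 / 2 : ℝ) • P p with hB
  have hBsymm : ∀ p, (B p).IsSymm := fun p => (hFvsymm p).sub ((hPsymm p).smul _)
  have hB' : ∀ p, ∑ k, (v k • F k p + (-(1 / 2 : ℝ) * t p k) • T k) = B p := by
    intro p
    simp only [hB, hFv, hP, Finset.sum_add_distrib, Finset.smul_sum, smul_smul, sub_eq_add_neg,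
      ← Finset.sum_neg_distrib, ← neg_smul, neg_mul]
  have hPt : ∀ p a b, (t * T p) a b = P a p b := by
    intro p a b
    simp only [hP, Matrix.mul_apply, Matrix.sum_apply, Matrix.smul_apply, smul_eq_mul]
    exact Finset.sum_congr rfl fun k _ => by rw [hT12 p k b]
  have htT : ∀ p, (t * T p)ᵀ = T p * t := fun p => by
    rw [Matrix.transpose_mul, tsymm.eq, (hTsymm p).eq]
  -- the second order inequality along the chosen variation
  have hp : ∀ p, α * (2 * ((∑ k, v k • D5 k p p) * t).trace
        - 2 * ∑ k, t p k * (F k p * t).trace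
        - 2 * (t * (F p p * t)).trace
        + (2 * (B p * B p).trace - 8 * (B p * (t * T p)).trace
          + 2 * ((t * T p) * (t * T p)).trace + 4 * ((t * T p) * (T p * t)).trace))
      - φ2 p - φ0 * (v ⬝ᵥ (F p p).mulVec v - 3 / 2 * ∑ i, t p i * t p i) ≤ 0 := by
    intro p
    have hXs : (B p - t * T p - T p * t).IsSymm := by
      unfold Matrix.IsSymm
      rw [Matrix.transpose_sub, Matrix.transpose_sub, htT, (hBsymm p).eq, ← htT p,
        Matrix.transpose_transpose]
      abel
    have := hsec p (fun i => -(1 / 2 : ℝ) * t p i) _ hXs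
    rw [hB' p] at this
    have c1 : ∑ k, (v k • D5 k p p + (2 * (-(1 / 2 : ℝ) * t p k)) • F k p)
        = ∑ k, v k • D5 k p p - ∑ k, t p k • F k p := by
      rw [← Finset.sum_sub_distrib]
      refine Finset.sum_congr rfl fun k _ => ?_
      rw [show 2 * (-(1 / 2 : ℝ) * t p k) = - t p k by ring, neg_smul, sub_eq_add_neg]
    have c2 : T p * t + (B p - t * T p - T p * t) = B p - t * T p := by abel
    have c3 : (fun i => -(1 / 2 : ℝ) * t p i) ⬝ᵥ v = -(1 / 2) * (v ⬝ᵥ (T p).mulVec v) := by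
      rw [hTv]; simp only [dotProduct, Finset.mul_sum]
      exact Finset.sum_congr rfl fun k _ => by ring
    have c4 : (fun i => -(1 / 2 : ℝ) * t p i) ⬝ᵥ (T p).mulVec v
        = -(1 / 2) * ∑ i, t p i * t p i := by
      rw [hTv]; simp only [dotProduct, Finset.mul_sum]
      exact Finset.sum_congr rfl fun k _ => by ring
    have c5 : (fun i => -(1 / 2 : ℝ) * t p i) ⬝ᵥ (fun i => -(1 / 2 : ℝ) * t p i)
        = 1 / 4 * ∑ i, t p i * t p i := by
      simp only [dotProduct, Finset.mul_sum]
      exact Finset.sum_congr rfl fun k _ => by ring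
    have c6 : 0 ≤ 2 * β * ((fun i => -(1 / 2 : ℝ) * t p i) ⬝ᵥ
        E.mulVec (fun i => -(1 / 2 : ℝ) * t p i)) := by
      have := hE.dotProduct_mulVec_nonneg (fun i => -(1 / 2 : ℝ) * t p i)
      rw [star_trivial] at this
      positivity
    rw [c1, c2, c3, c4, c5, hv] at this
    have tr : ∀ X Y : Matrix (Fin n) (Fin n) ℝ, (X * Y).trace = (Yᵀ * Xᵀ).trace := by
      intro X Y; rw [← Matrix.transpose_mul, Matrix.trace_transpose]
    have d1 : (B p * (T p * t)).trace = (B p * (t * T p)).trace := by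
      rw [tr, ← htT, Matrix.transpose_transpose, (hBsymm p).eq, Matrix.trace_mul_comm]
    have d2 : (t * (T p * (T p * t))).trace = (t * T p * (T p * t)).trace := by
      rw [Matrix.mul_assoc]
    have d3 : (t * (T p * B p)).trace = (B p * (t * T p)).trace := by
      rw [← Matrix.mul_assoc, Matrix.trace_mul_comm]
    have d4 : (t * (T p * (t * T p))).trace = (t * T p * (t * T p)).trace := by
      rw [Matrix.mul_assoc]
    have d5 : (t * T p * B p).trace = (B p * (t * T p)).trace := Matrix.trace_mul_comm _ _
    have d6 : ((∑ k, t p k • F k p) * t).trace = ∑ k, t p k * (F k p * t).trace :=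
      (sum_mul_trace_right _ _ _).symm
    simp only [mul_sub, sub_mul, mul_add, Matrix.trace_add, Matrix.trace_sub, Matrix.trace_smul,
      Matrix.mul_smul, smul_eq_mul, smul_sub, d1, d2, d3, d4, d5, d6]
      at this
    linarith
  have hsum : ∑ p, (α * (2 * ((∑ k, v k • D5 k p p) * t).trace
        - 2 * ∑ k, t p k * (F k p * t).trace
        - 2 * (t * (F p p * t)).trace
        + (2 * (B p * B p).trace - 8 * (B p * (t * T p)).trace
          + 2 * ((t * T p) * (t * T p)).trace + 4 * ((t * T p) * (T p * t)).trace))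
      - φ2 p - φ0 * (v ⬝ᵥ (F p p).mulVec v - 3 / 2 * ∑ i, t p i * t p i)) ≤ 0 :=
    Finset.sum_nonpos fun p _ => hp p
  -- the trace of the fourth derivatives
  have hF0 : ∀ k l, ∑ p, F p p k l = 2 * Q k l + ∑ b, w b * T b k l + (T l * T k).trace - V2 k l := by
    intro k l
    rw [h2 k l]
    have : ∑ p, F p p k l = (F k l).trace := by
      simp only [Matrix.trace, Matrix.diag_apply]
      refine Finset.sum_congr rfl fun p _ => ?_
      rw [hF23 p p k l, hF12 p k, hF34 k p p l, hF23 k p l p]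
    rw [this]; ring
  set Gm : Matrix (Fin n) (Fin n) ℝ := Matrix.of fun k l => (T l * T k).trace with hGm
  have hF0m : ∑ p, F p p = (2 : ℝ) • Q + ∑ b, w b • T b + Gm - V2 := by
    ext k l
    simp [Matrix.sum_apply, hF0, hGm]
  have a1 : ∑ p, (t * (F p p * t)).trace = 2 * (t * (Q * t)).trace
      + ∑ b, w b * (t * (T b * t)).trace + ∑ p, (P p * P p).trace - (t * (V2 * t)).trace := by
    have : ∑ p, (t * (F p p * t)).trace = (t * ((∑ p, F p p) * t)).trace := by
      simp [Matrix.sum_mul, Matrix.mul_sum, Matrix.trace_sum]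
    rw [this, hF0m]
    have g1 : (t * (Gm * t)).trace = ∑ p, (P p * P p).trace := by
      have : ∀ p, (P p * P p).trace = ∑ i, t p i * ∑ j, t p j * (T j * T i).trace := by
        intro p
        rw [hP]
        simp only []
        rw [← sum_mul_trace_left]
        exact Finset.sum_congr rfl fun i _ => by rw [sum_mul_trace_right]
      have e : (t * (Gm * t)).trace = ∑ p, ∑ i, t p i * ∑ j, Gm i j * t j p := by
        simp only [Matrix.trace, Matrix.diag_apply, Matrix.mul_apply]
      rw [e]
      refine Finset.sum_congr rfl fun p _ => ?_
      rw [this]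
      refine Finset.sum_congr rfl fun i _ => ?_
      congr 1
      exact Finset.sum_congr rfl fun j _ => by rw [hGm, Matrix.of_apply, ts j p, mul_comm]
    simp only [Matrix.sub_mul, Matrix.add_mul, Matrix.mul_add, Matrix.mul_sub, Matrix.trace_add,
      Matrix.trace_sub, g1, Matrix.smul_mul, Matrix.mul_smul, Matrix.trace_smul, smul_eq_mul,
      Matrix.sum_mul, Matrix.mul_sum, Matrix.trace_sum]
  have a2 : ∑ p, v ⬝ᵥ (F p p).mulVec v = 2 * (Q.mulVec v ⬝ᵥ v) + ∑ b, w b * (v ⬝ᵥ (T b).mulVec v)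
      + (t * t).trace - v ⬝ᵥ V2.mulVec v := by
    have : ∑ p, v ⬝ᵥ (F p p).mulVec v = v ⬝ᵥ (∑ p, F p p).mulVec v := by
      rw [Matrix.sum_mulVec, dotProduct_sum]
    rw [this, hF0m]
    have g1 : v ⬝ᵥ Gm.mulVec v = (t * t).trace := by
      have : (t * t).trace = ∑ i, v i * ∑ j, v j * (T j * T i).trace := by
        conv_lhs => rw [ht]
        rw [← sum_mul_trace_left]
        exact Finset.sum_congr rfl fun i _ => by rw [sum_mul_trace_right]
      rw [this]
      simp only [dotProduct, Matrix.mulVec, hGm, Matrix.of_apply]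
      exact Finset.sum_congr rfl fun i _ => by
        congr 1; exact Finset.sum_congr rfl fun j _ => by ring
    simp only [Matrix.sub_mulVec, Matrix.add_mulVec, dotProduct_add, dotProduct_sub, g1,
      Matrix.smul_mulVec, dotProduct_smul, smul_eq_mul, Matrix.sum_mulVec, dotProduct_sum,
      dotProduct_comm v (Q.mulVec v)]
  have a3 : ∑ p, ∑ i, t p i * t p i = (t * t).trace := by
    simp only [Matrix.trace, Matrix.diag_apply, Matrix.mul_apply]
    exact Finset.sum_congr rfl fun p _ => Finset.sum_congr rfl fun i _ => by rw [ts i p]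
  have a4 := contract_third hT12 hT23 hF12 hD5 ht h3
  have a5 : ∑ b, w b * (α * (2 * ((∑ k, v k • F k b) * t).trace - 2 * (t * (T b * t)).trace))
      = ∑ b, w b * (φ1 b + φ0 * (v ⬝ᵥ (T b).mulVec v)) :=
    Finset.sum_congr rfl fun b _ => by rw [hgrad]
  have a6 : ∑ l, ∑ m, t l m * (F l m * t).trace = ∑ p, ∑ k, t p k * (F k p * t).trace :=
    Finset.sum_congr rfl fun p _ => Finset.sum_congr rfl fun k _ => by rw [hF12]
  -- positivity of the remaining quadratic terms
  have hquad := second_variation_nonneg (fun p a b => Fv p a b) (fun p a b => P p a b)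
    (by
      intro a b c
      simp only [hFv, Matrix.sum_apply, Matrix.smul_apply]
      exact Finset.sum_congr rfl fun k _ => by rw [hF23 k a b c])
    (fun a b c => (hFvsymm a).apply c b) (fun a b c => (hPsymm a).apply c b)
  have q1 : ∑ p, (2 * (B p * B p).trace - 8 * (B p * (t * T p)).trace
          + 2 * ((t * T p) * (t * T p)).trace + 4 * ((t * T p) * (T p * t)).trace)
      = ∑ p, ∑ a, ∑ b, (2 * ((Fv p a b - 1 / 2 * P p a b) * (Fv p b a - 1 / 2 * P p b a))
        - 8 * ((Fv p a b - 1 / 2 * P p a b) * P b p a)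
        + 2 * (P a p b * P b p a) + 4 * (P a p b * P a p b)) := by
    refine Finset.sum_congr rfl fun p _ => ?_
    simp only [Matrix.trace, Matrix.diag_apply, Matrix.mul_apply (M := B p),
      Matrix.mul_apply (M := t * T p), Finset.mul_sum, ← Finset.sum_add_distrib,
      ← Finset.sum_sub_distrib]
    refine Finset.sum_congr rfl fun a _ => Finset.sum_congr rfl fun b _ => ?_
    rw [← htT p, Matrix.transpose_apply, hPt, hPt]
    simp [hB]
  have q2 : ∑ p, ∑ a, ∑ b, Fv p a b * P p a b = ∑ p, (P p * Fv p).trace := by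
    refine Finset.sum_congr rfl fun p _ => ?_
    simp only [Matrix.trace, Matrix.diag_apply, Matrix.mul_apply (M := P p)]
    exact Finset.sum_congr rfl fun a _ => Finset.sum_congr rfl fun b _ => by
      rw [(hFvsymm p).apply a b, mul_comm]
  have q3 : ∑ p, ∑ a, ∑ b, P p a b * P a p b = ∑ p, (P p * (T p * t)).trace := by
    refine Finset.sum_congr rfl fun p _ => ?_
    simp only [Matrix.trace, Matrix.diag_apply, Matrix.mul_apply (M := P p)]
    exact Finset.sum_congr rfl fun a _ => Finset.sum_congr rfl fun b _ => by
      rw [← htT p, Matrix.transpose_apply, hPt]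
  have q4 : ∑ p, ∑ a, ∑ b, P p a b * P p a b = ∑ p, (P p * P p).trace := by
    refine Finset.sum_congr rfl fun p _ => ?_
    simp only [Matrix.trace, Matrix.diag_apply, Matrix.mul_apply (M := P p)]
    exact Finset.sum_congr rfl fun a _ => Finset.sum_congr rfl fun b _ => by
      rw [(hPsymm p).apply a b]
  simp only [q2, q3, q4] at hquad
  rw [← q1] at hquad
  have hquad' := mul_nonneg hα hquad
  rw [Finset.sum_sub_distrib, Finset.sum_sub_distrib, ← Finset.mul_sum, ← Finset.mul_sum,
    Finset.sum_add_distrib, Finset.sum_sub_distrib, Finset.sum_sub_distrib, Finset.sum_sub_distrib,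
    ← Finset.mul_sum, ← Finset.mul_sum, ← Finset.mul_sum, ← Finset.mul_sum, a1, a2, a3] at hsum
  simp only [mul_add, mul_sub, Finset.sum_add_distrib, Finset.sum_sub_distrib,
    mul_left_comm (w _) α, mul_left_comm (w _) φ0, mul_left_comm (w _) 2, ← Finset.mul_sum] at a5
  rw [a6] at a4
  have hstat' := congrArg (fun r => 4 * r) hstat
  rw [a4]
  simp only [mul_add, mul_sub] at hsum hquad' a5 hstat' ⊢
  linarith

end CalabiAlgebra

section LocalFrame
variable {n : ℕ} {Φ V : (Fin n → ℝ) → ℝ} {Q : Matrix (Fin n) (Fin n) ℝ} {C : ℝ}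

theorem dirHess_eq_sum (f : (Fin n → ℝ) → ℝ) (v x : Fin n → ℝ) :
    dirHess f v x = ∑ k, v k • mat3 f k x := by
  ext i j
  simp [dirHess, mat3, Matrix.sum_apply]

theorem mJet_hess (hΦ : ContDiff ℝ 4 Φ) (x : Fin n → ℝ) (p : Fin n) :
    MJet (fun t : ℝ => hess Φ (x + t • Pi.single p 1)) (hess Φ x) (mat3 Φ p x)
      (mat4 Φ p p x) := by
  intro a b
  have := hasJet_coord (f := pd2 Φ a b) (contDiff_pd2 hΦ (by norm_num) a b) x p
  refine this.congr_jet rfl ?_ ?_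
  · change pd3 Φ a b p x = pd3 Φ p a b x
    rw [pd3_swap23 (hΦ.of_le (by norm_num)), pd3_swap12 (hΦ.of_le (by norm_num))]
  · change pd4 Φ a b p p x = pd4 Φ p p a b x
    rw [pd4_swap23 (hΦ.of_le (by norm_num)), pd4_swap12 (hΦ.of_le (by norm_num)),
      pd4_swap34 hΦ, pd4_swap23 (hΦ.of_le (by norm_num))]

theorem mJet_mat3 (hΦ : ContDiff ℝ 5 Φ) (x : Fin n → ℝ) (k p : Fin n) :
    MJet (fun t : ℝ => mat3 Φ k (x + t • Pi.single p 1)) (mat3 Φ k x) (mat4 Φ k p x)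
      (mat5 Φ k p p x) := by
  intro a b
  have := hasJet_coord (f := pd3 Φ k a b) (contDiff_pd3 hΦ (by norm_num) k a b) x p
  refine this.congr_jet rfl ?_ ?_
  · change pd4 Φ k a b p x = pd4 Φ k p a b x
    rw [pd4_swap34 (hΦ.of_le (by norm_num)), pd4_swap23 (hΦ.of_le (by norm_num))]
  · change pd5 Φ k a b p p x = pd5 Φ k p p a b x
    rw [pd5_swap34 (hΦ.of_le (by norm_num)), pd5_swap23 (hΦ.of_le (by norm_num)),
      pd5_swap45 hΦ, pd5_swap34 (hΦ.of_le (by norm_num))]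

theorem mat3_isSymm (hΦ : ContDiff ℝ 3 Φ) (k : Fin n) (x : Fin n → ℝ) : (mat3 Φ k x).IsSymm := by
  ext i j; simp only [mat3, Matrix.transpose_apply, Matrix.of_apply]; rw [pd3_swap23 hΦ]

theorem dirHess_isSymm (hΦ : ContDiff ℝ 3 Φ) (v : Fin n → ℝ) (x : Fin n → ℝ) :
    (dirHess Φ v x).IsSymm := by
  ext i j; simp only [dirHess, Matrix.transpose_apply, Matrix.of_apply, pd3_swap23 hΦ]

theorem tendsto_line (x d : Fin n → ℝ) : Tendsto (fun t : ℝ => x + t • d) (nhds 0) (nhds x) := by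
  have : Continuous fun t : ℝ => x + t • d := by fun_prop
  simpa using this.tendsto 0

/-- Maximum principle for the Calabi tensor at a point with unit Hessian. -/
theorem calabi_maximum_frame (hΦ : ContDiff ℝ 5 Φ) (hV : ContDiff ℝ 3 V) (hQ : Q.IsSymm)
    (hdet : ∀ x, (hess Φ x).det ≠ 0)
    (hMA : ∀ x, V x = C + qform Q (grad Φ x) - Real.log (hess Φ x).det)
    {x₀ : Fin n → ℝ} (h1 : hess Φ x₀ = 1) {φ : (Fin n → ℝ) → ℝ} {φ1 φ2 : Fin n → ℝ}
    (hφ : ∀ p, HasJet (fun t : ℝ => φ (x₀ + t • Pi.single p 1)) (φ x₀) (φ1 p) (φ2 p))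
    {α β : ℝ} (hα : 0 ≤ α) (hβ : 0 ≤ β) {E : Matrix (Fin n) (Fin n) ℝ} (hE : E.PosSemidef)
    {v : Fin n → ℝ} (hv : v ⬝ᵥ v = 1)
    (hmax : ∀ᶠ x in nhds x₀, ∀ (w : Fin n → ℝ) (X : Matrix (Fin n) (Fin n) ℝ), X.IsSymm →
      α * (2 * (dirHess Φ w x * X).trace - (hess Φ x * X * (hess Φ x * X)).trace)
        + β * (w ⬝ᵥ E.mulVec w) ≤ φ x * (w ⬝ᵥ (hess Φ x).mulVec w))
    (heq : α * (dirHess Φ v x₀ * dirHess Φ v x₀).trace + β * (v ⬝ᵥ E.mulVec v) = φ x₀) :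
    α * (2 * (dirHess Φ v x₀ * (hess V x₀ * dirHess Φ v x₀)).trace
        + 4 * (dirHess Φ v x₀ * (Q * dirHess Φ v x₀)).trace
        - 2 * (dirHess Φ v x₀ * dirHess V v x₀).trace)
      + φ x₀ * (2 * (Q.mulVec v ⬝ᵥ v) + v ⬝ᵥ (hess V x₀).mulVec v
        + 1 / 2 * (dirHess Φ v x₀ * dirHess Φ v x₀).trace)
      - 4 * β * (Q.mulVec v ⬝ᵥ E.mulVec v)
      ≤ ∑ p, φ2 p - ∑ p, (2 * ∑ j, Q p j * pd Φ j x₀) * φ1 p := by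
  set t := dirHess Φ v x₀ with ht'
  have ht : t = ∑ k, v k • mat3 Φ k x₀ := dirHess_eq_sum _ _ _
  have hts : t.IsSymm := dirHess_isSymm (hΦ.of_le (by norm_num)) v x₀
  have hEs : E.IsSymm := by simpa using hE.isHermitian
  -- second order information along coordinate lines
  have hvar : ∀ p (v1 : Fin n → ℝ) (X1 : Matrix (Fin n) (Fin n) ℝ), X1.IsSymm → _ :=
    fun p v1 X1 hX1 => (hasJet_calabi_test (h1 ▸ mJet_hess (hΦ.of_le (by norm_num)) x₀ p)
      (fun k => mJet_mat3 hΦ x₀ k p) (hφ p) (mat3_isSymm (hΦ.of_le (by norm_num)) p x₀) hEs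
      α β v v1 t X1).of_isLocalMax (by
        rw [← ht, hv]
        have e0 : α * (2 * (t * t).trace - (t * t).trace) + β * (v ⬝ᵥ E.mulVec v) - φ x₀ * 1
            = 0 := by linarith
        rw [e0]
        filter_upwards [(tendsto_line x₀ (Pi.single p 1)).eventually hmax] with s hs
        have := hs (v + s • v1) (t + s • X1) (hts.add (hX1.smul s))
        rw [dirHess_eq_sum] at this
        linarith)
  have hgrad : ∀ p, α * (2 * ((∑ k, v k • mat4 Φ k p x₀) * t).trace
        - 2 * (t * (mat3 Φ p x₀ * t)).trace) = φ1 p + φ x₀ * (v ⬝ᵥ (mat3 Φ p x₀).mulVec v) := by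
    intro p
    have := (hvar p 0 0 Matrix.isSymm_zero).1
    simp only [hv, Pi.zero_apply, zero_smul, add_zero, mul_zero, Matrix.trace_zero, zero_add,
      zero_dotProduct] at this
    linarith
  have hstat : α * ((∑ b, (Q.mulVec v) b • mat3 Φ b x₀) * t).trace
      + β * (Q.mulVec v ⬝ᵥ E.mulVec v) = φ x₀ * (Q.mulVec v ⬝ᵥ v) := by
    have hM : MJet (fun _ : ℝ => (1 : Matrix (Fin n) (Fin n) ℝ)) 1 0 0 := MJet.const _
    have := ((hasJet_calabi_test hM (fun k => MJet.const (mat3 Φ k x₀)) (HasJet.const (φ x₀))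
      Matrix.isSymm_zero hEs α β v (Q.mulVec v) t 0).of_isLocalMax (by
        rw [← ht, hv]
        have e0 : α * (2 * (t * t).trace - (t * t).trace) + β * (v ⬝ᵥ E.mulVec v) - φ x₀ * 1
            = 0 := by linarith
        rw [e0]
        refine Eventually.of_forall fun s => ?_
        have := hmax.self_of_nhds (v + s • Q.mulVec v) (t + s • 0) (by simpa using hts)
        rw [dirHess_eq_sum, h1] at this
        linarith)).1
    simp only [smul_zero, zero_add, add_zero, Matrix.trace_zero,
      Matrix.zero_mulVec, dotProduct_zero, zero_mul, mul_zero, sub_zero] at this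
    linarith
  have hD5 : ∀ k l m a b, mat5 Φ k l m x₀ a b = mat5 Φ k a b x₀ l m := by
    intro k l m a b
    simp only [mat5, Matrix.of_apply]
    rw [pd5_swap34 (hΦ.of_le (by norm_num)), pd5_swap23 (hΦ.of_le (by norm_num)),
      pd5_swap45 hΦ, pd5_swap34 (hΦ.of_le (by norm_num))]
  have h2 : ∀ k l, hess V x₀ k l = 2 * Q k l + ∑ b, (2 * ∑ j, Q b j * pd Φ j x₀) * mat3 Φ b x₀ k l
      + (mat3 Φ l x₀ * mat3 Φ k x₀).trace - (mat4 Φ k l x₀).trace := by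
    intro k l
    have := pd2_of_mongeAmpere hΦ hV hQ hdet hMA k l x₀
    rw [h1, inv_one, one_mul, one_mul, mul_one] at this
    have hd : ∀ i j, pd2 Φ i j x₀ = (1 : Matrix (Fin n) (Fin n) ℝ) i j := fun i j => by
      rw [← h1]; rfl
    simp only [hess, mat3, Matrix.of_apply] at this ⊢
    rw [this]
    simp only [hd, Matrix.one_apply, mul_add, Finset.sum_add_distrib, Finset.mul_sum,
      Finset.sum_mul]
    simp only [mul_ite, mul_one, mul_zero, mul_assoc]
    simp
  have h3 := fun k l m => pd3_of_mongeAmpere hΦ hV hQ hdet hMA k l m x₀ h1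
  have key := calabi_second_order_algebra (T := fun k => mat3 Φ k x₀)
    (F := fun k l => mat4 Φ k l x₀) (D5 := fun k l m => mat5 Φ k l m x₀) (V2 := hess V x₀)
    (V3 := fun k l m => pd3 V k l m x₀) (w := fun b => 2 * ∑ j, Q b j * pd Φ j x₀)
    (φ2 := φ2) hα hβ hE
    (fun i j k => by simp only [mat3, Matrix.of_apply]; rw [pd3_swap12 (hΦ.of_le (by norm_num))])
    (fun i j k => by simp only [mat3, Matrix.of_apply]; rw [pd3_swap23 (hΦ.of_le (by norm_num))])
    (fun i j k l => by simp only [mat4, Matrix.of_apply]; rw [pd4_swap34 (hΦ.of_le (by norm_num))])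
    (fun i j => by
      ext k l; simp only [mat4, Matrix.of_apply]; rw [pd4_swap12 (hΦ.of_le (by norm_num))])
    (fun i j k l => by simp only [mat4, Matrix.of_apply]; rw [pd4_swap23 (hΦ.of_le (by norm_num))])
    hD5 ht hv h2 h3 hgrad hstat (fun p v1 X1 hX1 => (hvar p v1 X1 hX1).2)
  have e3 : ∑ l, ∑ m, t l m * ∑ k, v k * pd3 V k l m x₀ = (t * dirHess V v x₀).trace := by
    simp only [Matrix.trace, Matrix.diag_apply, Matrix.mul_apply]
    refine Finset.sum_congr rfl fun l _ => Finset.sum_congr rfl fun m _ => ?_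
    rw [(dirHess_isSymm hV v x₀).apply l m]; rfl
  rw [e3] at key
  exact key

end LocalFrame

section LocalInverse
variable {n : ℕ} {Φ V : (Fin n → ℝ) → ℝ} {Q : Matrix (Fin n) (Fin n) ℝ} {C : ℝ}

/-- Maximum principle for the inverse Hessian at a point with unit Hessian. -/
theorem inverse_hessian_maximum_frame (hΦ : ContDiff ℝ 5 Φ) (hV : ContDiff ℝ 3 V) (hQ : Q.IsSymm)
    (hdet : ∀ x, (hess Φ x).det ≠ 0)
    (hMA : ∀ x, V x = C + qform Q (grad Φ x) - Real.log (hess Φ x).det)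
    {x₀ : Fin n → ℝ} (h1 : hess Φ x₀ = 1) {φ : (Fin n → ℝ) → ℝ} {φ1 φ2 : Fin n → ℝ}
    (hφ : ∀ p, HasJet (fun t : ℝ => φ (x₀ + t • Pi.single p 1)) (φ x₀) (φ1 p) (φ2 p))
    {α : ℝ} (hα : 0 ≤ α) {e : Fin n → ℝ}
    (hmax : ∀ᶠ x in nhds x₀, ∀ w : Fin n → ℝ,
      α * (2 * (w ⬝ᵥ e) - w ⬝ᵥ (hess Φ x).mulVec w) ≤ φ x)
    (heq : α * (e ⬝ᵥ e) = φ x₀) :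
    α * (e ⬝ᵥ (hess V x₀).mulVec e - 2 * (e ⬝ᵥ Q.mulVec e))
      ≤ ∑ p, φ2 p - ∑ p, (2 * ∑ j, Q p j * pd Φ j x₀) * φ1 p := by
  set T := fun p => mat3 Φ p x₀ with hT
  set F := fun p => mat4 Φ p p x₀ with hF
  have hTs : ∀ p, (T p).IsSymm := fun p => mat3_isSymm (hΦ.of_le (by norm_num)) p x₀
  have hvar : ∀ p (w1 : Fin n → ℝ), _ := fun p w1 =>
    (((((VJet.linear e w1).dot (VJet.linear e 0)).const_mul 2).sub
      ((VJet.linear e w1).dot ((h1 ▸ mJet_hess (hΦ.of_le (by norm_num)) x₀ p :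
        MJet (fun t : ℝ => hess Φ (x₀ + t • Pi.single p 1)) 1 (T p) (F p)).mulVec
          (VJet.linear e w1)))).const_mul α |>.sub (hφ p)).of_isLocalMax (by
        rw [Matrix.one_mulVec]
        have e0 : α * (2 * (e ⬝ᵥ e) - e ⬝ᵥ e) - φ x₀ = 0 := by linarith
        rw [e0]
        filter_upwards [(tendsto_line x₀ (Pi.single p 1)).eventually hmax] with s hs
        have := hs (e + s • w1)
        simp only [smul_zero, add_zero]
        linarith)
  have hgrad : ∀ p, - α * (e ⬝ᵥ (T p).mulVec e) = φ1 p := by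
    intro p
    have := (hvar p 0).1
    simp at this
    linarith
  have hsec : ∀ p, - α * (e ⬝ᵥ (F p).mulVec e - 2 * ((T p).mulVec e ⬝ᵥ (T p).mulVec e)) ≤ φ2 p := by
    intro p
    have := (hvar p (-(T p).mulVec e)).2
    simp only [Matrix.one_mulVec, Matrix.mulVec_neg, dotProduct_neg, neg_dotProduct, smul_neg,
      dotProduct_add, Matrix.mulVec_zero, dotProduct_zero, zero_dotProduct, mul_zero, zero_add,
      add_zero, dotProduct_smul, smul_eq_mul, neg_neg] at this
    have hs : e ⬝ᵥ (T p).mulVec ((T p).mulVec e) = (T p).mulVec e ⬝ᵥ (T p).mulVec e := by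
      rw [Matrix.dotProduct_mulVec, ← Matrix.mulVec_transpose, (hTs p).eq]
    rw [hs] at this
    linarith
  have hd : ∀ i j, pd2 Φ i j x₀ = (1 : Matrix (Fin n) (Fin n) ℝ) i j := fun i j => by
    rw [← h1]; rfl
  have h2 : ∀ k l, ∑ p, F p k l = 2 * Q k l + ∑ b, (2 * ∑ j, Q b j * pd Φ j x₀) * T b k l
      + (T l * T k).trace - hess V x₀ k l := by
    intro k l
    have := pd2_of_mongeAmpere hΦ hV hQ hdet hMA k l x₀
    rw [h1, inv_one, one_mul, one_mul, mul_one] at this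
    have e1 : ∑ p, F p k l = (mat4 Φ k l x₀).trace := by
      simp only [hF, mat4, Matrix.trace, Matrix.diag_apply, Matrix.of_apply]
      refine Finset.sum_congr rfl fun p _ => ?_
      rw [pd4_swap23 (hΦ.of_le (by norm_num)), pd4_swap12 (hΦ.of_le (by norm_num)),
        pd4_swap34 (hΦ.of_le (by norm_num)), pd4_swap23 (hΦ.of_le (by norm_num))]
    rw [e1]
    simp only [hess, hT, mat3, Matrix.of_apply] at this ⊢
    rw [this]
    simp only [hd, Matrix.one_apply, mul_add, Finset.sum_add_distrib, Finset.mul_sum,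
      Finset.sum_mul]
    simp only [mul_ite, mul_one, mul_zero, mul_assoc]
    simp
  have h2m : ∑ p, F p = (2 : ℝ) • Q + ∑ b, (2 * ∑ j, Q b j * pd Φ j x₀) • T b
      + Matrix.of (fun k l => (T l * T k).trace) - hess V x₀ := by
    ext k l
    simp [Matrix.sum_apply, h2]
  have hTe : ∀ p, (T p).mulVec e = fun i => ∑ k, e k * T k p i := by
    intro p; funext i
    simp only [Matrix.mulVec, dotProduct, hT, mat3, Matrix.of_apply]
    refine Finset.sum_congr rfl fun k _ => ?_
    rw [mul_comm, pd3_swap23 (hΦ.of_le (by norm_num)), pd3_swap12 (hΦ.of_le (by norm_num))]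
  have g1 : e ⬝ᵥ (Matrix.of fun k l => (T l * T k).trace).mulVec e
      = ∑ p, (T p).mulVec e ⬝ᵥ (T p).mulVec e := by
    have a1 : e ⬝ᵥ (Matrix.of fun k l => (T l * T k).trace).mulVec e
        = ((∑ k, e k • T k) * (∑ k, e k • T k)).trace := by
      rw [← sum_mul_trace_left]
      simp only [dotProduct, Matrix.mulVec, Matrix.of_apply]
      refine Finset.sum_congr rfl fun k _ => ?_
      rw [← sum_mul_trace_right]
      congr 1
      exact Finset.sum_congr rfl fun l _ => mul_comm _ _
    have a2 : (∑ k, e k • T k).IsSymm := by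
      rw [← dirHess_eq_sum]; exact dirHess_isSymm (hΦ.of_le (by norm_num)) e x₀
    rw [a1]
    simp only [Matrix.trace, Matrix.diag_apply, Matrix.mul_apply (M := ∑ k, e k • T k)]
    refine Finset.sum_congr rfl fun p _ => ?_
    rw [hTe]
    refine Finset.sum_congr rfl fun i _ => ?_
    rw [a2.apply p i]
    simp [Matrix.sum_apply]
  have htr : ∑ p, e ⬝ᵥ (F p).mulVec e = 2 * (e ⬝ᵥ Q.mulVec e)
      + ∑ b, (2 * ∑ j, Q b j * pd Φ j x₀) * (e ⬝ᵥ (T b).mulVec e)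
      + ∑ p, (T p).mulVec e ⬝ᵥ (T p).mulVec e - e ⬝ᵥ (hess V x₀).mulVec e := by
    rw [← dotProduct_sum, ← Matrix.sum_mulVec, h2m]
    simp only [Matrix.sub_mulVec, Matrix.add_mulVec, dotProduct_add, dotProduct_sub, g1,
      Matrix.smul_mulVec, dotProduct_smul, smul_eq_mul, Matrix.sum_mulVec, dotProduct_sum]
  have hsum := Finset.sum_le_sum fun p (_ : p ∈ Finset.univ) => hsec p
  rw [← Finset.mul_sum, Finset.sum_sub_distrib, htr, ← Finset.mul_sum] at hsum
  have hw : ∑ p, (2 * ∑ j, Q p j * pd Φ j x₀) * φ1 p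
      = - α * ∑ b, (2 * ∑ j, Q b j * pd Φ j x₀) * (e ⬝ᵥ (T b).mulVec e) := by
    rw [Finset.mul_sum]
    exact Finset.sum_congr rfl fun p _ => by rw [← hgrad]; ring
  have hnn : 0 ≤ α * ∑ p, (T p).mulVec e ⬝ᵥ (T p).mulVec e :=
    mul_nonneg hα (Finset.sum_nonneg fun p _ => by
      simpa using dotProduct_star_self_nonneg ((T p).mulVec e))
  rw [hw]
  nlinarith

end LocalInverse

/-- `φ` has gradient `a₁` and Hessian `a₂` at `x₀`, in the sense of second order jets along lines. -/
def HasLineJets {n : ℕ} (φ : (Fin n → ℝ) → ℝ) (x₀ a₁ : Fin n → ℝ)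
    (a₂ : Matrix (Fin n) (Fin n) ℝ) : Prop :=
  ∀ d, HasJet (fun t : ℝ => φ (x₀ + t • d)) (φ x₀) (a₁ ⬝ᵥ d) (d ⬝ᵥ a₂.mulVec d)

section AffineFrame
variable {n : ℕ} {f : (Fin n → ℝ) → ℝ} (x₀ : Fin n → ℝ) (R : Matrix (Fin n) (Fin n) ℝ)

theorem contDiff_comp_affine {m : WithTop ℕ∞} (hf : ContDiff ℝ m f) :
    ContDiff ℝ m (fun y => f (x₀ + R.mulVec y)) := by
  refine hf.comp (contDiff_const.add ?_)
  exact (Matrix.toLin' R).toContinuousLinearMap.contDiff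

theorem pd_sum_const_mul {g : Fin n → (Fin n → ℝ) → ℝ} (hg : ∀ a, Differentiable ℝ (g a))
    (k : Fin n → ℝ) (j : Fin n) (y : Fin n → ℝ) :
    pd (fun y => ∑ a, k a * g a y) j y = ∑ a, k a * pd (g a) j y := by
  unfold pd
  have : HasFDerivAt (fun y => ∑ a, k a * g a y) (∑ a, k a • fderiv ℝ (g a) y) y :=
    HasFDerivAt.fun_sum fun a _ => ((hg a) y).hasFDerivAt.const_mul (k a)
  rw [this.fderiv]
  simp

theorem differentiable_comp_affine (hf : Differentiable ℝ f) :
    Differentiable ℝ (fun y => f (x₀ + R.mulVec y)) := by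
  refine hf.comp ((differentiable_const _).add ?_)
  exact (Matrix.toLin' R).toContinuousLinearMap.differentiable

theorem pd2_comp_affine (hf : ContDiff ℝ 2 f) (i j : Fin n) (y : Fin n → ℝ) :
    pd2 (fun y => f (x₀ + R.mulVec y)) i j y
      = ∑ a, R a i * ∑ b, R b j * pd2 f a b (x₀ + R.mulVec y) := by
  have hd : ∀ a, Differentiable ℝ (pd f a) := fun a =>
    (contDiff_pd hf (k := 1) (by norm_num) a).differentiable (by norm_num)
  unfold pd2
  rw [show pd (fun y => f (x₀ + R.mulVec y)) i
      = fun y => ∑ a, R a i * pd f a (x₀ + R.mulVec y) from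
    funext fun y => pd_comp_affine (hf.differentiable (by norm_num)) x₀ R i y]
  rw [pd_sum_const_mul (fun a => differentiable_comp_affine x₀ R (hd a))]
  exact Finset.sum_congr rfl fun a _ => by rw [pd_comp_affine (hd a)]

theorem pd3_comp_affine (hf : ContDiff ℝ 3 f) (i j k : Fin n) (y : Fin n → ℝ) :
    pd3 (fun y => f (x₀ + R.mulVec y)) i j k y
      = ∑ a, R a i * ∑ b, R b j * ∑ c, R c k * pd3 f a b c (x₀ + R.mulVec y) := by
  have hd : ∀ a b, Differentiable ℝ (pd2 f a b) := fun a b =>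
    (contDiff_pd2 hf (k := 1) (by norm_num) a b).differentiable (by norm_num)
  have hd' : ∀ a b, Differentiable ℝ (fun y => pd2 f a b (x₀ + R.mulVec y)) := fun a b =>
    differentiable_comp_affine x₀ R (hd a b)
  unfold pd3
  rw [show pd2 (fun y => f (x₀ + R.mulVec y)) i j
      = fun y => ∑ a, R a i * ∑ b, R b j * pd2 f a b (x₀ + R.mulVec y) from
    funext fun y => pd2_comp_affine x₀ R (hf.of_le (by norm_num)) i j y]
  rw [pd_sum_const_mul (fun a => by fun_prop)]
  refine Finset.sum_congr rfl fun a _ => ?_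
  rw [pd_sum_const_mul (fun b => hd' a b)]
  congr 1
  exact Finset.sum_congr rfl fun b _ => by rw [pd_comp_affine (hd a b)]

theorem grad_comp_affine (hf : Differentiable ℝ f) (y : Fin n → ℝ) :
    grad (fun y => f (x₀ + R.mulVec y)) y = Rᵀ.mulVec (grad f (x₀ + R.mulVec y)) := by
  funext i
  simp only [grad, pd_comp_affine hf, Matrix.mulVec, dotProduct, Matrix.transpose_apply]

theorem hess_comp_affine (hf : ContDiff ℝ 2 f) (y : Fin n → ℝ) :
    hess (fun y => f (x₀ + R.mulVec y)) y = Rᵀ * hess f (x₀ + R.mulVec y) * R := by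
  ext i j
  simp only [hess, Matrix.of_apply, pd2_comp_affine x₀ R hf, Matrix.mul_assoc,
    Matrix.mul_apply (M := Rᵀ), Matrix.transpose_apply]
  refine Finset.sum_congr rfl fun a _ => ?_
  congr 1
  simp only [Matrix.mul_apply, Matrix.of_apply]
  exact Finset.sum_congr rfl fun b _ => mul_comm _ _

theorem dirHess_comp_affine (hf : ContDiff ℝ 3 f) (w y : Fin n → ℝ) :
    dirHess (fun y => f (x₀ + R.mulVec y)) w y
      = Rᵀ * dirHess f (R.mulVec w) (x₀ + R.mulVec y) * R := by
  ext i j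
  have e : ∀ k, pd3 (fun y => f (x₀ + R.mulVec y)) k i j y
      = ∑ a, R a i * ∑ b, R b j * ∑ c, R c k * pd3 f c a b (x₀ + R.mulVec y) := by
    intro k
    rw [pd3_swap12 (contDiff_comp_affine x₀ R (hf.of_le (by norm_num))),
      pd3_swap23 (contDiff_comp_affine x₀ R hf), pd3_comp_affine x₀ R hf]
    refine Finset.sum_congr rfl fun a _ => ?_
    congr 1
    refine Finset.sum_congr rfl fun b _ => ?_
    congr 1
    refine Finset.sum_congr rfl fun c _ => ?_
    rw [pd3_swap23 hf, pd3_swap12 (hf.of_le (by norm_num))]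
  simp only [dirHess, Matrix.of_apply, e, Matrix.mul_assoc,
    Matrix.mul_apply (M := Rᵀ), Matrix.transpose_apply, Matrix.mulVec, dotProduct]
  simp only [Finset.mul_sum, Finset.sum_mul, Matrix.mul_apply, Matrix.of_apply]
  rw [Finset.sum_comm]
  refine Finset.sum_congr rfl fun a _ => ?_
  rw [Finset.sum_comm]
  refine Finset.sum_congr rfl fun b _ => ?_
  rw [Finset.sum_comm]
  exact Finset.sum_congr rfl fun c _ => Finset.sum_congr rfl fun k _ => by ring

theorem qform_eq_dotProduct (Q : Matrix (Fin n) (Fin n) ℝ) (y : Fin n → ℝ) :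
    qform Q y = y ⬝ᵥ Q.mulVec y := by
  simp only [qform, dotProduct, Matrix.mulVec, Finset.mul_sum]
  exact Finset.sum_congr rfl fun i _ => Finset.sum_congr rfl fun j _ => by ring

theorem HasLineJets.coord_comp_affine {φ : (Fin n → ℝ) → ℝ} {a₁ : Fin n → ℝ}
    {a₂ : Matrix (Fin n) (Fin n) ℝ} {x₀ : Fin n → ℝ} (h : HasLineJets φ x₀ a₁ a₂) (p : Fin n) :
    HasJet (fun t : ℝ => (fun y => φ (x₀ + R.mulVec y)) (0 + t • Pi.single p 1))
      ((fun y => φ (x₀ + R.mulVec y)) 0) (Rᵀ.mulVec a₁ p) ((Rᵀ * a₂ * R) p p) := by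
  have := h (R.mulVec (Pi.single p 1))
  simp only [zero_add, Matrix.mulVec_smul, Matrix.mulVec_zero, add_zero]
  refine this.congr_jet rfl ?_ ?_
  · rw [Matrix.mulVec_single_one]
    simp only [dotProduct, Matrix.mulVec, Matrix.transpose_apply, Matrix.col_apply]
    exact Finset.sum_congr rfl fun _ _ => mul_comm _ _
  · rw [Matrix.mul_assoc, Matrix.mul_apply, Matrix.mulVec_single_one]
    simp only [dotProduct, Matrix.mulVec, Matrix.transpose_apply,
      Matrix.col_apply, Matrix.mul_apply]

open scoped MatrixOrder Matrix.Norms.L2Operator in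
/-- A frame diagonalising a positive definite matrix. -/
theorem exists_frame {M : Matrix (Fin n) (Fin n) ℝ} (hM : M.PosDef) :
    ∃ R : Matrix (Fin n) (Fin n) ℝ, IsUnit R.det ∧ Rᵀ * M * R = 1 ∧ R * Rᵀ = M⁻¹ := by
  obtain ⟨B, hB, hMB⟩ := CStarAlgebra.isStrictlyPositive_iff_eq_star_mul_self.mp
    hM.isStrictlyPositive
  rw [Matrix.star_eq_conjTranspose] at hMB
  have hBd : IsUnit B.det := (Matrix.isUnit_iff_isUnit_det B).1 hB
  rw [Matrix.conjTranspose_eq_transpose_of_trivial] at hMB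
  refine ⟨B⁻¹, ?_, ?_, ?_⟩
  · rw [Matrix.det_nonsing_inv]; simpa using hBd
  · rw [hMB, Matrix.transpose_nonsing_inv, ← Matrix.mul_assoc,
      Matrix.nonsing_inv_mul _ (by simpa using hBd), one_mul, Matrix.mul_nonsing_inv _ hBd]
  · rw [hMB, Matrix.mul_inv_rev, Matrix.transpose_nonsing_inv]

end AffineFrame

section Transfer
variable {n : ℕ} {Φ V : (Fin n → ℝ) → ℝ} {Q : Matrix (Fin n) (Fin n) ℝ} {C : ℝ}

theorem transpose_mulVec_dotProduct (A : Matrix (Fin n) (Fin n) ℝ) (x y : Fin n → ℝ) :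
    Aᵀ.mulVec x ⬝ᵥ y = x ⬝ᵥ A.mulVec y := by
  rw [Matrix.mulVec_transpose, Matrix.dotProduct_mulVec]

theorem mulVec_dotProduct (A : Matrix (Fin n) (Fin n) ℝ) (x y : Fin n → ℝ) :
    A.mulVec x ⬝ᵥ y = x ⬝ᵥ Aᵀ.mulVec y := by
  rw [← transpose_mulVec_dotProduct, Matrix.transpose_transpose]

theorem frame_conj (Q : Matrix (Fin n) (Fin n) ℝ) {R : Matrix (Fin n) (Fin n) ℝ}
    (hR : IsUnit R.det) : R * (R⁻¹ * Q * R⁻¹ᵀ) * Rᵀ = Q := by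
  rw [Matrix.mul_assoc, Matrix.mul_assoc (R⁻¹ * Q), ← Matrix.transpose_mul,
    Matrix.mul_nonsing_inv _ hR, Matrix.transpose_one, Matrix.mul_one, ← Matrix.mul_assoc,
    Matrix.mul_nonsing_inv _ hR, Matrix.one_mul]

theorem tendsto_affine (x₀ : Fin n → ℝ) (R : Matrix (Fin n) (Fin n) ℝ) :
    Tendsto (fun y => x₀ + R.mulVec y) (nhds 0) (nhds x₀) := by
  have : Continuous fun y => x₀ + R.mulVec y := by fun_prop
  simpa using this.tendsto 0

/-- The logarithmic Monge–Ampère equation in an affine frame. -/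
theorem mongeAmpere_comp_affine (hΦ : ContDiff ℝ 5 Φ) (hdet : ∀ x, (hess Φ x).det ≠ 0)
    (hMA : ∀ x, V x = C + qform Q (grad Φ x) - Real.log (hess Φ x).det)
    (x₀ : Fin n → ℝ) {R : Matrix (Fin n) (Fin n) ℝ} (hR : IsUnit R.det) (y : Fin n → ℝ) :
    V (x₀ + R.mulVec y) = (C + Real.log (R.det * R.det))
      + qform (R⁻¹ * Q * R⁻¹ᵀ) (grad (fun y => Φ (x₀ + R.mulVec y)) y)
      - Real.log (hess (fun y => Φ (x₀ + R.mulVec y)) y).det := by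
  have hR0 : R.det ≠ 0 := hR.ne_zero
  rw [hMA, hess_comp_affine x₀ R (hΦ.of_le (by norm_num)),
    grad_comp_affine x₀ R (hΦ.differentiable (by norm_num)), Matrix.det_mul, Matrix.det_mul,
    Matrix.det_transpose, show ∀ a b : ℝ, a * b * a = (a * a) * b by intros; ring,
    Real.log_mul (mul_ne_zero hR0 hR0) (hdet _), qform_eq_dotProduct, qform_eq_dotProduct,
    transpose_mulVec_dotProduct, Matrix.mulVec_mulVec, Matrix.mulVec_mulVec]
  rw [frame_conj Q hR]
  ring

theorem drift_comp_affine (hΦ : Differentiable ℝ Φ) (x₀ a₁ : Fin n → ℝ)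
    {R : Matrix (Fin n) (Fin n) ℝ} (hR : IsUnit R.det) :
    ∑ p, (2 * ∑ j, (R⁻¹ * Q * R⁻¹ᵀ) p j * pd (fun y => Φ (x₀ + R.mulVec y)) j 0)
        * Rᵀ.mulVec a₁ p = 2 * (Q.mulVec (grad Φ x₀) ⬝ᵥ a₁) := by
  have h : ∑ p, (2 * ∑ j, (R⁻¹ * Q * R⁻¹ᵀ) p j * pd (fun y => Φ (x₀ + R.mulVec y)) j 0)
        * Rᵀ.mulVec a₁ p
      = 2 * ((R⁻¹ * Q * R⁻¹ᵀ).mulVec (grad (fun y => Φ (x₀ + R.mulVec y)) 0)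
        ⬝ᵥ Rᵀ.mulVec a₁) := by
    simp only [dotProduct, Matrix.mulVec, grad, mul_assoc, ← Finset.mul_sum]
  rw [h, grad_comp_affine x₀ R hΦ, Matrix.mulVec_zero, add_zero, dotProduct_comm,
    transpose_mulVec_dotProduct, dotProduct_comm, Matrix.mulVec_mulVec, Matrix.mulVec_mulVec]
  rw [frame_conj Q hR]

theorem trace_cycle (A B D : Matrix (Fin n) (Fin n) ℝ) :
    (A * B * D).trace = (D * A * B).trace := by
  rw [Matrix.trace_mul_comm, Matrix.mul_assoc]

theorem sum_frame_trace (a₂ R : Matrix (Fin n) (Fin n) ℝ) {N : Matrix (Fin n) (Fin n) ℝ}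
    (hN : R * Rᵀ = N) : ∑ p, (Rᵀ * a₂ * R) p p = (N * a₂).trace := by
  change (Rᵀ * a₂ * R).trace = _
  rw [trace_cycle, hN]

/-- Maximum principle for the Calabi tensor. -/
theorem calabi_maximum (hΦ : ContDiff ℝ 5 Φ) (hV : ContDiff ℝ 3 V) (hQ : Q.IsSymm)
    (hQpos : Q.PosDef) (hpos : ∀ x, (hess Φ x).PosDef)
    (hMA : ∀ x, V x = C + qform Q (grad Φ x) - Real.log (hess Φ x).det)
    {x₀ : Fin n → ℝ} {φ : (Fin n → ℝ) → ℝ} {a₁ : Fin n → ℝ} {a₂ : Matrix (Fin n) (Fin n) ℝ}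
    (hφ : HasLineJets φ x₀ a₁ a₂) {α β : ℝ} (hα : 0 ≤ α) (hβ : 0 ≤ β)
    {v : Fin n → ℝ} (hv : v ⬝ᵥ (hess Φ x₀).mulVec v = 1)
    (hmax : ∀ᶠ x in nhds x₀, ∀ (w : Fin n → ℝ) (X : Matrix (Fin n) (Fin n) ℝ), X.IsSymm →
      α * (2 * (dirHess Φ w x * X).trace - (hess Φ x * X * (hess Φ x * X)).trace)
        + β * (w ⬝ᵥ w) ≤ φ x * (w ⬝ᵥ (hess Φ x).mulVec w))
    {N T : Matrix (Fin n) (Fin n) ℝ} (hN : N = (hess Φ x₀)⁻¹) (hT : T = dirHess Φ v x₀)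
    (heq : α * (N * T * N * T).trace + β * (v ⬝ᵥ v) = φ x₀) :
    α * (2 * (hess V x₀ * (N * T * N * T * N)).trace - 2 * (N * T * N * dirHess V v x₀).trace)
      + φ x₀ * (2 * ((hess Φ x₀).mulVec v ⬝ᵥ Q.mulVec ((hess Φ x₀).mulVec v))
        + v ⬝ᵥ (hess V x₀).mulVec v + 1 / 2 * (N * T * N * T).trace)
      - 4 * β * (Q.mulVec ((hess Φ x₀).mulVec v) ⬝ᵥ v)
      ≤ (N * a₂).trace - 2 * (Q.mulVec (grad Φ x₀) ⬝ᵥ a₁) := by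
  obtain ⟨R, hR, hRM, hRN⟩ := exists_frame (hpos x₀)
  rw [← hN] at hRN
  have hdet : ∀ x, (hess Φ x).det ≠ 0 := fun x => (hpos x).det_pos.ne'
  have hRP := Matrix.mul_nonsing_inv _ hR
  have hPR := Matrix.nonsing_inv_mul _ hR
  have hPM : R⁻¹ᵀ * R⁻¹ = hess Φ x₀ := by
    have e1 : Rᵀ * (hess Φ x₀) = R⁻¹ := by
      rw [← Matrix.mul_one (Rᵀ * _), ← hRP, ← Matrix.mul_assoc, hRM, Matrix.one_mul]
    calc R⁻¹ᵀ * R⁻¹ = R⁻¹ᵀ * (Rᵀ * hess Φ x₀) := by rw [e1]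
      _ = hess Φ x₀ := by
        rw [← Matrix.mul_assoc, ← Matrix.transpose_mul, hRP, Matrix.transpose_one,
          Matrix.one_mul]
  have hRv : R.mulVec (R⁻¹.mulVec v) = v := by rw [Matrix.mulVec_mulVec, hRP, Matrix.one_mulVec]
  have hA0 : x₀ + R.mulVec 0 = x₀ := by simp
  have hd3 : ContDiff ℝ 3 Φ := hΦ.of_le (by norm_num)
  have hTs : T.IsSymm := hT ▸ dirHess_isSymm hd3 v x₀
  have hΦ2 := hess_comp_affine (f := Φ) x₀ R (hΦ.of_le (by norm_num))
  have hV2 := hess_comp_affine (f := V) x₀ R (hV.of_le (by norm_num))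
  have hΦ3 := dirHess_comp_affine (f := Φ) x₀ R hd3
  have hV3 := dirHess_comp_affine (f := V) x₀ R hV
  have tr2 : ∀ A B : Matrix (Fin n) (Fin n) ℝ,
      (Rᵀ * A * R * (Rᵀ * B * R)).trace = (N * A * N * B).trace := by
    intro A B
    rw [← hRN, show Rᵀ * A * R * (Rᵀ * B * R) = (Rᵀ * A * R * Rᵀ * B) * R by
      simp only [Matrix.mul_assoc], Matrix.trace_mul_comm]
    simp only [Matrix.mul_assoc]
  have tr3 : ∀ A B D : Matrix (Fin n) (Fin n) ℝ,
      (Rᵀ * A * R * (Rᵀ * B * R * (Rᵀ * D * R))).trace = (N * A * N * B * N * D).trace := by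
    intro A B D
    rw [← hRN, show Rᵀ * A * R * (Rᵀ * B * R * (Rᵀ * D * R))
      = (Rᵀ * A * R * Rᵀ * B * R * Rᵀ * D) * R by simp only [Matrix.mul_assoc],
      Matrix.trace_mul_comm]
    simp only [Matrix.mul_assoc]
  have hv' : R⁻¹.mulVec v ⬝ᵥ R⁻¹.mulVec v = 1 := by
    rw [mulVec_dotProduct, Matrix.mulVec_mulVec, hPM, hv]
  have key := calabi_maximum_frame (Φ := fun y => Φ (x₀ + R.mulVec y))
    (V := fun y => V (x₀ + R.mulVec y)) (Q := R⁻¹ * Q * R⁻¹ᵀ) (x₀ := 0)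
    (C := C + Real.log (R.det * R.det))
    (φ := fun y => φ (x₀ + R.mulVec y)) (E := Rᵀ * R) (v := R⁻¹.mulVec v) (α := α) (β := β)
    (contDiff_comp_affine x₀ R hΦ) (contDiff_comp_affine x₀ R hV)
    (by
      unfold Matrix.IsSymm
      rw [Matrix.transpose_mul, Matrix.transpose_mul, hQ.eq, Matrix.transpose_transpose,
        Matrix.mul_assoc])
    (fun y => by
      rw [hΦ2, Matrix.det_mul, Matrix.det_mul, Matrix.det_transpose]
      exact mul_ne_zero (mul_ne_zero hR.ne_zero (hdet _)) hR.ne_zero)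
    (mongeAmpere_comp_affine hΦ hdet hMA x₀ hR)
    (by rw [hΦ2, hA0, hRM]) (fun p => hφ.coord_comp_affine R p) hα hβ
    (by simpa using Matrix.posSemidef_conjTranspose_mul_self R) hv'
    (by
      filter_upwards [(tendsto_affine x₀ R).eventually hmax] with y hy w X hX
      have h := hy (R.mulVec w) (R * X * Rᵀ) (by
        unfold Matrix.IsSymm
        rw [Matrix.transpose_mul, Matrix.transpose_mul, hX.eq, Matrix.transpose_transpose,
          Matrix.mul_assoc])
      rw [hΦ2, hΦ3]
      have e1 : (Rᵀ * dirHess Φ (R.mulVec w) (x₀ + R.mulVec y) * R * X).trace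
          = (dirHess Φ (R.mulVec w) (x₀ + R.mulVec y) * (R * X * Rᵀ)).trace := by
        simp only [Matrix.mul_assoc]
        rw [Matrix.trace_mul_comm]
        simp only [Matrix.mul_assoc]
      have e2 : ∀ M : Matrix (Fin n) (Fin n) ℝ, (Rᵀ * M * R * X * (Rᵀ * M * R * X)).trace
          = (M * (R * X * Rᵀ) * (M * (R * X * Rᵀ))).trace := by
        intro M
        simp only [Matrix.mul_assoc]
        rw [Matrix.trace_mul_comm]
        simp only [Matrix.mul_assoc]
      have e3 : w ⬝ᵥ (Rᵀ * R).mulVec w = R.mulVec w ⬝ᵥ R.mulVec w := by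
        rw [mulVec_dotProduct, Matrix.mulVec_mulVec]
      have e4 : ∀ M : Matrix (Fin n) (Fin n) ℝ, w ⬝ᵥ (Rᵀ * M * R).mulVec w
          = R.mulVec w ⬝ᵥ M.mulVec (R.mulVec w) := by
        intro M
        rw [mulVec_dotProduct, Matrix.mulVec_mulVec, Matrix.mulVec_mulVec, Matrix.mul_assoc]
      rw [e1, e2, e3, e4]
      exact h)
    (by
      rw [hΦ3, hRv, hA0, ← hT, tr2, ← Matrix.mulVec_mulVec, hRv,
        ← mulVec_dotProduct, hRv]
      simpa using heq)
  rw [drift_comp_affine (hΦ.differentiable (by norm_num)) x₀ a₁ hR, sum_frame_trace a₂ R hRN,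
    hΦ3, hV2, hV3, hRv, hA0, ← hT, tr3, tr2, tr2, ← Matrix.mulVec_mulVec (M := Rᵀ), hRv] at key
  have f1 : (N * T * N * hess V x₀ * N * T).trace = (hess V x₀ * (N * T * N * T * N)).trace := by
    rw [show N * T * N * hess V x₀ * N * T = (N * T * N) * (hess V x₀ * N * T) by
      simp only [Matrix.mul_assoc], Matrix.trace_mul_comm]
    simp only [Matrix.mul_assoc]
  have f2 : R⁻¹.mulVec v ⬝ᵥ (Rᵀ * hess V x₀ * R).mulVec (R⁻¹.mulVec v)
      = v ⬝ᵥ (hess V x₀).mulVec v := by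
    rw [← Matrix.mulVec_mulVec, hRv, ← Matrix.mulVec_mulVec, ← mulVec_dotProduct, hRv]
  have f3 : (R⁻¹ * Q * R⁻¹ᵀ).mulVec (R⁻¹.mulVec v)
      = R⁻¹.mulVec (Q.mulVec ((hess Φ x₀).mulVec v)) := by
    rw [← hPM]; simp only [Matrix.mulVec_mulVec, Matrix.mul_assoc]
  have f4 : R⁻¹.mulVec (Q.mulVec ((hess Φ x₀).mulVec v)) ⬝ᵥ R⁻¹.mulVec v
      = (hess Φ x₀).mulVec v ⬝ᵥ Q.mulVec ((hess Φ x₀).mulVec v) := by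
    rw [mulVec_dotProduct, Matrix.mulVec_mulVec v R⁻¹ᵀ R⁻¹, hPM, dotProduct_comm]
  have f5 : R⁻¹.mulVec (Q.mulVec ((hess Φ x₀).mulVec v)) ⬝ᵥ Rᵀ.mulVec v
      = Q.mulVec ((hess Φ x₀).mulVec v) ⬝ᵥ v := by
    rw [← mulVec_dotProduct, Matrix.mulVec_mulVec, hRP, Matrix.one_mulVec]
  rw [f1, f2, f3, f4, f5] at key
  have hnn : 0 ≤ (Rᵀ * T * R * (R⁻¹ * Q * R⁻¹ᵀ * (Rᵀ * T * R))).trace := by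
    have e : Rᵀ * T * R * (R⁻¹ * Q * R⁻¹ᵀ * (Rᵀ * T * R)) = (T * R)ᴴ * Q * (T * R) := by
      rw [Matrix.conjTranspose_eq_transpose_of_trivial, Matrix.transpose_mul, hTs.eq]
      have e1 : R * (R⁻¹ * Q * R⁻¹ᵀ * (Rᵀ * T * R)) = Q * (T * R) := by
        rw [show R * (R⁻¹ * Q * R⁻¹ᵀ * (Rᵀ * T * R))
          = (R * R⁻¹) * Q * (R⁻¹ᵀ * Rᵀ) * (T * R) by simp only [Matrix.mul_assoc],
          ← Matrix.transpose_mul, hRP, Matrix.transpose_one, Matrix.one_mul, Matrix.mul_one]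
      rw [Matrix.mul_assoc (Rᵀ * T) R, e1, ← Matrix.mul_assoc]
    rw [e]
    exact (hQpos.posSemidef.conjTranspose_mul_mul_same (T * R)).trace_nonneg
  have := mul_nonneg hα hnn
  linarith

/-- Maximum principle for the inverse Hessian. -/
theorem inverse_hessian_maximum (hΦ : ContDiff ℝ 5 Φ) (hV : ContDiff ℝ 3 V) (hQ : Q.IsSymm)
    (hpos : ∀ x, (hess Φ x).PosDef)
    (hMA : ∀ x, V x = C + qform Q (grad Φ x) - Real.log (hess Φ x).det)
    {x₀ : Fin n → ℝ} {φ : (Fin n → ℝ) → ℝ} {a₁ : Fin n → ℝ} {a₂ : Matrix (Fin n) (Fin n) ℝ}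
    (hφ : HasLineJets φ x₀ a₁ a₂) {α : ℝ} (hα : 0 ≤ α)
    {e : Fin n → ℝ}
    (hmax : ∀ᶠ x in nhds x₀, ∀ w : Fin n → ℝ,
      α * (2 * (w ⬝ᵥ e) - w ⬝ᵥ (hess Φ x).mulVec w) ≤ φ x)
    {N : Matrix (Fin n) (Fin n) ℝ} (hN : N = (hess Φ x₀)⁻¹)
    (heq : α * (e ⬝ᵥ N.mulVec e) = φ x₀) :
    α * (N.mulVec e ⬝ᵥ (hess V x₀).mulVec (N.mulVec e) - 2 * (e ⬝ᵥ Q.mulVec e))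
      ≤ (N * a₂).trace - 2 * (Q.mulVec (grad Φ x₀) ⬝ᵥ a₁) := by
  obtain ⟨R, hR, hRM, hRN⟩ := exists_frame (hpos x₀)
  rw [← hN] at hRN
  have hdet : ∀ x, (hess Φ x).det ≠ 0 := fun x => (hpos x).det_pos.ne'
  have hRP := Matrix.mul_nonsing_inv _ hR
  have hA0 : x₀ + R.mulVec 0 = x₀ := by simp
  have hΦ2 := hess_comp_affine (f := Φ) x₀ R (hΦ.of_le (by norm_num))
  have hV2 := hess_comp_affine (f := V) x₀ R (hV.of_le (by norm_num))
  have e4 : ∀ (M : Matrix (Fin n) (Fin n) ℝ) (w : Fin n → ℝ), w ⬝ᵥ (Rᵀ * M * R).mulVec w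
      = R.mulVec w ⬝ᵥ M.mulVec (R.mulVec w) := by
    intro M w
    rw [mulVec_dotProduct, Matrix.mulVec_mulVec, Matrix.mulVec_mulVec, Matrix.mul_assoc]
  have key := inverse_hessian_maximum_frame (Φ := fun y => Φ (x₀ + R.mulVec y))
    (V := fun y => V (x₀ + R.mulVec y)) (Q := R⁻¹ * Q * R⁻¹ᵀ) (x₀ := 0)
    (C := C + Real.log (R.det * R.det))
    (φ := fun y => φ (x₀ + R.mulVec y)) (e := Rᵀ.mulVec e) (α := α)
    (contDiff_comp_affine x₀ R hΦ) (contDiff_comp_affine x₀ R hV)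
    (by
      unfold Matrix.IsSymm
      rw [Matrix.transpose_mul, Matrix.transpose_mul, hQ.eq, Matrix.transpose_transpose,
        Matrix.mul_assoc])
    (fun y => by
      rw [hΦ2, Matrix.det_mul, Matrix.det_mul, Matrix.det_transpose]
      exact mul_ne_zero (mul_ne_zero hR.ne_zero (hdet _)) hR.ne_zero)
    (mongeAmpere_comp_affine hΦ hdet hMA x₀ hR)
    (by rw [hΦ2, hA0, hRM]) (fun p => hφ.coord_comp_affine R p) hα
    (by
      filter_upwards [(tendsto_affine x₀ R).eventually hmax] with y hy w
      have h := hy (R.mulVec w)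
      rw [hΦ2, e4, ← mulVec_dotProduct]
      exact h)
    (by
      rw [transpose_mulVec_dotProduct, Matrix.mulVec_mulVec, hRN]
      simpa using heq)
  rw [drift_comp_affine (hΦ.differentiable (by norm_num)) x₀ a₁ hR, sum_frame_trace a₂ R hRN,
    hV2, e4, hA0, Matrix.mulVec_mulVec e R Rᵀ, hRN, transpose_mulVec_dotProduct,
    Matrix.mulVec_mulVec _ R, Matrix.mulVec_mulVec e _ Rᵀ, frame_conj Q hR] at key
  exact key

end Transfer

section FormBounds
variable {n : ℕ} {A P Q : Matrix (Fin n) (Fin n) ℝ}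

theorem dotProduct_self_nonneg' (x : Fin n → ℝ) : 0 ≤ x ⬝ᵥ x :=
  Finset.sum_nonneg fun i _ => mul_self_nonneg (x i)

theorem form_comm (hA : A.IsSymm) (x y : Fin n → ℝ) :
    x ⬝ᵥ A.mulVec y = y ⬝ᵥ A.mulVec x := by
  rw [dotProduct_comm, mulVec_dotProduct, hA.eq]

theorem posSemidef_form_nonneg (hA : A.PosSemidef) (x : Fin n → ℝ) : 0 ≤ x ⬝ᵥ A.mulVec x := by
  simpa using hA.dotProduct_mulVec_nonneg x

theorem posDef_isSymm (hA : A.PosDef) : A.IsSymm := by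
  simpa [Matrix.IsHermitian, Matrix.IsSymm] using hA.isHermitian

theorem form_le_eOpNorm (Q : Matrix (Fin n) (Fin n) ℝ) (y : Fin n → ℝ) :
    y ⬝ᵥ Q.mulVec y ≤ eOpNorm Q * (y ⬝ᵥ y) := by
  set L := LinearMap.toContinuousLinearMap (Matrix.toEuclideanLin Q) with hL
  set w : EuclideanSpace ℝ (Fin n) := WithLp.toLp 2 y with hw
  have h1 : inner ℝ w (L w) = y ⬝ᵥ Q.mulVec y := by
    rw [EuclideanSpace.inner_eq_star_dotProduct]
    simp [hL, hw, Matrix.toLpLin_apply, dotProduct_comm]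
  have h2 : ‖w‖ * ‖w‖ = y ⬝ᵥ y := by
    rw [← real_inner_self_eq_norm_mul_norm, EuclideanSpace.inner_eq_star_dotProduct]
    simp [hw]
  calc y ⬝ᵥ Q.mulVec y = inner ℝ w (L w) := h1.symm
    _ ≤ ‖w‖ * ‖L w‖ := real_inner_le_norm _ _
    _ ≤ ‖w‖ * (‖L‖ * ‖w‖) := by gcongr; exact L.le_opNorm w
    _ = eOpNorm Q * (y ⬝ᵥ y) := by rw [← h2]; unfold eOpNorm; ring

theorem eOpNorm_nonneg (Q : Matrix (Fin n) (Fin n) ℝ) : 0 ≤ eOpNorm Q := norm_nonneg _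

theorem form_sub_smul (hA : A.IsSymm) (x y : Fin n → ℝ) (t : ℝ) :
    (x - t • y) ⬝ᵥ A.mulVec (x - t • y)
      = x ⬝ᵥ A.mulVec x - 2 * t * (x ⬝ᵥ A.mulVec y) + t ^ 2 * (y ⬝ᵥ A.mulVec y) := by
  simp only [Matrix.mulVec_sub, Matrix.mulVec_smul, dotProduct_sub, sub_dotProduct,
    dotProduct_smul, smul_dotProduct, smul_eq_mul]
  rw [form_comm hA y x]
  ring

theorem dotProduct_sub_smul_self (x y : Fin n → ℝ) (t : ℝ) :
    (x - t • y) ⬝ᵥ (x - t • y) = x ⬝ᵥ x - 2 * t * (x ⬝ᵥ y) + t ^ 2 * (y ⬝ᵥ y) := by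
  simp only [dotProduct_sub, sub_dotProduct, dotProduct_smul, smul_dotProduct, smul_eq_mul]
  rw [dotProduct_comm y x]
  ring

theorem two_mul_dotProduct_le (x y : Fin n → ℝ) {t : ℝ} (ht : 0 < t) :
    2 * (x ⬝ᵥ y) ≤ t * (x ⬝ᵥ x) + (y ⬝ᵥ y) / t := by
  have h := dotProduct_self_nonneg' (x - t⁻¹ • y)
  rw [dotProduct_sub_smul_self] at h
  have h2 := mul_nonneg ht.le h
  have e : t * (x ⬝ᵥ x - 2 * t⁻¹ * (x ⬝ᵥ y) + t⁻¹ ^ 2 * (y ⬝ᵥ y))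
    = t * (x ⬝ᵥ x) - 2 * (x ⬝ᵥ y) + (y ⬝ᵥ y) / t := by field_simp
  linarith

/-- An upper bound for a form gives a lower bound for the inverse form. -/
theorem dotProduct_le_inv_form (hQ : Q.PosDef) {q : ℝ} (hq : 0 < q)
    (h : ∀ y : Fin n → ℝ, y ⬝ᵥ Q.mulVec y ≤ q * (y ⬝ᵥ y)) (x : Fin n → ℝ) :
    x ⬝ᵥ x ≤ q * (x ⬝ᵥ Q⁻¹.mulVec x) := by
  have hQx : Q.mulVec (Q⁻¹.mulVec x) = x := by
    rw [Matrix.mulVec_mulVec, Matrix.mul_nonsing_inv _ hQ.det_pos.ne'.isUnit, Matrix.one_mulVec]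
  have h0 := posSemidef_form_nonneg hQ.posSemidef (Q⁻¹.mulVec x - q⁻¹ • x)
  rw [form_sub_smul (posDef_isSymm hQ), form_comm (posDef_isSymm hQ) _ x, hQx,
    dotProduct_comm (Q⁻¹.mulVec x)] at h0
  have h1 := h x
  have h2 : q⁻¹ ^ 2 * (x ⬝ᵥ Q.mulVec x) ≤ q⁻¹ * (x ⬝ᵥ x) := by
    calc _ ≤ q⁻¹ ^ 2 * (q * (x ⬝ᵥ x)) := by gcongr
      _ = _ := by field_simp
  have h3 : 0 ≤ q * (x ⬝ᵥ Q⁻¹.mulVec x - q⁻¹ * (x ⬝ᵥ x)) := mul_nonneg hq.le (by linarith)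
  have : q * (x ⬝ᵥ Q⁻¹.mulVec x - q⁻¹ * (x ⬝ᵥ x)) = q * (x ⬝ᵥ Q⁻¹.mulVec x) - x ⬝ᵥ x := by
    field_simp
  linarith

/-- A lower bound for a form gives an upper bound for the inverse form. -/
theorem inv_form_le (hM : IsUnit A.det) {K : ℝ} (hK : 0 < K)
    (h : ∀ y : Fin n → ℝ, y ⬝ᵥ y ≤ K * (y ⬝ᵥ A.mulVec y)) (w : Fin n → ℝ) :
    w ⬝ᵥ A⁻¹.mulVec w ≤ K * (w ⬝ᵥ w) := by
  have hQx : A.mulVec (A⁻¹.mulVec w) = w := by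
    rw [Matrix.mulVec_mulVec, Matrix.mul_nonsing_inv _ hM, Matrix.one_mulVec]
  have h0 := h (A⁻¹.mulVec w)
  rw [hQx, dotProduct_comm _ w] at h0
  have h1 := two_mul_dotProduct_le w (A⁻¹.mulVec w) hK
  have : (A⁻¹.mulVec w ⬝ᵥ A⁻¹.mulVec w) / K ≤ w ⬝ᵥ A⁻¹.mulVec w := by
    rw [div_le_iff₀ hK]; linarith
  linarith

theorem mulVec_dotProduct_self_le (hP : P.PosSemidef) {p : ℝ} (hp : 0 < p)
    (h : ∀ y : Fin n → ℝ, y ⬝ᵥ P.mulVec y ≤ p * (y ⬝ᵥ y)) (x : Fin n → ℝ) :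
    P.mulVec x ⬝ᵥ P.mulVec x ≤ p * (x ⬝ᵥ P.mulVec x) := by
  have hs : P.IsSymm := by simpa [Matrix.IsHermitian, Matrix.IsSymm] using hP.isHermitian
  have h0 := posSemidef_form_nonneg hP (x - p⁻¹ • P.mulVec x)
  rw [form_sub_smul hs, form_comm hs x (P.mulVec x)] at h0
  have h2 : p⁻¹ ^ 2 * (P.mulVec x ⬝ᵥ P.mulVec (P.mulVec x)) ≤ p⁻¹ * (P.mulVec x ⬝ᵥ P.mulVec x) := by
    calc _ ≤ p⁻¹ ^ 2 * (p * (P.mulVec x ⬝ᵥ P.mulVec x)) := by gcongr; exact h _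
      _ = _ := by field_simp
  have h3 : 0 ≤ p * (x ⬝ᵥ P.mulVec x - p⁻¹ * (P.mulVec x ⬝ᵥ P.mulVec x)) :=
    mul_nonneg hp.le (by linarith)
  have : p * (x ⬝ᵥ P.mulVec x - p⁻¹ * (P.mulVec x ⬝ᵥ P.mulVec x))
      = p * (x ⬝ᵥ P.mulVec x) - P.mulVec x ⬝ᵥ P.mulVec x := by field_simp
  linarith

theorem trace_mul_nonneg (hA : A.PosDef) {B : Matrix (Fin n) (Fin n) ℝ} (hB : B.PosSemidef) :
    0 ≤ (A * B).trace := by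
  obtain ⟨R, -, -, hR⟩ := exists_frame hA.inv
  rw [Matrix.nonsing_inv_nonsing_inv _ hA.det_pos.ne'.isUnit] at hR
  rw [← hR, ← trace_cycle]
  simpa using (hB.conjTranspose_mul_mul_same R).trace_nonneg

theorem trace_mul_le (hA : A.PosDef) {B : Matrix (Fin n) (Fin n) ℝ} (hB : B.IsSymm) {K : ℝ}
    (h : ∀ y : Fin n → ℝ, y ⬝ᵥ B.mulVec y ≤ K * (y ⬝ᵥ y)) :
    (A * B).trace ≤ K * A.trace := by
  have h0 : (K • (1 : Matrix (Fin n) (Fin n) ℝ) - B).PosSemidef := by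
    refine Matrix.posSemidef_iff_dotProduct_mulVec.2 ⟨?_, fun y => ?_⟩
    · simp [Matrix.IsHermitian, Matrix.transpose_sub, hB.eq]
    · have := h y
      simp only [star_trivial, Matrix.sub_mulVec, Matrix.smul_mulVec, Matrix.one_mulVec,
        dotProduct_sub, dotProduct_smul, smul_eq_mul]
      linarith
  have := trace_mul_nonneg hA h0
  rw [Matrix.mul_sub, Matrix.trace_sub, Matrix.mul_smul, Matrix.trace_smul, Matrix.mul_one,
    smul_eq_mul] at this
  linarith

end FormBounds

section FirstOrder
variable {n : ℕ} {f : (Fin n → ℝ) → ℝ}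

/-- First order characterization of strong convexity. -/
theorem quadratic_lower_bound (hf : ContDiff ℝ 2 f) {c : ℝ}
    (h : ∀ x d : Fin n → ℝ, c * (d ⬝ᵥ d) ≤ d ⬝ᵥ (hess f x).mulVec d) (x d : Fin n → ℝ) :
    f x + grad f x ⬝ᵥ d + c / 2 * (d ⬝ᵥ d) ≤ f (x + d) := by
  set k : ℝ → ℝ := fun t => f (x + t • d) - c / 2 * (d ⬝ᵥ d) * t ^ 2 with hk
  set k' : ℝ → ℝ := fun t => (∑ i, d i * pd f i (x + t • d)) - c * (d ⬝ᵥ d) * t with hk'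
  have hd : ∀ t, HasDerivAt k (k' t) t := fun t => by
    have h1 := hasDerivAt_line (f := f) (x := x) (d := d) (t := t)
      (hf.differentiable (by norm_num) _)
    have e : k' t = (∑ i, d i * pd f i (x + t • d))
        - c / 2 * (d ⬝ᵥ d) * ((2 : ℕ) * t ^ (2 - 1)) := by
      rw [hk']; push_cast; ring
    rw [e]
    exact h1.sub ((hasDerivAt_pow 2 t).const_mul (c / 2 * (d ⬝ᵥ d)))
  have hd' : ∀ t, HasDerivAt k' ((∑ i, d i * ∑ j, d j * pd (pd f i) j (x + t • d))
      - c * (d ⬝ᵥ d)) t := fun t => by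
    have h1 : HasDerivAt (fun t : ℝ => ∑ i, d i * pd f i (x + t • d))
        (∑ i, d i * ∑ j, d j * pd (pd f i) j (x + t • d)) t :=
      HasDerivAt.fun_sum fun i _ => (hasDerivAt_line (f := pd f i)
        ((contDiff_pd hf (k := 1) (by norm_num) i).differentiable (by norm_num) _)).const_mul _
    have h2 := h1.sub ((hasDerivAt_id t).const_mul (c * (d ⬝ᵥ d)))
    rw [mul_one] at h2
    exact h2
  have e1 : deriv k = k' := funext fun t => (hd t).deriv
  have hconv : ConvexOn ℝ Set.univ k := by
    refine convexOn_univ_of_deriv2_nonneg (fun t => (hd t).differentiableAt)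
      (by rw [e1]; exact fun t => (hd' t).differentiableAt) fun t => ?_
    simp only [Function.iterate_succ, Function.iterate_zero, Function.comp, id]
    rw [e1, (hd' t).deriv]
    have := h (x + t • d) d
    have e : d ⬝ᵥ (hess f (x + t • d)).mulVec d
        = ∑ i, d i * ∑ j, d j * pd (pd f i) j (x + t • d) := by
      simp only [dotProduct, Matrix.mulVec, hess, Matrix.of_apply, pd2, mul_comm]
    linarith
  have := hconv.le_slope_of_hasDerivAt (Set.mem_univ 0) (Set.mem_univ 1) one_pos (hd 0)
  simp only [slope, vsub_eq_sub, sub_zero, inv_one, one_smul, hk, hk', zero_smul, add_zero,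
    mul_zero, mul_one, one_pow, ne_eq, OfNat.ofNat_ne_zero, not_false_eq_true, zero_pow] at this
  have e : grad f x ⬝ᵥ d = ∑ i, d i * pd f i x := by
    simp only [dotProduct, grad, mul_comm]
  linarith

theorem gradient_inequality (hf : ContDiff ℝ 2 f) (h : ∀ x, (hess f x).PosSemidef)
    (x y : Fin n → ℝ) : f x + grad f x ⬝ᵥ (y - x) ≤ f y := by
  have := quadratic_lower_bound hf (c := 0)
    (fun x d => by simpa using posSemidef_form_nonneg (h x) d) x (y - x)
  simpa using this

end FirstOrder

section Cutoff
variable {n : ℕ} {Φ : (Fin n → ℝ) → ℝ} {P Q : Matrix (Fin n) (Fin n) ℝ}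

theorem hasJet_quadratic (a b c : ℝ) : HasJet (fun t => a + t * b + t * t * c) a b (2 * c) := by
  have h : HasJet (fun t : ℝ => t) 0 1 0 := by
    simpa using HasJet.linear 0 1
  refine ((HasJet.linear a b).add ((h.mul h).mul (HasJet.const c))).congr_jet ?_ ?_ ?_ <;> ring

theorem hasJet_inv_pow_four (m : ℝ) {h : ℝ} (b c : ℝ) (h0 : h ≠ 0) :
    HasJet (fun t => m * ((h + t * b + t * t * c) ^ 4)⁻¹) (m * (h ^ 4)⁻¹) (-4 * m * b / h ^ 5)
      (20 * m * b ^ 2 / h ^ 6 - 8 * m * c / h ^ 5) := by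
  have hi := (hasJet_quadratic h b c).inv h0
  have e : ∀ y : ℝ, (y ^ 4)⁻¹ = y⁻¹ * y⁻¹ * (y⁻¹ * y⁻¹) := fun y => by
    rw [← mul_inv, ← mul_inv]; congr 1; ring
  simp only [e]
  refine (((hi.mul hi).mul (hi.mul hi)).const_mul m).congr_jet rfl ?_ ?_ <;> field

/-- The jet of the power `η⁻⁴` of the cutoff `η = 1 - ⟨Px, x⟩ / R²`. -/
theorem hasLineJets_cutoff (hP : P.IsSymm) {R m h : ℝ} {x₀ : Fin n → ℝ}
    (hh : h = 1 - (x₀ ⬝ᵥ P.mulVec x₀) / R ^ 2) (h0 : h ≠ 0) :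
    HasLineJets (fun x => m * ((1 - (x ⬝ᵥ P.mulVec x) / R ^ 2) ^ 4)⁻¹) x₀
      ((8 * m / (h ^ 5 * R ^ 2)) • P.mulVec x₀)
      ((8 * m / (h ^ 5 * R ^ 2)) • P + (80 * m / (h ^ 6 * R ^ 4)) •
        Matrix.vecMulVec (P.mulVec x₀) (P.mulVec x₀)) := by
  intro d
  have e : ∀ t : ℝ, 1 - ((x₀ + t • d) ⬝ᵥ P.mulVec (x₀ + t • d)) / R ^ 2
      = h + t * (-(2 * (P.mulVec x₀ ⬝ᵥ d) / R ^ 2)) + t * t * (-((d ⬝ᵥ P.mulVec d) / R ^ 2)) := by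
    intro t
    simp only [Matrix.mulVec_add, Matrix.mulVec_smul, dotProduct_add, add_dotProduct,
      dotProduct_smul, smul_dotProduct, smul_eq_mul, hh]
    rw [form_comm hP x₀ d, dotProduct_comm d (P.mulVec x₀)]
    ring
  simp only [e]
  refine (hasJet_inv_pow_four m _ _ h0).congr_jet ?_ ?_ ?_
  · rw [← hh]
  · simp only [smul_dotProduct, smul_eq_mul]
    field
  · simp only [Matrix.add_mulVec, Matrix.smul_mulVec, dotProduct_add, dotProduct_smul, smul_eq_mul,
      Matrix.vecMulVec_mulVec, op_smul_eq_smul]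
    rw [dotProduct_comm d (P.mulVec x₀)]
    field

theorem cutoff_algebra {a m h R X Y C₁ C₂ : ℝ} (hm : 0 < m) (h0 : 0 < h) (h1 : h ≤ 1)
    (hR : 1 ≤ R) (hC₁ : 0 ≤ C₁) (hC₂ : 0 ≤ C₂) (hX : X ≤ C₁ * R) (hY : Y ≤ C₂ * R ^ 2)
    (hmain : a * (m * (h ^ 4)⁻¹ * √(m * (h ^ 4)⁻¹))
      ≤ 8 * m / (h ^ 5 * R ^ 2) * X + 80 * m / (h ^ 6 * R ^ 4) * Y) :
    a * √m * R ≤ 8 * C₁ + 80 * C₂ := by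
  have hR0 : 0 < R := by linarith
  have hs : √(m * (h ^ 4)⁻¹) = √m * (h ^ 2)⁻¹ := by
    rw [Real.sqrt_mul hm.le, Real.sqrt_inv, show h ^ 4 = (h ^ 2) ^ 2 by ring,
      Real.sqrt_sq (by positivity)]
  rw [hs] at hmain
  have h2 : 8 * m / (h ^ 5 * R ^ 2) * X ≤ 8 * m / (h ^ 5 * R ^ 2) * (C₁ * R) := by gcongr
  have h3 : 80 * m / (h ^ 6 * R ^ 4) * Y ≤ 80 * m / (h ^ 6 * R ^ 4) * (C₂ * R ^ 2) := by gcongr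
  have h4 := (hmain.trans (add_le_add h2 h3))
  have h5 := mul_le_mul_of_nonneg_left h4 (show 0 ≤ h ^ 6 * R / m by positivity)
  have e1 : h ^ 6 * R / m * (a * (m * (h ^ 4)⁻¹ * (√m * (h ^ 2)⁻¹))) = a * √m * R := by
    field_simp
  have e2 : h ^ 6 * R / m * (8 * m / (h ^ 5 * R ^ 2) * (C₁ * R) +
      80 * m / (h ^ 6 * R ^ 4) * (C₂ * R ^ 2)) = 8 * (h * C₁) + 80 * (C₂ / R) := by
    field_simp
  rw [e1, e2] at h5
  have h6 : h * C₁ ≤ C₁ := by nlinarith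
  have h7 : C₂ / R ≤ C₂ := div_le_self hC₂ hR
  linarith

set_option maxHeartbeats 1000000 in
/-- A maximum principle at infinity with quadratic cutoff. -/
theorem cutoff_maximum (hΦ : ContDiff ℝ 2 Φ) (hpos : ∀ x, (hess Φ x).PosDef)
    (hQ : Q.PosDef) {K : ℝ} (hK0 : 0 < K)
    (hK : ∀ x y : Fin n → ℝ, y ⬝ᵥ y ≤ K * (y ⬝ᵥ (hess Φ x).mulVec y))
    {Z : Set ((Fin n → ℝ) × (Fin n → ℝ))} (hZ : IsClosed Z) (hZK : ∀ z ∈ Z, z.2 ⬝ᵥ z.2 ≤ K)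
    {G : (Fin n → ℝ) × (Fin n → ℝ) → ℝ} (hG : Continuous G) {a : ℝ} (ha : 0 < a)
    (hyp : ∀ x₀ v₀, (x₀, v₀) ∈ Z → 0 < G (x₀, v₀) → ∀ φ a₁ a₂, HasLineJets φ x₀ a₁ a₂ →
      (∀ᶠ x in nhds x₀, ∀ v, (x, v) ∈ Z → G (x, v) ≤ φ x) → G (x₀, v₀) = φ x₀ →
      a * (G (x₀, v₀) * √(G (x₀, v₀)))
        ≤ ((hess Φ x₀)⁻¹ * a₂).trace - 2 * (Q.mulVec (grad Φ x₀) ⬝ᵥ a₁)) :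
    ∀ z ∈ Z, G z ≤ 0 := by
  intro z₁ hz₁
  by_contra hcon
  push Not at hcon
  set P := Q⁻¹ with hPdef
  have hP : P.PosDef := hQ.inv
  have hPs := posDef_isSymm hP
  set q := eOpNorm Q + 1 with hqdef
  have hq : 0 < q := by have := eOpNorm_nonneg Q; linarith
  have hqb : ∀ x : Fin n → ℝ, x ⬝ᵥ x ≤ q * (x ⬝ᵥ P.mulVec x) :=
    dotProduct_le_inv_form hQ hq fun y => (form_le_eOpNorm Q y).trans (by
      have := dotProduct_self_nonneg' y; rw [hqdef]; nlinarith)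
  set p := eOpNorm P + 1 with hpdef
  have hp : 0 < p := by have := eOpNorm_nonneg P; linarith
  have hpb : ∀ x : Fin n → ℝ, P.mulVec x ⬝ᵥ P.mulVec x ≤ p * (x ⬝ᵥ P.mulVec x) :=
    mulVec_dotProduct_self_le hP.posSemidef hp fun y => (form_le_eOpNorm P y).trans (by
      have := dotProduct_self_nonneg' y; rw [hpdef]; nlinarith)
  set C₁ := K * P.trace + grad Φ 0 ⬝ᵥ grad Φ 0 + q with hC₁
  set C₂ := K * p with hC₂
  have hC₁0 : 0 ≤ C₁ := by
    have h1 := hP.posSemidef.trace_nonneg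
    have h2 := dotProduct_self_nonneg' (grad Φ 0)
    positivity
  have hC₂0 : 0 ≤ C₂ := by positivity
  set ψ : (Fin n → ℝ) → ℝ := fun x => x ⬝ᵥ P.mulVec x with hψ
  have hψ0 : ∀ x, 0 ≤ ψ x := fun x => posSemidef_form_nonneg hP.posSemidef x
  have hψc : Continuous ψ := by
    simp only [hψ, dotProduct, Matrix.mulVec]; fun_prop
  set s := √(G z₁) with hs
  have hs0 : 0 < s := Real.sqrt_pos.2 hcon
  set R := 1 + 2 * ψ z₁.1 + 4 * (8 * C₁ + 80 * C₂ + 1) / (a * s) with hR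
  have hR1 : 1 + 2 * ψ z₁.1 ≤ R := by rw [hR]; linarith [show 0 ≤
    4 * (8 * C₁ + 80 * C₂ + 1) / (a * s) by positivity]
  have hRge : 1 ≤ R := by linarith [hψ0 z₁.1]
  have hR0 : 0 < R := by linarith
  have hψ₁ : ψ z₁.1 / R ^ 2 ≤ 1 / 2 := by
    rw [div_le_iff₀ (by positivity)]; nlinarith
  set η : (Fin n → ℝ) → ℝ := fun x => 1 - ψ x / R ^ 2 with hη
  have hηc : Continuous η := by simp only [hη]; fun_prop
  set D := Z ∩ {z | ψ z.1 ≤ R ^ 2} with hD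
  have hsq : ∀ (x : Fin n → ℝ) (B : ℝ), 0 ≤ B → x ⬝ᵥ x ≤ B → ‖x‖ ≤ B + 1 := by
    intro x B hB hx
    rw [pi_norm_le_iff_of_nonneg (by linarith)]
    intro i
    have : x i * x i ≤ x ⬝ᵥ x :=
      Finset.single_le_sum (f := fun i => x i * x i) (fun i _ => mul_self_nonneg _)
        (Finset.mem_univ i)
    rw [Real.norm_eq_abs, abs_le]
    constructor <;> nlinarith
  have hDc : IsCompact D := by
    refine Metric.isCompact_of_isClosed_isBounded
      (hZ.inter (isClosed_le (hψc.comp continuous_fst) continuous_const)) ?_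
    refine isBounded_iff_forall_norm_le.2 ⟨max (q * R ^ 2 + 1) (K + 1), fun z hz => ?_⟩
    rw [Prod.norm_def]
    refine max_le_max (hsq _ _ (by positivity) ?_) (hsq _ _ hK0.le (hZK z hz.1))
    exact (hqb _).trans (by gcongr; exact hz.2)
  have hz₁D : z₁ ∈ D := ⟨hz₁, by
    have := (div_le_iff₀ (by positivity : 0 < R ^ 2)).1 hψ₁
    change ψ z₁.1 ≤ R ^ 2
    nlinarith [sq_nonneg R]⟩
  obtain ⟨⟨x₀, v₀⟩, hz₀, hmax⟩ := hDc.exists_isMaxOn ⟨z₁, hz₁D⟩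
    (f := fun z => G z * η z.1 ^ 4) (by fun_prop)
  have hmax' : ∀ z ∈ D, G z * η z.1 ^ 4 ≤ G (x₀, v₀) * η x₀ ^ 4 := fun z hz => hmax hz
  set m := G (x₀, v₀) * η x₀ ^ 4 with hm
  have hm1 : G z₁ / 16 ≤ m := by
    refine le_trans ?_ (hmax' z₁ hz₁D)
    have : (1 / 2 : ℝ) ^ 4 ≤ η z₁.1 ^ 4 := pow_le_pow_left₀ (by norm_num) (by
      simp only [hη]; linarith) 4
    nlinarith
  have hm0 : 0 < m := by linarith
  have hη0 : 0 ≤ η x₀ := by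
    simp only [hη, sub_nonneg]
    exact (div_le_one (by positivity)).2 hz₀.2
  have hηpos : 0 < η x₀ := by
    rcases hη0.lt_or_eq with h | h
    · exact h
    · rw [hm, ← h] at hm0; norm_num at hm0
  have hη1 : η x₀ ≤ 1 := by
    simp only [hη]; linarith [div_nonneg (hψ0 x₀) (sq_nonneg R)]
  have hG0 : G (x₀, v₀) = m * (η x₀ ^ 4)⁻¹ := by
    rw [hm]; field_simp
  have hGpos : 0 < G (x₀, v₀) := by rw [hG0]; positivity
  have hev : ∀ᶠ x in nhds x₀, ∀ v, (x, v) ∈ Z → G (x, v) ≤ m * (η x ^ 4)⁻¹ := by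
    filter_upwards [hηc.continuousAt.eventually (lt_mem_nhds hηpos)] with x hx v hv
    have hx' : 0 < η x := hx
    have : (x, v) ∈ D := ⟨hv, by
      have h1 : ψ x / R ^ 2 ≤ 1 := by simp only [hη] at hx'; linarith
      exact (div_le_one (by positivity)).1 h1⟩
    have h2 := hmax' _ this
    rw [← div_eq_mul_inv, le_div_iff₀ (by positivity)]
    exact h2
  have key := hyp x₀ v₀ hz₀.1 hGpos _ _ _
    (hasLineJets_cutoff (m := m) (R := R) hPs (h := η x₀) rfl hηpos.ne') hev hG0
  have hNs : ∀ w : Fin n → ℝ, w ⬝ᵥ (hess Φ x₀)⁻¹.mulVec w ≤ K * (w ⬝ᵥ w) :=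
    inv_form_le (hpos x₀).det_pos.ne'.isUnit hK0 (hK x₀)
  have hX : (P * (hess Φ x₀)⁻¹).trace - 2 * (grad Φ x₀ ⬝ᵥ x₀) ≤ C₁ * R := by
    have h1 := trace_mul_le hP (posDef_isSymm (hpos x₀).inv) hNs
    have h2 := gradient_inequality hΦ (fun x => (hpos x).posSemidef) x₀ 0
    have h3 := gradient_inequality hΦ (fun x => (hpos x).posSemidef) 0 x₀
    simp only [zero_sub, dotProduct_neg, sub_zero] at h2 h3
    have h4 := two_mul_dotProduct_le (grad Φ 0) (-x₀) hR0
    simp only [dotProduct_neg, neg_dotProduct, neg_neg] at h4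
    have h5 : (x₀ ⬝ᵥ x₀) / R ≤ q * R := by
      rw [div_le_iff₀ hR0]
      calc x₀ ⬝ᵥ x₀ ≤ q * ψ x₀ := hqb x₀
        _ ≤ q * R ^ 2 := by gcongr; exact hz₀.2
        _ = _ := by ring
    have h6 : K * P.trace ≤ K * P.trace * R :=
      le_mul_of_one_le_right (mul_nonneg hK0.le hP.posSemidef.trace_nonneg) hRge
    rw [hC₁]
    nlinarith
  have hY : P.mulVec x₀ ⬝ᵥ (hess Φ x₀)⁻¹.mulVec (P.mulVec x₀) ≤ C₂ * R ^ 2 := by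
    calc _ ≤ K * (P.mulVec x₀ ⬝ᵥ P.mulVec x₀) := hNs _
      _ ≤ K * (p * ψ x₀) := by gcongr; exact hpb x₀
      _ ≤ K * (p * R ^ 2) := by gcongr; exact hz₀.2
      _ = _ := by rw [hC₂]; ring
  have hdrift : Q.mulVec (grad Φ x₀) ⬝ᵥ P.mulVec x₀ = grad Φ x₀ ⬝ᵥ x₀ := by
    rw [mulVec_dotProduct, posDef_isSymm hQ, Matrix.mulVec_mulVec, hPdef,
      Matrix.mul_nonsing_inv _ hQ.det_pos.ne'.isUnit, Matrix.one_mulVec]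
  have hfin := cutoff_algebra hm0 hηpos hη1 hRge hC₁0 hC₂0 hX hY (a := a) (by
    rw [← hG0]
    refine key.trans (le_of_eq ?_)
    rw [Matrix.mul_add, Matrix.trace_add, Matrix.mul_smul, Matrix.mul_smul, Matrix.trace_smul,
      Matrix.trace_smul, Matrix.trace_mul_comm _ P, Matrix.mul_vecMulVec, Matrix.trace_vecMulVec,
      dotProduct_smul, hdrift, dotProduct_comm ((hess Φ x₀)⁻¹.mulVec _)]
    simp only [smul_eq_mul]
    ring)
  have hsm : s / 4 ≤ √m := by
    rw [show s / 4 = √(G z₁ / 16) by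
      rw [Real.sqrt_div hcon.le, show (16 : ℝ) = 4 ^ 2 by norm_num,
        Real.sqrt_sq (by norm_num)]]
    exact Real.sqrt_le_sqrt hm1
  have h1 : a * (s / 4) * R ≤ a * √m * R := by gcongr
  have h2 : 4 * (8 * C₁ + 80 * C₂ + 1) / (a * s) ≤ R := by rw [hR]; linarith [hψ0 z₁.1]
  rw [div_le_iff₀ (by positivity)] at h2
  nlinarith

end Cutoff

section Surjectivity
variable {n : ℕ} {Φ V : (Fin n → ℝ) → ℝ} {Q : Matrix (Fin n) (Fin n) ℝ} {cQ : ℝ}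

theorem hasFDerivAt_grad (hΦ : ContDiff ℝ 2 Φ) (x : Fin n → ℝ) :
    HasFDerivAt (grad Φ) (Matrix.toLin' (hess Φ x)).toContinuousLinearMap x := by
  rw [hasFDerivAt_pi']
  intro i
  have hd : DifferentiableAt ℝ (pd Φ i) x :=
    (contDiff_pd hΦ (k := 1) (by norm_num) i).differentiable (by norm_num) x
  have e : (ContinuousLinearMap.proj i).comp (Matrix.toLin' (hess Φ x)).toContinuousLinearMap
      = fderiv ℝ (pd Φ i) x := by
    refine ContinuousLinearMap.ext fun d => ?_
    rw [fderiv_apply_eq_sum_pd]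
    simp [Matrix.mulVec, dotProduct, hess, pd2, mul_comm]
  rw [e]
  exact hd.hasFDerivAt

theorem continuous_grad (hΦ : ContDiff ℝ 2 Φ) : Continuous (grad Φ) :=
  continuous_iff_continuousAt.2 fun x => (hasFDerivAt_grad hΦ x).continuousAt

theorem hasDerivAt_grad_line (hΦ : ContDiff ℝ 2 Φ) (x d : Fin n → ℝ) (t : ℝ) :
    HasDerivAt (fun s : ℝ => grad Φ (x + s • d)) ((hess Φ (x + t • d)).mulVec d) t := by
  have h1 : HasDerivAt (fun s : ℝ => x + s • d) d t := by
    simpa using ((hasDerivAt_id t).smul_const d).const_add x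
  exact (hasFDerivAt_grad hΦ (x + t • d)).comp_hasDerivAt t h1

theorem grad_injective (hΦ : ContDiff ℝ 2 Φ) (hpos : ∀ x, (hess Φ x).PosDef) :
    Function.Injective (grad Φ) := by
  intro x y hxy
  by_contra hne
  have hd : y - x ≠ 0 := sub_ne_zero.2 (Ne.symm hne)
  have hder : ∀ t : ℝ, HasDerivAt (fun s : ℝ => ∑ i, (y - x) i * grad Φ (x + s • (y - x)) i)
      ((y - x) ⬝ᵥ (hess Φ (x + t • (y - x))).mulVec (y - x)) t := fun t =>
    HasDerivAt.fun_sum fun i _ =>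
      ((hasDerivAt_pi.1 (hasDerivAt_grad_line hΦ x (y - x) t)) i).const_mul _
  have hm := strictMono_of_deriv_pos fun t => by
    rw [(hder t).deriv]
    simpa using (hpos (x + t • (y - x))).dotProduct_mulVec_pos hd
  have := hm (zero_lt_one (α := ℝ))
  simp [hxy] at this

theorem exists_norm_eq_abs_apply [Nonempty (Fin n)] (x : Fin n → ℝ) : ∃ i, ‖x‖ = |x i| := by
  obtain ⟨i, -, hi⟩ := Finset.exists_max_image Finset.univ (fun i => |x i|) Finset.univ_nonempty
  refine ⟨i, le_antisymm ?_ (norm_le_pi_norm x i)⟩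
  rw [pi_norm_le_iff_of_nonneg (abs_nonneg _)]
  exact fun j => hi j (Finset.mem_univ j)

theorem abs_dotProduct_le_norm (x r : Fin n → ℝ) : |x ⬝ᵥ r| ≤ n * (‖x‖ * ‖r‖) := by
  calc |x ⬝ᵥ r| ≤ ∑ i, |x i * r i| := Finset.abs_sum_le_sum_abs _ _
    _ ≤ ∑ _i : Fin n, ‖x‖ * ‖r‖ := Finset.sum_le_sum fun i _ => by
        rw [abs_mul]
        exact mul_le_mul (norm_le_pi_norm x i) (norm_le_pi_norm r i) (abs_nonneg _) (norm_nonneg _)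
    _ = _ := by simp

/-- A function bounded below by finitely many affine functions with slopes near `± eᵢ`. -/
theorem norm_le_of_affine_bounds [Nonempty (Fin n)] {F : (Fin n → ℝ) → ℝ}
    (h : ∀ (i : Fin n) (s : Bool), ∃ (r : Fin n → ℝ) (k : ℝ), ‖r‖ ≤ 1 / (2 * n) ∧
      ∀ x, (bif s then 1 else -1) * x i + x ⬝ᵥ r - k ≤ F x) :
    ∃ C, ∀ x, ‖x‖ / 2 - C ≤ F x := by
  choose r k hr hF using h
  refine ⟨∑ i, ∑ s, |k i s|, fun x => ?_⟩
  obtain ⟨i, hi⟩ := exists_norm_eq_abs_apply x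
  have hn : (0 : ℝ) < n := by
    have : n ≠ 0 := by rintro rfl; exact i.elim0
    positivity
  have hb : ∀ s, ‖x‖ / 2 ≤ ‖x‖ + x ⬝ᵥ r i s := fun s => by
    have h1 := abs_dotProduct_le_norm x (r i s)
    have h2 : (n : ℝ) * (‖x‖ * ‖r i s‖) ≤ n * (‖x‖ * (1 / (2 * n))) := by gcongr; exact hr i s
    have h3 : (n : ℝ) * (‖x‖ * (1 / (2 * n))) = ‖x‖ / 2 := by field_simp
    have := (abs_le.1 (h1.trans (h2.trans h3.le))).1
    linarith
  have hk : ∀ s, k i s ≤ ∑ i, ∑ s, |k i s| := fun s =>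
    (le_abs_self _).trans ((Finset.single_le_sum (f := fun s => |k i s|)
      (fun _ _ => abs_nonneg _) (Finset.mem_univ s)).trans
      (Finset.single_le_sum (f := fun i => ∑ s, |k i s|)
        (fun _ _ => Finset.sum_nonneg fun _ _ => abs_nonneg _) (Finset.mem_univ i)))
  rcases abs_cases (x i) with ⟨h1, -⟩ | ⟨h1, -⟩
  · have := hF i true x
    have := hb true
    have := hk true
    simp only [cond_true] at *
    linarith
  · have := hF i false x
    have := hb false
    have := hk false
    simp only [cond_false] at *
    linarith

theorem grad_surjective_of_denseRange (hΦ : ContDiff ℝ 2 Φ) (hpos : ∀ x, (hess Φ x).PosSemidef)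
    (hd : DenseRange (grad Φ)) : Function.Surjective (grad Φ) := by
  intro y
  rcases isEmpty_or_nonempty (Fin n) with he | he
  · exact ⟨y, Subsingleton.elim _ _⟩
  have hn : (0 : ℝ) < n := by
    have : n ≠ 0 := by rintro rfl; exact he.some.elim0
    positivity
  obtain ⟨C, hC⟩ := norm_le_of_affine_bounds (F := fun x => Φ x - x ⬝ᵥ y) fun i s => by
    obtain ⟨z, hz⟩ := hd.exists_dist_lt (y + (bif s then (1 : ℝ) else -1) • Pi.single i 1)
      (ε := 1 / (2 * n)) (by positivity)
    refine ⟨grad Φ z - (y + (bif s then (1 : ℝ) else -1) • Pi.single i 1),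
      grad Φ z ⬝ᵥ z - Φ z, ?_, fun x => ?_⟩
    · rw [← dist_eq_norm, dist_comm]; exact hz.le
    · have := gradient_inequality hΦ hpos z x
      simp only [dotProduct_sub, dotProduct_add, dotProduct_smul, dotProduct_single, smul_eq_mul,
        mul_one] at this ⊢
      rw [dotProduct_comm x (grad Φ z)]
      linarith
  have hcont : Continuous fun x => Φ x - x ⬝ᵥ y := by
    have := hΦ.continuous
    simp only [dotProduct]; fun_prop
  have htend : Tendsto (fun x => Φ x - x ⬝ᵥ y) (cocompact _) atTop := by
    refine tendsto_atTop_mono hC (tendsto_atTop_add_const_right _ _ ?_)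
    exact (tendsto_norm_cocompact_atTop).atTop_div_const (by norm_num)
  obtain ⟨x, hx⟩ := hcont.exists_forall_le htend
  refine ⟨x, funext fun i => ?_⟩
  have h1 := hasDerivAt_coord (x := x) i (hΦ.differentiable (by norm_num) x)
  have h2 : HasDerivAt (fun t : ℝ => Φ (x + t • Pi.single i 1) - (x + t • Pi.single i 1) ⬝ᵥ y)
      (pd Φ i x - y i) 0 := by
    refine h1.sub ?_
    simp only [add_dotProduct, smul_dotProduct, single_dotProduct, smul_eq_mul, one_mul]
    simpa using ((hasDerivAt_id (0 : ℝ)).mul_const (y i)).const_add (x ⬝ᵥ y)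
  have h3 : IsLocalMin (fun t : ℝ => Φ (x + t • Pi.single i 1) - (x + t • Pi.single i 1) ⬝ᵥ y) 0 :=
    Eventually.of_forall fun t => by
      simpa only [zero_smul, add_zero] using hx (x + t • Pi.single i 1)
  have := h3.hasDerivAt_eq_zero h2
  exact sub_eq_zero.1 this

theorem grad_surjective (hΦ : ContDiff ℝ 2 Φ) (hpos : ∀ x, (hess Φ x).PosDef) (hcQ : 0 < cQ)
    (hμp : IsProbabilityMeasure
      (volume.withDensity fun x : Fin n → ℝ => ENNReal.ofReal (Real.exp (-V x))))
    (hνp : IsProbabilityMeasure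
      (volume.withDensity fun x : Fin n → ℝ => ENNReal.ofReal (cQ * Real.exp (-(qform Q x)))))
    (hMA : ∀ x, Real.exp (-V x) = cQ * Real.exp (-(qform Q (grad Φ x))) * (hess Φ x).det) :
    Function.Surjective (grad Φ) := by
  refine grad_surjective_of_denseRange hΦ (fun x => (hpos x).posSemidef) ?_
  set ν := volume.withDensity fun x : Fin n → ℝ => ENNReal.ofReal (cQ * Real.exp (-(qform Q x)))
    with hν
  have hqc : Continuous (qform Q) := by unfold qform; fun_prop
  have hac : volume ≪ ν := withDensity_absolutelyContinuous' (by fun_prop)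
    (Eventually.of_forall fun x => by positivity)
  have hrm : MeasurableSet (grad Φ '' Set.univ) :=
    MeasurableSet.univ.image_of_continuousOn_injOn (continuous_grad hΦ).continuousOn
      (grad_injective hΦ hpos).injOn
  have hrange : ν (grad Φ '' Set.univ) = 1 := by
    rw [hν, withDensity_apply _ hrm, lintegral_image_eq_lintegral_abs_det_fderiv_mul volume
      MeasurableSet.univ (fun x _ => (hasFDerivAt_grad hΦ x).hasFDerivWithinAt)
      (grad_injective hΦ hpos).injOn, ← hμp.measure_univ,
      withDensity_apply _ MeasurableSet.univ]
    refine lintegral_congr fun x => ?_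
    rw [hMA x, ← ENNReal.ofReal_mul (abs_nonneg _)]
    congr 1
    rw [ContinuousLinearMap.det]
    simp only [LinearMap.coe_toContinuousLinearMap, LinearMap.det_toLin']
    rw [abs_of_pos (hpos x).det_pos]
    ring
  rw [Set.image_univ] at hrange hrm
  have hcompl : ν (Set.range (grad Φ))ᶜ = 0 := by
    rw [measure_compl hrm (measure_ne_top _ _), hrange, measure_univ, tsub_self]
  have := hac hcompl
  exact Measure.dense_of_ae (p := fun y => y ∈ Set.range (grad Φ)) this

end Surjectivity

/-- `Ψ` is the Legendre transform of `Φ`, characterized by Young's inequality and its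
equality case. -/
structure IsLegendre {n : ℕ} (Φ Ψ : (Fin n → ℝ) → ℝ) : Prop where
  young : ∀ x y, x ⬝ᵥ y - Φ x ≤ Ψ y
  eq_grad : ∀ x, Ψ (grad Φ x) = x ⬝ᵥ grad Φ x - Φ x

section Legendre
variable {n : ℕ} {Φ Ψ : (Fin n → ℝ) → ℝ}

theorem exists_isLegendre (hΦ : ContDiff ℝ 2 Φ) (hpos : ∀ x, (hess Φ x).PosDef)
    (hsurj : Function.Surjective (grad Φ)) : ∃ Ψ, IsLegendre Φ Ψ := by
  choose X hX using hsurj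
  refine ⟨fun y => X y ⬝ᵥ y - Φ (X y), fun x y => ?_, fun x => ?_⟩
  · have := gradient_inequality hΦ (fun x => (hpos x).posSemidef) (X y) x
    rw [hX, dotProduct_sub, dotProduct_comm y x, dotProduct_comm y] at this
    linarith
  · have : X (grad Φ x) = x := grad_injective hΦ hpos (hX _)
    simp only [this]

namespace IsLegendre

theorem convexOn (h : IsLegendre Φ Ψ) (hsurj : Function.Surjective (grad Φ)) :
    ConvexOn ℝ Set.univ Ψ := by
  refine ⟨convex_univ, fun a _ b _ s t hs ht hst => ?_⟩
  obtain ⟨x, hx⟩ := hsurj (s • a + t • b)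
  rw [← hx, h.eq_grad, hx]
  have h1 := mul_le_mul_of_nonneg_left (h.young x a) hs
  have h2 := mul_le_mul_of_nonneg_left (h.young x b) ht
  have h3 : Φ x = s * Φ x + t * Φ x := by rw [← add_mul, hst, one_mul]
  simp only [dotProduct_add, dotProduct_smul, smul_eq_mul]
  linarith

theorem continuous (h : IsLegendre Φ Ψ) (hsurj : Function.Surjective (grad Φ)) :
    Continuous Ψ :=
  continuousOn_univ.1 ((h.convexOn hsurj).continuousOn isOpen_univ)

theorem coercive (h : IsLegendre Φ Ψ) : ∃ C, ∀ y, ‖y‖ / 2 - C ≤ Ψ y := by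
  rcases isEmpty_or_nonempty (Fin n) with he | he
  · refine ⟨-Ψ 0, fun y => ?_⟩
    rw [Subsingleton.elim y 0]; simp
  refine norm_le_of_affine_bounds fun i s =>
    ⟨0, Φ ((bif s then (1 : ℝ) else -1) • Pi.single i 1), by simp, fun y => ?_⟩
  have := h.young ((bif s then (1 : ℝ) else -1) • Pi.single i 1) y
  simpa [smul_dotProduct] using this

theorem exists_max (h : IsLegendre Φ Ψ) (hsurj : Function.Surjective (grad Φ)) (e : Fin n → ℝ)
    {s : ℝ} (hs0 : 0 < s) (hs1 : s < 1) :
    ∃ y₀, ∀ y, Ψ (s • (y + e)) + Ψ (s • (y - e)) - 2 * Ψ y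
      ≤ Ψ (s • (y₀ + e)) + Ψ (s • (y₀ - e)) - 2 * Ψ y₀ := by
  have hc := h.continuous hsurj
  obtain ⟨C, hC⟩ := h.coercive
  have hb : ∀ e y : Fin n → ℝ, Ψ (s • (y + e)) ≤ s * Ψ y + (1 - s) * Ψ ((s / (1 - s)) • e) := by
    intro e y
    have := (h.convexOn hsurj).2 (Set.mem_univ y) (Set.mem_univ ((s / (1 - s)) • e)) hs0.le
      (by linarith : 0 ≤ 1 - s) (by ring)
    rw [smul_smul, mul_div_cancel₀ _ (by linarith : 1 - s ≠ 0), ← smul_add] at this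
    exact this
  have htend : Tendsto (fun y => 2 * Ψ y - (Ψ (s • (y + e)) + Ψ (s • (y - e)))) (cocompact _)
      atTop := by
    refine tendsto_atTop_mono (f := fun y => (1 - s) * ‖y‖ + (-2 * (1 - s) * C
      - (1 - s) * Ψ ((s / (1 - s)) • e) - (1 - s) * Ψ ((s / (1 - s)) • (-e)))) (fun y => ?_) ?_
    · have h1 := hb e y
      have h2 := hb (-e) y
      rw [← sub_eq_add_neg] at h2
      have h3 := mul_le_mul_of_nonneg_left (hC y) (by linarith : 0 ≤ 2 * (1 - s))
      linarith
    · exact tendsto_atTop_add_const_right _ _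
        (tendsto_norm_cocompact_atTop.const_mul_atTop (by linarith))
  obtain ⟨y₀, hy₀⟩ := Continuous.exists_forall_le (by fun_prop) htend
  exact ⟨y₀, fun y => by have := hy₀ y; linarith⟩

end IsLegendre

theorem hasJet_grad_apply (hΦ : ContDiff ℝ 3 Φ) (x ξ : Fin n → ℝ) (i : Fin n) :
    HasJet (fun t : ℝ => grad Φ (x + t • ξ) i) (grad Φ x i) ((hess Φ x).mulVec ξ i)
      (∑ j, ξ j * ∑ k, ξ k * pd2 (pd Φ i) j k x) :=
  (hasJet_line (contDiff_pd hΦ (k := 2) (by norm_num) i) x ξ).congr_jet rfl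
    (by simp [Matrix.mulVec, dotProduct, hess, pd2, mul_comm]) rfl

theorem hasJet_dotProduct {y : ℝ → Fin n → ℝ} {y₀ y₁ y₂ : Fin n → ℝ}
    (hy : ∀ i, HasJet (fun t => y t i) (y₀ i) (y₁ i) (y₂ i)) (x ξ : Fin n → ℝ) :
    HasJet (fun t : ℝ => (x + t • ξ) ⬝ᵥ y t) (x ⬝ᵥ y₀) (x ⬝ᵥ y₁ + ξ ⬝ᵥ y₀)
      (x ⬝ᵥ y₂ + 2 * (ξ ⬝ᵥ y₁)) := by
  simp only [dotProduct, Pi.add_apply, Pi.smul_apply, smul_eq_mul]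
  refine (HasJet.sum Finset.univ fun i _ => (HasJet.linear (x i) (ξ i)).mul (hy i)).congr_jet
    rfl ?_ ?_
  · rw [Finset.sum_add_distrib]
  · simp only [zero_mul, add_zero, Finset.sum_add_distrib, Finset.mul_sum]

theorem hasJet_line_form (hΦ : ContDiff ℝ 2 Φ) (x ξ : Fin n → ℝ) :
    HasJet (fun t : ℝ => Φ (x + t • ξ)) (Φ x) (ξ ⬝ᵥ grad Φ x) (ξ ⬝ᵥ (hess Φ x).mulVec ξ) :=
  (hasJet_line hΦ x ξ).congr_jet rfl rfl
    (by simp only [Matrix.mulVec, dotProduct, hess, Matrix.of_apply, mul_comm])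

/-- Second variation of the difference quotient of the Legendre transform at a maximum. -/
theorem IsLegendre.second_variation (h : IsLegendre Φ Ψ) (hΦ : ContDiff ℝ 3 Φ)
    {e x₀ xp xm : Fin n → ℝ} {s : ℝ}
    (hmax : ∀ y, Ψ (s • (y + e)) + Ψ (s • (y - e)) - 2 * Ψ y
      ≤ Ψ (s • (grad Φ x₀ + e)) + Ψ (s • (grad Φ x₀ - e)) - 2 * Ψ (grad Φ x₀))
    (hxp : grad Φ xp = s • (grad Φ x₀ + e)) (hxm : grad Φ xm = s • (grad Φ x₀ - e))
    (ξ ξp ξm : Fin n → ℝ) :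
    (s • (xp + xm) - (2 : ℝ) • x₀) ⬝ᵥ (hess Φ x₀).mulVec ξ = 0 ∧
    (s • (xp + xm) = (2 : ℝ) • x₀ →
      s * (2 * (ξp ⬝ᵥ (hess Φ x₀).mulVec ξ)) - ξp ⬝ᵥ (hess Φ xp).mulVec ξp
      + (s * (2 * (ξm ⬝ᵥ (hess Φ x₀).mulVec ξ)) - ξm ⬝ᵥ (hess Φ xm).mulVec ξm)
      - 2 * (ξ ⬝ᵥ (hess Φ x₀).mulVec ξ) ≤ 0) := by
  have hΦ2 : ContDiff ℝ 2 Φ := hΦ.of_le (by norm_num)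
  set w : Fin n → ℝ := fun i => ∑ j, ξ j * ∑ k, ξ k * pd2 (pd Φ i) j k x₀ with hw
  have hy : ∀ i, HasJet (fun t : ℝ => grad Φ (x₀ + t • ξ) i) (grad Φ x₀ i)
    ((hess Φ x₀).mulVec ξ i) (w i) := hasJet_grad_apply hΦ x₀ ξ
  have hshift : ∀ (u : Fin n → ℝ) (i : Fin n),
      HasJet (fun t : ℝ => (s • (grad Φ (x₀ + t • ξ) + u)) i) ((s • (grad Φ x₀ + u)) i)
        ((s • (hess Φ x₀).mulVec ξ) i) ((s • w) i) := fun u i => by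
    refine (((hy i).add (HasJet.const (u i))).const_mul s).congr_jet ?_ ?_ ?_ <;> simp
  have hp := (hasJet_dotProduct (hshift e) xp ξp).sub (hasJet_line_form hΦ2 xp ξp)
  have hm := (hasJet_dotProduct (hshift (-e)) xm ξm).sub (hasJet_line_form hΦ2 xm ξm)
  have h0 := ((hasJet_dotProduct hy x₀ ξ).sub (hasJet_line_form hΦ2 x₀ ξ)).const_mul 2
  have hj := ((hp.add hm).sub h0)
  simp only [← sub_eq_add_neg] at hj
  have := hj.of_isLocalMax (Eventually.of_forall fun t => by
    have h1 := hmax (grad Φ (x₀ + t • ξ))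
    have h2 := h.young (xp + t • ξp) (s • (grad Φ (x₀ + t • ξ) + e))
    have h3 := h.young (xm + t • ξm) (s • (grad Φ (x₀ + t • ξ) - e))
    rw [h.eq_grad, h.eq_grad, ← hxp, ← hxm, h.eq_grad, h.eq_grad] at h1
    rw [← hxp, ← hxm]
    linarith)
  obtain ⟨b, c⟩ := this
  simp only [hxp, hxm, dotProduct_smul, smul_eq_mul] at b c
  constructor
  · simp only [sub_dotProduct, smul_dotProduct, add_dotProduct, smul_eq_mul]
    linarith
  · intro hx
    have h1 : (s • (xp + xm)) ⬝ᵥ w = ((2 : ℝ) • x₀) ⬝ᵥ w := by rw [hx]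
    simp only [smul_dotProduct, add_dotProduct, smul_eq_mul] at h1
    linarith

theorem log_det_le_trace {A : Matrix (Fin n) (Fin n) ℝ} (hA : A.PosDef) :
    Real.log A.det ≤ A.trace - n := by
  rw [hA.isHermitian.det_eq_prod_eigenvalues, hA.isHermitian.trace_eq_sum_eigenvalues]
  simp only [RCLike.ofReal_real_eq_id, id]
  rw [Real.log_prod fun i _ => (hA.eigenvalues_pos i).ne']
  calc ∑ i, Real.log (hA.isHermitian.eigenvalues i)
      ≤ ∑ i, (hA.isHermitian.eigenvalues i - 1) :=
        Finset.sum_le_sum fun i _ => Real.log_le_sub_one_of_pos (hA.eigenvalues_pos i)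
    _ = _ := by simp

theorem log_det_mul_le_trace {A B : Matrix (Fin n) (Fin n) ℝ} (hA : A.PosDef) (hB : B.PosDef) :
    Real.log A.det + Real.log B.det ≤ (A * B).trace - n := by
  obtain ⟨R, hR1, -, hR⟩ := exists_frame hA.inv
  rw [Matrix.nonsing_inv_nonsing_inv _ hA.det_pos.ne'.isUnit] at hR
  have hpd : (Rᵀ * B * R).PosDef := by
    have := hB.conjTranspose_mul_mul_same (B := R)
      (Matrix.mulVec_injective_of_isUnit ((Matrix.isUnit_iff_isUnit_det R).2 hR1))
    simpa using this
  have := log_det_le_trace hpd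
  rw [trace_cycle, hR] at this
  rw [← Real.log_mul hA.det_pos.ne' hB.det_pos.ne']
  refine le_trans (le_of_eq ?_) this
  have hdet : A.det = R.det * R.det := by rw [← hR, Matrix.det_mul, Matrix.det_transpose]
  rw [hdet, Matrix.det_mul, Matrix.det_mul, Matrix.det_transpose]
  congr 1; ring

end Legendre

section Caffarelli
variable {n : ℕ} {Φ Ψ V : (Fin n → ℝ) → ℝ} {Q : Matrix (Fin n) (Fin n) ℝ}

/-- Optimality conditions at a maximum of the rescaled second difference of the Legendre
transform. -/
theorem IsLegendre.inverse_hessian_comparison (h : IsLegendre Φ Ψ) (hΦ : ContDiff ℝ 3 Φ)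
    (hpos : ∀ x, (hess Φ x).PosDef) {e x₀ xp xm : Fin n → ℝ} {s : ℝ}
    (hmax : ∀ y, Ψ (s • (y + e)) + Ψ (s • (y - e)) - 2 * Ψ y
      ≤ Ψ (s • (grad Φ x₀ + e)) + Ψ (s • (grad Φ x₀ - e)) - 2 * Ψ (grad Φ x₀))
    (hxp : grad Φ xp = s • (grad Φ x₀ + e)) (hxm : grad Φ xm = s • (grad Φ x₀ - e)) :
    s • (xp + xm) = (2 : ℝ) • x₀ ∧
      ((2 : ℝ) • (hess Φ x₀)⁻¹ - (s ^ 2) • ((hess Φ xp)⁻¹ + (hess Φ xm)⁻¹)).PosSemidef := by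
  have hu : ∀ x, IsUnit (hess Φ x).det := fun x => (hpos x).det_pos.ne'.isUnit
  have hcancel : ∀ x (η : Fin n → ℝ), (hess Φ x).mulVec ((hess Φ x)⁻¹.mulVec η) = η := fun x η => by
    rw [Matrix.mulVec_mulVec, Matrix.mul_nonsing_inv _ (hu x), Matrix.one_mulVec]
  have h1 : s • (xp + xm) = (2 : ℝ) • x₀ := by
    have := (h.second_variation hΦ hmax hxp hxm
      ((hess Φ x₀)⁻¹.mulVec (s • (xp + xm) - (2 : ℝ) • x₀)) 0 0).1
    rw [hcancel, dotProduct_self_eq_zero] at this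
    exact sub_eq_zero.1 this
  refine ⟨h1, Matrix.PosSemidef.of_dotProduct_mulVec_nonneg ?_ fun η => ?_⟩
  · have hh := fun x => (hpos x).inv.isHermitian
    exact ((hh x₀).smul (IsSelfAdjoint.all _)).sub
      (((hh xp).add (hh xm)).smul (IsSelfAdjoint.all _))
  · have h2 := (h.second_variation hΦ hmax hxp hxm ((hess Φ x₀)⁻¹.mulVec η)
      (s • (hess Φ xp)⁻¹.mulVec η) (s • (hess Φ xm)⁻¹.mulVec η)).2 h1
    simp only [Matrix.mulVec_smul, hcancel, smul_dotProduct, dotProduct_smul, smul_eq_mul] at h2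
    simp only [star_trivial, Matrix.sub_mulVec, Matrix.smul_mulVec, Matrix.add_mulVec,
      dotProduct_sub, dotProduct_smul, dotProduct_add, smul_eq_mul]
    simp only [dotProduct_comm _ η] at h2
    linarith

/-- Comparison of log-determinants from a comparison of inverses. -/
theorem log_det_comparison {A B C : Matrix (Fin n) (Fin n) ℝ} (hA : A.PosDef) (hB : B.PosDef)
    (hC : C.PosDef) {s : ℝ} (hs : 0 < s)
    (h : ((2 : ℝ) • A⁻¹ - (s ^ 2) • (B⁻¹ + C⁻¹)).PosSemidef) :
    2 * Real.log A.det - Real.log B.det - Real.log C.det ≤ -(4 * n * Real.log s) := by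
  have key : ∀ B : Matrix (Fin n) (Fin n) ℝ, B.PosDef →
      Real.log A.det - Real.log B.det + 2 * n * Real.log s ≤ s ^ 2 * (A * B⁻¹).trace - n := by
    intro B hB
    have := log_det_mul_le_trace hA (hB.inv.smul (by positivity : 0 < s ^ 2))
    rw [Matrix.det_smul, Matrix.det_nonsing_inv, Ring.inverse_eq_inv', Fintype.card_fin,
      Real.log_mul (by positivity) (inv_ne_zero hB.det_pos.ne'), Real.log_inv, Real.log_pow,
      Real.log_pow, Matrix.mul_smul, Matrix.trace_smul, smul_eq_mul] at this
    push_cast at this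
    linarith
  have h1 := trace_mul_nonneg hA h
  rw [Matrix.mul_sub, Matrix.mul_smul, Matrix.mul_smul, Matrix.mul_add,
    Matrix.mul_nonsing_inv _ hA.det_pos.ne'.isUnit, Matrix.trace_sub, Matrix.trace_smul,
    Matrix.trace_smul, Matrix.trace_add, Matrix.trace_one, Fintype.card_fin] at h1
  simp only [smul_eq_mul] at h1
  have := key B hB
  have := key C hC
  linarith

theorem uniformly_convex_bounded_below {c : ℝ} (hc : 0 < c) (hV : ContDiff ℝ 2 V)
    (hVc : ∀ x d, c * (d ⬝ᵥ d) ≤ d ⬝ᵥ (hess V x).mulVec d) :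
    ∃ B, ∀ x, V 0 - B ≤ V x := by
  refine ⟨(grad V 0 ⬝ᵥ grad V 0) / (2 * c), fun x => ?_⟩
  have h1 := quadratic_lower_bound hV hVc 0 x
  have h2 := two_mul_dotProduct_le x (-grad V 0) hc
  rw [zero_add] at h1
  rw [dotProduct_neg, neg_dotProduct_neg, dotProduct_comm x] at h2
  have : (grad V 0 ⬝ᵥ grad V 0) / (2 * c) = (grad V 0 ⬝ᵥ grad V 0) / c / 2 := by
    rw [div_div, mul_comm]
  linarith

theorem midpoint_gap {c : ℝ} (hc : 0 < c) (hV : ContDiff ℝ 2 V)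
    (hVc : ∀ x d, c * (d ⬝ᵥ d) ≤ d ⬝ᵥ (hess V x).mulVec d) {B : ℝ} (hB : ∀ x, V 0 - B ≤ V x)
    {x₀ xp xm : Fin n → ℝ} {s : ℝ} (hs0 : 0 < s) (hs1 : s < 1)
    (h : s • (xp + xm) = (2 : ℝ) • x₀) :
    c / 4 * ((xp - xm) ⬝ᵥ (xp - xm)) - 2 * (1 - s) * B ≤ V xp + V xm - 2 * V x₀ := by
  set m : Fin n → ℝ := (1 / 2 : ℝ) • (xp + xm) with hm
  have hx₀ : x₀ = s • m := by
    rw [hm, smul_comm, h, smul_smul]; norm_num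
  have e1 : m + (1 / 2 : ℝ) • (xp - xm) = xp := by rw [hm]; module
  have e2 : m + (-1 / 2 : ℝ) • (xp - xm) = xm := by rw [hm]; module
  have h1 := quadratic_lower_bound hV hVc m ((1 / 2 : ℝ) • (xp - xm))
  have h2 := quadratic_lower_bound hV hVc m ((-1 / 2 : ℝ) • (xp - xm))
  rw [e1] at h1
  rw [e2] at h2
  have h3 := quadratic_lower_bound hV hVc x₀ ((1 - s) • m)
  have h4 := quadratic_lower_bound hV hVc x₀ ((-s) • m)
  have e3 : x₀ + (1 - s) • m = m := by rw [hx₀]; module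
  have e4 : x₀ + (-s) • m = 0 := by rw [hx₀]; module
  rw [e3] at h3
  rw [e4] at h4
  simp only [dotProduct_smul, smul_dotProduct, smul_eq_mul] at h1 h2 h3 h4
  have hmm := dotProduct_self_nonneg' m
  have h3' := mul_le_mul_of_nonneg_left h3 hs0.le
  have h4' := mul_le_mul_of_nonneg_left h4 (by linarith : 0 ≤ 1 - s)
  have h5 : 0 ≤ c * s * (1 - s) * (m ⬝ᵥ m) := by
    have : 0 < 1 - s := by linarith
    positivity
  have h6 := mul_le_mul_of_nonneg_left (hB m) (by linarith : 0 ≤ 1 - s)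
  nlinarith

theorem IsLegendre.rescaled_second_difference_le (h : IsLegendre Φ Ψ) (hΦ : ContDiff ℝ 3 Φ)
    (hpos : ∀ x, (hess Φ x).PosDef) (hsurj : Function.Surjective (grad Φ))
    (hV : ContDiff ℝ 2 V) {c C₀ : ℝ} (hc : 0 < c)
    (hVc : ∀ x d, c * (d ⬝ᵥ d) ≤ d ⬝ᵥ (hess V x).mulVec d) (hQ : Q.PosDef)
    (hMA : ∀ x, V x = C₀ + qform Q (grad Φ x) - Real.log (hess Φ x).det)
    {B C' : ℝ} (hB : ∀ x, V 0 - B ≤ V x) (hC' : ∀ y, -C' ≤ Ψ y) (y e : Fin n → ℝ)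
    {s : ℝ} (hs0 : 0 < s) (hs1 : s < 1) :
    Ψ (s • (y + e)) + Ψ (s • (y - e)) - 2 * Ψ y
      ≤ 2 * (1 - s) * (C' + Ψ 0) + 1 / 2 * (e ⬝ᵥ e)
        + 2 / c * (2 * eOpNorm Q * (e ⬝ᵥ e) + 2 * (1 - s) * B - 4 * n * Real.log s) := by
  obtain ⟨y₀, hy₀⟩ := h.exists_max hsurj e hs0 hs1
  obtain ⟨x₀, rfl⟩ := hsurj y₀
  obtain ⟨xp, hxp⟩ := hsurj (s • (grad Φ x₀ + e))
  obtain ⟨xm, hxm⟩ := hsurj (s • (grad Φ x₀ - e))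
  obtain ⟨h1, h2⟩ := h.inverse_hessian_comparison hΦ hpos hy₀ hxp hxm
  have h3 := log_det_comparison (hpos x₀) (hpos xp) (hpos xm) hs0 h2
  have h4 := midpoint_gap hc hV hVc hB hs0 hs1 h1
  rw [hMA xp, hMA xm, hMA x₀, hxp, hxm] at h4
  have hq : qform Q (s • (grad Φ x₀ + e)) + qform Q (s • (grad Φ x₀ - e))
      ≤ 2 * qform Q (grad Φ x₀) + 2 * eOpNorm Q * (e ⬝ᵥ e) := by
    have e0 := form_le_eOpNorm Q e
    have e1 := posSemidef_form_nonneg hQ.posSemidef (grad Φ x₀)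
    have e2 := posSemidef_form_nonneg hQ.posSemidef e
    have e3 : s ^ 2 ≤ 1 := by nlinarith
    simp only [qform_eq_dotProduct, Matrix.mulVec_smul, Matrix.mulVec_add, Matrix.mulVec_sub,
      dotProduct_smul, smul_dotProduct, dotProduct_add, add_dotProduct, dotProduct_sub,
      sub_dotProduct, smul_eq_mul]
    nlinarith
  have hR : c / 4 * ((xp - xm) ⬝ᵥ (xp - xm))
      ≤ 2 * eOpNorm Q * (e ⬝ᵥ e) + 2 * (1 - s) * B - 4 * n * Real.log s := by linarith
  set R := 2 * eOpNorm Q * (e ⬝ᵥ e) + 2 * (1 - s) * B - 4 * n * Real.log s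
  have hR' : 1 / 2 * ((xp - xm) ⬝ᵥ (xp - xm)) ≤ 2 / c * R := by
    rw [div_mul_eq_mul_div 2 c, le_div_iff₀ hc]; linarith
  refine (hy₀ y).trans ?_
  rw [← hxp, ← hxm, h.eq_grad xp, h.eq_grad xm, hxp, hxm]
  have y1 := h.young xp (s • grad Φ x₀)
  have y2 := h.young xm (s • grad Φ x₀)
  have y3 := (h.convexOn hsurj).2 (Set.mem_univ (grad Φ x₀)) (Set.mem_univ 0) hs0.le
      (by linarith : 0 ≤ 1 - s) (by ring)
  simp only [smul_zero, add_zero, smul_eq_mul] at y3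
  have y4 := mul_le_mul_of_nonneg_left (hC' (grad Φ x₀)) (by linarith : 0 ≤ 1 - s)
  have y5 := two_mul_dotProduct_le (xp - xm) e one_pos
  rw [div_one, one_mul] at y5
  have y6 := mul_le_mul_of_nonneg_left y5 hs0.le
  have y7 : 0 ≤ (1 - s) * ((xp - xm) ⬝ᵥ (xp - xm) + e ⬝ᵥ e) :=
    mul_nonneg (by linarith) (add_nonneg (dotProduct_self_nonneg' _) (dotProduct_self_nonneg' _))
  simp only [sub_dotProduct xp xm e, dotProduct_smul, dotProduct_add, dotProduct_sub,
    smul_eq_mul] at *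
  linarith

theorem IsLegendre.second_difference_le (h : IsLegendre Φ Ψ) (hΦ : ContDiff ℝ 3 Φ)
    (hpos : ∀ x, (hess Φ x).PosDef) (hsurj : Function.Surjective (grad Φ))
    (hV : ContDiff ℝ 2 V) {c C₀ : ℝ} (hc : 0 < c)
    (hVc : ∀ x d, c * (d ⬝ᵥ d) ≤ d ⬝ᵥ (hess V x).mulVec d) (hQ : Q.PosDef)
    (hMA : ∀ x, V x = C₀ + qform Q (grad Φ x) - Real.log (hess Φ x).det) (y e : Fin n → ℝ) :
    Ψ (y + e) + Ψ (y - e) - 2 * Ψ y ≤ (4 * eOpNorm Q / c + 1 / 2) * (e ⬝ᵥ e) := by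
  obtain ⟨B, hB⟩ := uniformly_convex_bounded_below hc hV hVc
  obtain ⟨C', hC'⟩ := h.coercive
  have hC'' : ∀ y, -C' ≤ Ψ y := fun y => by
    have := hC' y
    have := norm_nonneg y
    linarith
  have hcont := h.continuous hsurj
  have l1 : Tendsto (fun s : ℝ => Ψ (s • (y + e)) + Ψ (s • (y - e)) - 2 * Ψ y) (nhdsWithin 1 (Set.Iio 1))
      (nhds (Ψ ((1 : ℝ) • (y + e)) + Ψ ((1 : ℝ) • (y - e)) - 2 * Ψ y)) :=
    (Continuous.tendsto (by fun_prop) 1).mono_left nhdsWithin_le_nhds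
  have l2 : Tendsto (fun s : ℝ => 2 * (1 - s) * (C' + Ψ 0) + 1 / 2 * (e ⬝ᵥ e)
        + 2 / c * (2 * eOpNorm Q * (e ⬝ᵥ e) + 2 * (1 - s) * B - 4 * n * Real.log s)) (nhdsWithin 1 (Set.Iio 1))
      (nhds (2 * (1 - 1) * (C' + Ψ 0) + 1 / 2 * (e ⬝ᵥ e)
        + 2 / c * (2 * eOpNorm Q * (e ⬝ᵥ e) + 2 * (1 - 1) * B - 4 * n * Real.log 1))) := by
    refine Tendsto.mono_left ?_ nhdsWithin_le_nhds
    have : ContinuousAt Real.log 1 := Real.continuousAt_log one_ne_zero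
    have h1 : ContinuousAt (fun s : ℝ => 2 * (1 - s) * (C' + Ψ 0) + 1 / 2 * (e ⬝ᵥ e)
        + 2 / c * (2 * eOpNorm Q * (e ⬝ᵥ e) + 2 * (1 - s) * B - 4 * n * Real.log s)) 1 := by
      fun_prop
    exact h1
  have := le_of_tendsto_of_tendsto l1 l2 (by
    filter_upwards [Ioo_mem_nhdsLT (zero_lt_one (α := ℝ))] with s hs
    exact h.rescaled_second_difference_le hΦ hpos hsurj hV hc hVc hQ hMA hB hC'' y e hs.1 hs.2)
  simp only [one_smul, sub_self, mul_zero, zero_mul, Real.log_one, add_zero, sub_zero] at this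
  refine this.trans (le_of_eq ?_)
  ring

/-- A Hessian lower bound for the Brenier potential, with a non-sharp constant. -/
theorem hessian_lower_bound_crude (hΦ : ContDiff ℝ 3 Φ)
    (hpos : ∀ x, (hess Φ x).PosDef) (hsurj : Function.Surjective (grad Φ))
    (hV : ContDiff ℝ 2 V) {c C₀ : ℝ} (hc : 0 < c)
    (hVc : ∀ x d, c * (d ⬝ᵥ d) ≤ d ⬝ᵥ (hess V x).mulVec d) (hQ : Q.PosDef)
    (hMA : ∀ x, V x = C₀ + qform Q (grad Φ x) - Real.log (hess Φ x).det) :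
    ∃ K, 0 < K ∧ ∀ x ξ, ξ ⬝ᵥ ξ ≤ K * (ξ ⬝ᵥ (hess Φ x).mulVec ξ) := by
  obtain ⟨Ψ, h⟩ := exists_isLegendre (hΦ.of_le (by norm_num)) hpos hsurj
  set K := 4 * eOpNorm Q / c + 1 / 2 with hKdef
  have hK : 0 < K := by
    have := eOpNorm_nonneg Q
    positivity
  refine ⟨K, hK, fun x ξ => ?_⟩
  have hΦ2 : ContDiff ℝ 2 Φ := hΦ.of_le (by norm_num)
  set e : Fin n → ℝ := (1 / K) • ξ with he
  have hsq : HasJet (fun t : ℝ => t * t) 0 0 2 := by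
    simpa using (HasJet.linear 0 1).mul (HasJet.linear 0 1)
  have hj := ((hsq.const_mul (2 * (ξ ⬝ᵥ e) - K * (e ⬝ᵥ e))).sub
    ((hasJet_line_form hΦ2 x ξ).add (hasJet_line_form hΦ2 x (-ξ)))).of_isLocalMax
    (Eventually.of_forall fun t => by
      have h1 := h.second_difference_le hΦ hpos hsurj hV hc hVc hQ hMA (grad Φ x) (t • e)
      have h2 := h.young (x + t • ξ) (grad Φ x + t • e)
      have h3 := h.young (x + t • -ξ) (grad Φ x - t • e)
      rw [h.eq_grad, ← hKdef] at h1
      simp only [add_dotProduct, dotProduct_add, dotProduct_sub, dotProduct_smul, smul_dotProduct,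
        smul_eq_mul, neg_dotProduct, smul_neg] at *
      linarith)
  have h1 := hj.2
  simp only [Matrix.mulVec_neg, dotProduct_neg, neg_dotProduct, neg_neg, he, dotProduct_smul,
    smul_dotProduct, smul_eq_mul] at h1
  have h2 : K * (1 / K * (1 / K * (ξ ⬝ᵥ ξ))) = 1 / K * (ξ ⬝ᵥ ξ) := by field_simp
  rw [h2] at h1
  have h3 : 1 / K * (ξ ⬝ᵥ ξ) ≤ ξ ⬝ᵥ (hess Φ x).mulVec ξ := by linarith
  rwa [one_div, inv_mul_le_iff₀ hK] at h3

end Caffarelli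

section SharpCaffarelli
variable {n : ℕ} {Φ V : (Fin n → ℝ) → ℝ} {Q : Matrix (Fin n) (Fin n) ℝ}

theorem continuous_hess (hΦ : ContDiff ℝ 2 Φ) : Continuous (hess Φ) :=
  continuous_matrix fun i j => (contDiff_pd2 hΦ (k := 0) (by norm_num) i j).continuous

theorem continuous_inv_hess (hΦ : ContDiff ℝ 2 Φ) (hpos : ∀ x, (hess Φ x).PosDef) :
    Continuous fun x => (hess Φ x)⁻¹ := by
  have hc := continuous_hess hΦ
  have : (fun x => (hess Φ x)⁻¹) = fun x => (hess Φ x).det⁻¹ • (hess Φ x).adjugate := by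
    funext x
    rw [Matrix.inv_def, Ring.inverse_eq_inv']
  rw [this]
  exact (hc.matrix_det.inv₀ fun x => (hpos x).det_pos.ne').smul hc.matrix_adjugate

theorem HasLineJets.add_const {φ : (Fin n → ℝ) → ℝ} {x₀ a₁ : Fin n → ℝ}
    {a₂ : Matrix (Fin n) (Fin n) ℝ} (h : HasLineJets φ x₀ a₁ a₂) (k : ℝ) :
    HasLineJets (fun x => φ x + k) x₀ a₁ a₂ := fun d =>
  ((h d).add (HasJet.const k)).congr_jet rfl (add_zero _) (add_zero _)

theorem variational_le_inv_form {A : Matrix (Fin n) (Fin n) ℝ} (hA : A.PosDef)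
    (w e : Fin n → ℝ) : 2 * (w ⬝ᵥ e) - w ⬝ᵥ A.mulVec w ≤ e ⬝ᵥ A⁻¹.mulVec e := by
  have hAe : A.mulVec (A⁻¹.mulVec e) = e := by
    rw [Matrix.mulVec_mulVec, Matrix.mul_nonsing_inv _ hA.det_pos.ne'.isUnit, Matrix.one_mulVec]
  have h := posSemidef_form_nonneg hA.posSemidef (w - (1 : ℝ) • A⁻¹.mulVec e)
  rw [form_sub_smul (posDef_isSymm hA), hAe, dotProduct_comm (A⁻¹.mulVec e)] at h
  linarith

/-- The sharp bound on the inverse Hessian of the Brenier potential. -/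
theorem inverse_hessian_le_sharp (hΦ : ContDiff ℝ 5 Φ) (hV : ContDiff ℝ 3 V) (hQ : Q.IsSymm)
    (hQpos : Q.PosDef) (hpos : ∀ x, (hess Φ x).PosDef) {c C k : ℝ} (hc : 0 < c) (hk : 0 < k)
    (hkq : c * k ^ 2 = 2 * eOpNorm Q)
    (hVc : ∀ x d, c * (d ⬝ᵥ d) ≤ d ⬝ᵥ (hess V x).mulVec d)
    (hMA : ∀ x, V x = C + qform Q (grad Φ x) - Real.log (hess Φ x).det)
    {K : ℝ} (hK0 : 0 < K)
    (hK : ∀ x y : Fin n → ℝ, y ⬝ᵥ y ≤ K * (y ⬝ᵥ (hess Φ x).mulVec y)) (x e : Fin n → ℝ) :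
    e ⬝ᵥ (hess Φ x)⁻¹.mulVec e ≤ k * (e ⬝ᵥ e) := by
  have hΦ2 : ContDiff ℝ 2 Φ := hΦ.of_le (by norm_num)
  rcases eq_or_ne e 0 with rfl | he
  · simp
  set r := e ⬝ᵥ e with hr
  have hr0 : 0 < r := lt_of_le_of_ne (dotProduct_self_nonneg' e)
    fun h => he (dotProduct_self_eq_zero.1 h.symm)
  have hcont := continuous_inv_hess hΦ2 hpos
  have hu0 : ∀ x, 0 ≤ e ⬝ᵥ (hess Φ x)⁻¹.mulVec e := fun x =>
    posSemidef_form_nonneg (hpos x).inv.posSemidef e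
  suffices h : (e ⬝ᵥ (hess Φ x)⁻¹.mulVec e) ^ 2 - (k * r) ^ 2 ≤ 0 by
    exact abs_le_of_sq_le_sq' (by linarith) (by positivity) |>.2
  refine cutoff_maximum hΦ2 hpos hQpos hK0 hK (Z := Set.univ ×ˢ {0})
    (G := fun z => (e ⬝ᵥ (hess Φ z.1)⁻¹.mulVec e) ^ 2 - (k * r) ^ 2) (a := 2 * c / r)
    (isClosed_univ.prod isClosed_singleton) ?_ ?_ (by positivity) ?_ (x, 0) (by simp)
  · rintro ⟨y, v⟩ hz
    have : v = 0 := by simpa using hz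
    simp [this, hK0.le]
  · have h1 : Continuous fun z : (Fin n → ℝ) × (Fin n → ℝ) => (hess Φ z.1)⁻¹ :=
      hcont.comp continuous_fst
    have h2 : Continuous fun z : (Fin n → ℝ) × (Fin n → ℝ) => (hess Φ z.1)⁻¹.mulVec e :=
      h1.matrix_mulVec continuous_const
    exact ((continuous_const.dotProduct h2).pow 2).sub continuous_const
  · intro x₀ v₀ _ hG φ a₁ a₂ hφ hle heq
    dsimp only at hG hle heq ⊢
    set N := (hess Φ x₀)⁻¹ with hN
    set u := e ⬝ᵥ N.mulVec e with hu
    set G := u ^ 2 - (k * r) ^ 2 with hGdef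
    have hu1 : 0 ≤ u := hu0 x₀
    have key := inverse_hessian_maximum hΦ hV hQ hpos hMA
      (hφ.add_const ((k * r) ^ 2 + u ^ 2)) (α := 2 * u) (by positivity) (e := e)
      (by
        filter_upwards [hle] with x hx w
        have h1 := hx 0 (by simp)
        have h2 := variational_le_inv_form (hpos x) w e
        have h3 := mul_le_mul_of_nonneg_left h2 (by positivity : 0 ≤ 2 * u)
        nlinarith [sq_nonneg (e ⬝ᵥ (hess Φ x)⁻¹.mulVec e - u)])
      hN (by rw [← heq, ← hu]; ring)
    refine le_trans ?_ key
    have h1 := hVc x₀ (N.mulVec e)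
    have h2 := form_le_eOpNorm Q e
    have h3 := dotProduct_self_nonneg' (N.mulVec e - (u / r) • e)
    rw [dotProduct_sub_smul_self, dotProduct_comm _ e, ← hu, ← hr] at h3
    have h4 : u ^ 2 / r ≤ N.mulVec e ⬝ᵥ N.mulVec e := by
      have : 2 * (u / r) * u - (u / r) ^ 2 * r = u ^ 2 / r := by field_simp; ring
      linarith
    have h5 : c * (u ^ 2 / r) ≤ N.mulVec e ⬝ᵥ (hess V x₀).mulVec (N.mulVec e) :=
      (mul_le_mul_of_nonneg_left h4 hc.le).trans h1
    have h6 : √G ≤ u := by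
      rw [Real.sqrt_le_left hu1, hGdef]
      nlinarith [sq_nonneg (k * r)]
    calc 2 * c / r * (G * √G) ≤ 2 * c / r * (G * u) := by gcongr
      _ = 2 * u * (c * (u ^ 2 / r) - c * k ^ 2 * r) := by rw [hGdef]; field_simp
      _ = 2 * u * (c * (u ^ 2 / r) - 2 * (eOpNorm Q * r)) := by rw [hkq]; ring
      _ ≤ _ := by gcongr

/-- The sharp lower bound on the Hessian of the Brenier potential. -/
theorem hessian_ge_sharp (hΦ : ContDiff ℝ 5 Φ) (hV : ContDiff ℝ 3 V) (hQ : Q.IsSymm)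
    (hQpos : Q.PosDef) (hpos : ∀ x, (hess Φ x).PosDef) {c C k : ℝ} (hc : 0 < c) (hk : 0 < k)
    (hkq : c * k ^ 2 = 2 * eOpNorm Q)
    (hVc : ∀ x d, c * (d ⬝ᵥ d) ≤ d ⬝ᵥ (hess V x).mulVec d)
    (hMA : ∀ x, V x = C + qform Q (grad Φ x) - Real.log (hess Φ x).det)
    (hsurj : Function.Surjective (grad Φ)) (x y : Fin n → ℝ) :
    y ⬝ᵥ y ≤ k * (y ⬝ᵥ (hess Φ x).mulVec y) := by
  obtain ⟨K, hK0, hK⟩ := hessian_lower_bound_crude (hΦ.of_le (by norm_num)) hpos hsurj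
    (hV.of_le (by norm_num)) hc hVc hQpos hMA
  have := dotProduct_le_inv_form (hpos x).inv hk
    (inverse_hessian_le_sharp hΦ hV hQ hQpos hpos hc hk hkq hVc hMA hK0 hK x) y
  rwa [Matrix.nonsing_inv_nonsing_inv _ (hpos x).det_pos.ne'.isUnit] at this

end SharpCaffarelli

section TraceInequalities
variable {n : ℕ} {A M T X B : Matrix (Fin n) (Fin n) ℝ}

theorem trace_inv_mul_inv_mul_nonneg (hA : A.PosDef) (hT : T.IsSymm) :
    0 ≤ (A⁻¹ * T * A⁻¹ * T).trace := by
  have h : (Tᴴ * A⁻¹ * T).PosSemidef := hA.inv.posSemidef.conjTranspose_mul_mul_same T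
  rw [Matrix.conjTranspose_eq_transpose_of_trivial, hT.eq] at h
  simpa only [Matrix.mul_assoc] using trace_mul_nonneg hA.inv h

theorem variational_le_trace (hA : A.PosDef) (hT : T.IsSymm) (hX : X.IsSymm) :
    2 * (T * X).trace - (A * X * (A * X)).trace ≤ (A⁻¹ * T * A⁻¹ * T).trace := by
  have hu := hA.det_pos.ne'.isUnit
  have hAs := posDef_isSymm hA
  have hD : (T - A * X * A).IsSymm := by
    rw [Matrix.IsSymm, Matrix.transpose_sub, Matrix.transpose_mul, Matrix.transpose_mul, hT.eq,
      hX.eq, hAs.eq, Matrix.mul_assoc]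
  have h := trace_inv_mul_inv_mul_nonneg hA hD
  have e0 : A⁻¹ * (T - A * X * A) = A⁻¹ * T - X * A := by
    rw [Matrix.mul_sub, Matrix.mul_assoc A, Matrix.nonsing_inv_mul_cancel_left _ _ hu]
  have e1 : A⁻¹ * (T - A * X * A) * A⁻¹ * (T - A * X * A)
      = (A⁻¹ * T - X * A) * (A⁻¹ * T - X * A) := by
    rw [Matrix.mul_assoc _ A⁻¹, e0]
  have e2 : (A⁻¹ * T * (X * A)).trace = (T * X).trace := by
    rw [Matrix.trace_mul_comm, Matrix.mul_assoc, Matrix.mul_nonsing_inv_cancel_left _ _ hu,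
      Matrix.trace_mul_comm]
  have e3 : (X * A * (A⁻¹ * T)).trace = (T * X).trace := by
    rw [Matrix.mul_assoc, Matrix.mul_nonsing_inv_cancel_left _ _ hu, Matrix.trace_mul_comm]
  have e4 : (X * A * (X * A)).trace = (A * X * (A * X)).trace := by
    rw [Matrix.mul_assoc, Matrix.trace_mul_comm]
    simp only [Matrix.mul_assoc]
  rw [e1, Matrix.sub_mul, Matrix.mul_sub, Matrix.mul_sub, Matrix.trace_sub, Matrix.trace_sub,
    Matrix.trace_sub, e2, e3, e4, ← Matrix.mul_assoc] at h
  linarith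

/-- Completing the square in the source term of the Calabi inequality. -/
theorem trace_source_lower_bound (hA : A.PosDef) (hX : X.IsSymm) (hB : B.IsSymm)
    (hM : M.IsSymm) {k : ℝ} (hk : 0 < k)
    (h : ∀ y : Fin n → ℝ, y ⬝ᵥ y ≤ k * (y ⬝ᵥ M.mulVec y)) :
    -(k / 2) * (A⁻¹ * B * B).trace ≤ 2 * (A * (X * M * X)).trace - 2 * (X * B).trace := by
  have hu := hA.det_pos.ne'.isUnit
  have hAi := posDef_isSymm hA.inv
  have h1 : (k • M - 1).PosSemidef := by
    refine Matrix.posSemidef_iff_dotProduct_mulVec.2 ⟨?_, fun y => ?_⟩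
    · simp [Matrix.IsHermitian, Matrix.transpose_sub, hM.eq]
    · have := h y
      simp only [star_trivial, Matrix.sub_mulVec, Matrix.smul_mulVec, Matrix.one_mulVec,
        dotProduct_sub, dotProduct_smul, smul_eq_mul]
      linarith
  have h2 := trace_mul_nonneg hA (h1.conjTranspose_mul_mul_same X)
  rw [Matrix.conjTranspose_eq_transpose_of_trivial, hX.eq, Matrix.mul_sub, Matrix.sub_mul,
    Matrix.mul_sub, Matrix.trace_sub, Matrix.mul_one, Matrix.mul_smul, Matrix.smul_mul,
    Matrix.mul_smul, Matrix.trace_smul, smul_eq_mul] at h2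
  have h3 := trace_mul_nonneg hA
    (Matrix.posSemidef_self_mul_conjTranspose (X - (k / 2) • (A⁻¹ * B)))
  rw [Matrix.conjTranspose_eq_transpose_of_trivial, Matrix.transpose_sub, Matrix.transpose_smul,
    Matrix.transpose_mul, hX.eq, hB.eq, hAi.eq] at h3
  have e1 : (A * (X * (B * A⁻¹))).trace = (X * B).trace := by
    rw [Matrix.trace_mul_comm, ← Matrix.mul_assoc X, Matrix.nonsing_inv_mul_cancel_right _ _ hu]
  have e2 : (A * (A⁻¹ * B * X)).trace = (X * B).trace := by
    rw [Matrix.mul_assoc, Matrix.mul_nonsing_inv_cancel_left _ _ hu, Matrix.trace_mul_comm]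
  have e3 : (A * (A⁻¹ * B * (B * A⁻¹))).trace = (A⁻¹ * B * B).trace := by
    rw [Matrix.mul_assoc, Matrix.mul_nonsing_inv_cancel_left _ _ hu, ← Matrix.mul_assoc,
      Matrix.trace_mul_comm, Matrix.mul_assoc]
  simp only [Matrix.sub_mul, Matrix.mul_sub, Matrix.trace_sub, Matrix.mul_smul, Matrix.smul_mul, Matrix.trace_smul, smul_eq_mul, e1, e2, e3] at h3
  have h4 : 0 ≤ k * ((A * (X * M * X)).trace - (X * B).trace + k / 4 * (A⁻¹ * B * B).trace) := by
    linarith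
  have := nonneg_of_mul_nonneg_right h4 hk
  linarith

end TraceInequalities

section CalabiBound
variable {n : ℕ} {Φ V : (Fin n → ℝ) → ℝ} {Q : Matrix (Fin n) (Fin n) ℝ}

theorem dirHess_smul (f : (Fin n → ℝ) → ℝ) (t : ℝ) (v x : Fin n → ℝ) :
    dirHess f (t • v) x = t • dirHess f v x := by
  ext i j
  simp [dirHess, Finset.mul_sum, mul_assoc]

theorem continuous_dirHess (hΦ : ContDiff ℝ 3 Φ) :
    Continuous fun z : (Fin n → ℝ) × (Fin n → ℝ) => dirHess Φ z.2 z.1 := by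
  refine continuous_matrix fun i j => ?_
  simp only [dirHess, Matrix.of_apply]
  refine continuous_finsetSum _ fun k _ => ?_
  exact ((continuous_apply k).comp continuous_snd).mul
    ((contDiff_pd3 hΦ (k := 0) (by norm_num) k i j).continuous.comp continuous_fst)

/-- The Calabi form `g(v, v)` at `x`. -/
def calabiForm (Φ : (Fin n → ℝ) → ℝ) (x v : Fin n → ℝ) : ℝ :=
  ((hess Φ x)⁻¹ * dirHess Φ v x * (hess Φ x)⁻¹ * dirHess Φ v x).trace

theorem sum_calabi (hΦ : ContDiff ℝ 3 Φ) (hpos : ∀ x, (hess Φ x).PosDef) (x v : Fin n → ℝ) :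
    ∑ i, ∑ j, calabi Φ i j x * v i * v j = calabiForm Φ x v := by
  have hT : ∀ a b, dirHess Φ v x a b = ∑ i, v i * pd3 Φ i a b x := fun a b => rfl
  have hTs : ∀ a b, dirHess Φ v x a b = dirHess Φ v x b a := fun a b =>
    ((dirHess_isSymm hΦ v x).apply a b).symm
  have hNs : ∀ a b, (hess Φ x)⁻¹ a b = (hess Φ x)⁻¹ b a := fun a b =>
    ((posDef_isSymm (hpos x).inv).apply a b).symm
  have h1 : ∑ i, ∑ j, calabi Φ i j x * v i * v j
      = ∑ a, ∑ b, ∑ c, ∑ d, dirHess Φ v x a b * dirHess Φ v x c d * (hess Φ x)⁻¹ a c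
        * (hess Φ x)⁻¹ b d := by
    simp only [calabi, ihess, Finset.sum_mul]
    calc _ = ∑ i, ∑ a, ∑ b, ∑ c, ∑ d, ∑ j, pd3 Φ i a b x * pd3 Φ j c d x * (hess Φ x)⁻¹ a c
          * (hess Φ x)⁻¹ b d * v i * v j := by
          refine Finset.sum_congr rfl fun i _ => ?_
          rw [Finset.sum_comm]; refine Finset.sum_congr rfl fun a _ => ?_
          rw [Finset.sum_comm]; refine Finset.sum_congr rfl fun b _ => ?_
          rw [Finset.sum_comm]; refine Finset.sum_congr rfl fun c _ => ?_
          rw [Finset.sum_comm]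
      _ = ∑ a, ∑ b, ∑ c, ∑ d, ∑ i, ∑ j, pd3 Φ i a b x * pd3 Φ j c d x * (hess Φ x)⁻¹ a c
          * (hess Φ x)⁻¹ b d * v i * v j := by
          rw [Finset.sum_comm]; refine Finset.sum_congr rfl fun a _ => ?_
          rw [Finset.sum_comm]; refine Finset.sum_congr rfl fun b _ => ?_
          rw [Finset.sum_comm]; refine Finset.sum_congr rfl fun c _ => ?_
          rw [Finset.sum_comm]
      _ = _ := by
          refine Finset.sum_congr rfl fun a _ => Finset.sum_congr rfl fun b _ =>
            Finset.sum_congr rfl fun c _ => Finset.sum_congr rfl fun d _ => ?_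
          rw [hT, hT, Finset.sum_mul_sum, Finset.sum_mul, Finset.sum_mul]
          refine Finset.sum_congr rfl fun i _ => ?_
          rw [Finset.sum_mul, Finset.sum_mul]
          exact Finset.sum_congr rfl fun j _ => by ring
  rw [h1]
  simp only [calabiForm, Matrix.trace, Matrix.diag_apply, Matrix.mul_apply, Finset.sum_mul]
  calc _ = ∑ c, ∑ a, ∑ b, ∑ d, dirHess Φ v x a b * dirHess Φ v x c d * (hess Φ x)⁻¹ a c
        * (hess Φ x)⁻¹ b d := by
        have : ∀ a, ∑ b, ∑ c, ∑ d, dirHess Φ v x a b * dirHess Φ v x c d * (hess Φ x)⁻¹ a c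
            * (hess Φ x)⁻¹ b d = ∑ c, ∑ b, ∑ d, dirHess Φ v x a b * dirHess Φ v x c d
            * (hess Φ x)⁻¹ a c * (hess Φ x)⁻¹ b d := fun a => Finset.sum_comm
        simp only [this]
        rw [Finset.sum_comm]
    _ = ∑ c, ∑ d, ∑ b, ∑ a, dirHess Φ v x a b * dirHess Φ v x c d * (hess Φ x)⁻¹ a c
        * (hess Φ x)⁻¹ b d := by
        refine Finset.sum_congr rfl fun c _ => ?_
        rw [Finset.sum_comm]
        have : ∀ b, ∑ a, ∑ d, dirHess Φ v x a b * dirHess Φ v x c d * (hess Φ x)⁻¹ a c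
            * (hess Φ x)⁻¹ b d = ∑ d, ∑ a, dirHess Φ v x a b * dirHess Φ v x c d
            * (hess Φ x)⁻¹ a c * (hess Φ x)⁻¹ b d := fun b => Finset.sum_comm
        simp only [this]
        rw [Finset.sum_comm]
    _ = _ := by
        refine Finset.sum_congr rfl fun c _ => Finset.sum_congr rfl fun d _ =>
          Finset.sum_congr rfl fun b _ => Finset.sum_congr rfl fun a _ => ?_
        rw [hNs a c, hTs c d]
        ring

theorem calabiForm_smul (t : ℝ) (x v : Fin n → ℝ) :
    calabiForm Φ x (t • v) = t ^ 2 * calabiForm Φ x v := by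
  simp only [calabiForm, dirHess_smul, Matrix.mul_smul, Matrix.smul_mul, Matrix.trace_smul,
    smul_eq_mul]
  ring

theorem calabiForm_nonneg (hΦ : ContDiff ℝ 3 Φ) (hpos : ∀ x, (hess Φ x).PosDef)
    (x v : Fin n → ℝ) : 0 ≤ calabiForm Φ x v :=
  trace_inv_mul_inv_mul_nonneg (hpos x) (dirHess_isSymm hΦ v x)

theorem continuous_calabiForm (hΦ : ContDiff ℝ 3 Φ) (hpos : ∀ x, (hess Φ x).PosDef) :
    Continuous fun z : (Fin n → ℝ) × (Fin n → ℝ) => calabiForm Φ z.1 z.2 := by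
  have h1 : Continuous fun z : (Fin n → ℝ) × (Fin n → ℝ) => (hess Φ z.1)⁻¹ :=
    (continuous_inv_hess (hΦ.of_le (by norm_num)) hpos).comp continuous_fst
  have h2 := continuous_dirHess hΦ
  exact (((h1.matrix_mul h2).matrix_mul h1).matrix_mul h2).matrix_trace

/-- A bound on unit vectors for a sum of quadratic forms, extended by homogeneity. -/
theorem calabiForm_add_le_of_unit {α β b : ℝ} {x : Fin n → ℝ} (hpos : (hess Φ x).PosDef)
    (h : ∀ v, v ⬝ᵥ (hess Φ x).mulVec v = 1 → α * calabiForm Φ x v + β * (v ⬝ᵥ v) ≤ b)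
    (w : Fin n → ℝ) :
    α * calabiForm Φ x w + β * (w ⬝ᵥ w) ≤ b * (w ⬝ᵥ (hess Φ x).mulVec w) := by
  rcases eq_or_ne w 0 with rfl | hw
  · have := calabiForm_smul (Φ := Φ) 0 x 0
    rw [zero_smul, zero_pow two_ne_zero, zero_mul] at this
    simp [this]
  · have hq : 0 < w ⬝ᵥ (hess Φ x).mulVec w := by simpa using hpos.dotProduct_mulVec_pos hw
    set p := w ⬝ᵥ (hess Φ x).mulVec w with hp
    have hs : (√p)⁻¹ ^ 2 = p⁻¹ := by rw [inv_pow, Real.sq_sqrt hq.le]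
    have := h ((√p)⁻¹ • w) (by
      rw [Matrix.mulVec_smul, dotProduct_smul, smul_dotProduct, smul_smul, ← pow_two, hs, ← hp,
        smul_eq_mul, inv_mul_cancel₀ hq.ne'])
    rw [calabiForm_smul, dotProduct_smul, smul_dotProduct, smul_smul, ← pow_two, hs,
      smul_eq_mul] at this
    have h2 := mul_le_mul_of_nonneg_right this hq.le
    have : (α * (p⁻¹ * calabiForm Φ x w) + β * (p⁻¹ * w ⬝ᵥ w)) * p
        = α * calabiForm Φ x w + β * (w ⬝ᵥ w) := by field_simp
    linarith

theorem trace_dirHess_le {S : ℝ} {x : Fin n → ℝ}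
    (hS : ∀ e : Fin n → ℝ, (∑ k, e k ^ 2) = 1 →
      ((hess V x)⁻¹ * dirHess V e x * dirHess V e x).trace ≤ S) (v : Fin n → ℝ) :
    ((hess V x)⁻¹ * dirHess V v x * dirHess V v x).trace ≤ S * (v ⬝ᵥ v) := by
  rcases eq_or_ne v 0 with rfl | hv
  · have := dirHess_smul V 0 0 x
    rw [zero_smul, zero_smul] at this
    simp [this]
  · have hp : 0 < v ⬝ᵥ v := lt_of_le_of_ne (dotProduct_self_nonneg' v)
      fun h => hv (dotProduct_self_eq_zero.1 h.symm)
    set p := v ⬝ᵥ v with hpd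
    have hs : (√p)⁻¹ ^ 2 = p⁻¹ := by rw [inv_pow, Real.sq_sqrt hp.le]
    have := hS ((√p)⁻¹ • v) (by
      simp only [Pi.smul_apply, smul_eq_mul, mul_pow, hs, ← Finset.mul_sum]
      rw [show ∑ k, v k ^ 2 = p by simp [hpd, dotProduct, pow_two], inv_mul_cancel₀ hp.ne'])
    simp only [dirHess_smul, Matrix.mul_smul, Matrix.smul_mul, Matrix.trace_smul, smul_smul,
      ← pow_two, hs] at this
    rwa [smul_eq_mul, inv_mul_le_iff₀ hp, mul_comm] at this

/-- The scalar inequality closing the maximum principle for the Calabi form. -/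
theorem calabi_scalar_bound {c k S f u y m p D r G : ℝ} (hc : 0 < c) (hk : 0 < k) (hS : 0 ≤ S)
    (hf : 0 ≤ f) (hu : 0 ≤ u) (hy : 0 ≤ y) (hyu : u - k / 2 ≤ y) (hyk : y ≤ k / 2)
    (hm : 0 ≤ m) (hpm : 4 * p ≤ k * (2 * m + c * u)) (hD : -(k / 2) * (S * u) ≤ D)
    (hr : c * u ≤ r) (hG : G = f ^ 2 + 2 * S * y ^ 2 - S * k ^ 2 / 2) (hG0 : 0 ≤ G) :
    G * √G ≤ 2 * f * D
      + 2 * (f ^ 2 + 2 * S * y ^ 2 + S * y * k) * (2 * m + r + 1 / 2 * f)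
      - 4 * (4 * S * y) * p := by
  set Λ := f ^ 2 + 2 * S * y ^ 2 + S * y * k with hΛ
  have hSy : 0 ≤ S * y := by positivity
  have hΛ1 : 2 * (S * y) * k ≤ Λ := by
    have : S * k * y ≤ S * k * (k / 2) := by gcongr
    linarith
  have hΛ0 : 0 ≤ Λ := by positivity
  have hGf : G ≤ Λ - k * S * u := by
    have : S * k * (u - k / 2) ≤ S * k * y := by gcongr
    linarith
  have hsq : √G ≤ f := by
    rw [Real.sqrt_le_left hf]
    have : S * y ^ 2 ≤ S * (k / 2) ^ 2 := by gcongr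
    linarith
  have h1 : G * √G ≤ (Λ - k * S * u) * f := by
    calc G * √G ≤ G * f := by gcongr
      _ ≤ _ := by gcongr
  have h2 : 2 * f * (-(k / 2) * (S * u)) ≤ 2 * f * D := by gcongr
  have h3 : 0 ≤ 2 * m + c * u := by positivity
  have h4 : 4 * (S * y) * (4 * p) ≤ 2 * Λ * (2 * m + c * u) := by
    calc 4 * (S * y) * (4 * p) ≤ 4 * (S * y) * (k * (2 * m + c * u)) := by gcongr
      _ = 2 * (2 * (S * y) * k) * (2 * m + c * u) := by ring
      _ ≤ _ := by gcongr
  have h5 : 2 * Λ * (c * u) ≤ 2 * Λ * r := by gcongr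
  linarith

/-- The Calabi form is bounded on unit vectors of the Hessian metric. -/
theorem calabiForm_sq_le (hΦ : ContDiff ℝ 5 Φ) (hV : ContDiff ℝ 3 V) (hQ : Q.IsSymm)
    (hQpos : Q.PosDef) (hpos : ∀ x, (hess Φ x).PosDef) (hVpos : ∀ x, (hess V x).PosDef)
    {c C k S : ℝ} (hc : 0 < c) (hk : 0 < k) (hS0 : 0 ≤ S)
    (hkq : c * k ^ 2 = 2 * eOpNorm Q)
    (hVc : ∀ x d, c * (d ⬝ᵥ d) ≤ d ⬝ᵥ (hess V x).mulVec d)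
    (hMA : ∀ x, V x = C + qform Q (grad Φ x) - Real.log (hess Φ x).det)
    (hK : ∀ x y : Fin n → ℝ, y ⬝ᵥ y ≤ k * (y ⬝ᵥ (hess Φ x).mulVec y))
    (hS : ∀ x v, ((hess V x)⁻¹ * dirHess V v x * dirHess V v x).trace ≤ S * (v ⬝ᵥ v))
    (x v : Fin n → ℝ) (hv : v ⬝ᵥ (hess Φ x).mulVec v = 1) :
    calabiForm Φ x v ^ 2 ≤ S * k ^ 2 / 2 := by
  have hΦ2 : ContDiff ℝ 2 Φ := hΦ.of_le (by norm_num)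
  have hΦ3 : ContDiff ℝ 3 Φ := hΦ.of_le (by norm_num)
  have hcf := continuous_calabiForm hΦ3 hpos
  have hdot : Continuous fun z : (Fin n → ℝ) × (Fin n → ℝ) => z.2 ⬝ᵥ z.2 :=
    continuous_snd.dotProduct continuous_snd
  suffices h : calabiForm Φ x v ^ 2 + 2 * S * (max (v ⬝ᵥ v - k / 2) 0) ^ 2 - S * k ^ 2 / 2 ≤ 0 by
    have : 0 ≤ 2 * S * (max (v ⬝ᵥ v - k / 2) 0) ^ 2 := by positivity
    linarith
  refine cutoff_maximum hΦ2 hpos hQpos hk hK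
    (Z := {z | z.2 ⬝ᵥ (hess Φ z.1).mulVec z.2 = 1})
    (G := fun z => calabiForm Φ z.1 z.2 ^ 2 + 2 * S * (max (z.2 ⬝ᵥ z.2 - k / 2) 0) ^ 2
      - S * k ^ 2 / 2) (a := 1) ?_ ?_ ?_ one_pos ?_ (x, v) hv
  · exact isClosed_eq (continuous_snd.dotProduct
      (((continuous_hess hΦ2).comp continuous_fst).matrix_mulVec continuous_snd)) continuous_const
  · rintro ⟨x, v⟩ hz
    have hz' : v ⬝ᵥ (hess Φ x).mulVec v = 1 := hz
    have := hK x v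
    rwa [hz', mul_one] at this
  · fun_prop
  intro x₀ v₀ hz hG φ a₁ a₂ hφ hle heq
  have hv₀ : v₀ ⬝ᵥ (hess Φ x₀).mulVec v₀ = 1 := hz
  dsimp only at hG hle heq ⊢
  set f := calabiForm Φ x₀ v₀ with hf
  set u := v₀ ⬝ᵥ v₀ with hu
  set y := max (u - k / 2) 0 with hy
  set G := f ^ 2 + 2 * S * y ^ 2 - S * k ^ 2 / 2 with hGdef
  have hf0 : 0 ≤ f := calabiForm_nonneg hΦ3 hpos x₀ v₀
  have hy0 : 0 ≤ y := le_max_right _ _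
  have hyu : u - k / 2 ≤ y := le_max_left _ _
  have hu0 : 0 ≤ u := dotProduct_self_nonneg' v₀
  have huk : u ≤ k := by
    have := hK x₀ v₀
    rwa [hv₀, mul_one] at this
  have hyk : y ≤ k / 2 := max_le (by linarith) (by linarith)
  have hyy : y * u = y * (y + k / 2) := by
    rcases le_total (u - k / 2) 0 with h | h
    · rw [hy, max_eq_right h]; ring
    · rw [hy, max_eq_left h]; ring
  have hSy : 0 ≤ S * y := by positivity
  have key := calabi_maximum hΦ hV hQ hQpos hpos hMA
    (hφ.add_const (f ^ 2 + 2 * S * y * k + 2 * S * y ^ 2 + S * k ^ 2 / 2))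
    (α := 2 * f) (β := 4 * S * y) (by positivity) (by positivity) hv₀
    (by
      filter_upwards [hle] with x hx w X hX
      have h1 := variational_le_trace (hpos x) (dirHess_isSymm hΦ3 w x) hX
      have h2 := mul_le_mul_of_nonneg_left h1 (by positivity : 0 ≤ 2 * f)
      refine (add_le_add_left h2 _).trans
        (calabiForm_add_le_of_unit (hpos x) (fun v hv => ?_) w)
      have h3 := hx v hv
      have h4 : v ⬝ᵥ v - k / 2 ≤ max (v ⬝ᵥ v - k / 2) 0 := le_max_left _ _
      have h5 := mul_le_mul_of_nonneg_left h4 hSy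
      have h6 : 0 ≤ S * (max (v ⬝ᵥ v - k / 2) 0 - y) ^ 2 := by positivity
      nlinarith [sq_nonneg (calabiForm Φ x v - f)])
    rfl rfl (by
      rw [← calabiForm, ← hf, ← heq, hGdef, ← hu]; linear_combination 4 * S * hyy)
  rw [← calabiForm, ← hf] at key
  refine le_trans ?_ key
  set M := hess Φ x₀ with hM
  set N := M⁻¹ with hN
  set T := dirHess Φ v₀ x₀ with hT
  have hMs := posDef_isSymm (hpos x₀)
  have hNs := posDef_isSymm (hpos x₀).inv
  have hTs : T.IsSymm := dirHess_isSymm hΦ3 v₀ x₀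
  have hXs : (N * T * N).IsSymm := by
    rw [Matrix.IsSymm, Matrix.transpose_mul, Matrix.transpose_mul, hNs.eq, hTs.eq,
      Matrix.mul_assoc]
  have hD := trace_source_lower_bound (hVpos x₀) hXs (dirHess_isSymm hV v₀ x₀) hMs hk (hK x₀)
  have hXMX : N * T * N * M * (N * T * N) = N * T * N * T * N := by
    rw [Matrix.nonsing_inv_mul_cancel_right _ _ (hpos x₀).det_pos.ne'.isUnit]
    simp only [Matrix.mul_assoc]
  rw [hXMX] at hD
  have hSv := hS x₀ v₀
  have hVv := hVc x₀ v₀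
  set D := 2 * (hess V x₀ * (N * T * N * T * N)).trace
    - 2 * (N * T * N * dirHess V v₀ x₀).trace
  have hD' : -(k / 2) * (S * u) ≤ D :=
    le_trans (mul_le_mul_of_nonpos_left hSv (by linarith)) hD
  set m := M.mulVec v₀ ⬝ᵥ Q.mulVec (M.mulVec v₀) with hm
  set p := Q.mulVec (M.mulVec v₀) ⬝ᵥ v₀ with hp
  have hm0 : 0 ≤ m := posSemidef_form_nonneg hQpos.posSemidef _
  have hpm : 4 * p ≤ k * (2 * m + c * u) := by
    have h1 := posSemidef_form_nonneg hQpos.posSemidef (v₀ - k • M.mulVec v₀)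
    rw [form_sub_smul hQ, dotProduct_comm v₀ (Q.mulVec (M.mulVec v₀)), ← hp, ← hm] at h1
    have h2 := form_le_eOpNorm Q v₀
    have h3 : 0 ≤ k * (k * (2 * m + c * u) - 4 * p) := by
      have : c * k ^ 2 * u = 2 * eOpNorm Q * u := by rw [hkq]
      linarith
    have := nonneg_of_mul_nonneg_right h3 hk
    linarith
  have hφ0 : φ x₀ + (f ^ 2 + 2 * S * y * k + 2 * S * y ^ 2 + S * k ^ 2 / 2)
      = 2 * (f ^ 2 + 2 * S * y ^ 2 + S * y * k) := by
    rw [← heq, hGdef]; ring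
  rw [hφ0, one_mul]
  exact calabi_scalar_bound hc hk hS0 hf0 hu0 hy0 hyu hyk hm0 hpm hD' hVv hGdef hG.le

end CalabiBound

/-- Gaussian target: `‖g‖_h² ≤ (‖Q‖/c) · S`. -/
theorem stmt_18 {n : ℕ} (Φ V : (Fin n → ℝ) → ℝ) (Q : Matrix (Fin n) (Fin n) ℝ)
    (cQ c S : ℝ) (hc : 0 < c)
    (hΦ : ContDiff ℝ 5 Φ) (hΦconv : ConvexOn ℝ Set.univ Φ)
    (hpos : ∀ x, (hess Φ x).PosDef)
    (hV : ContDiff ℝ 3 V)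
    (hVc : ∀ x, (hess V x - c • (1 : Matrix (Fin n) (Fin n) ℝ)).PosSemidef)
    (hQsymm : Q.IsSymm) (hQpos : Q.PosDef)
    (μ ν : Measure (Fin n → ℝ))
    (hμ : μ = MeasureTheory.volume.withDensity (fun x => ENNReal.ofReal (Real.exp (-V x))))
    (hν : ν = MeasureTheory.volume.withDensity
      (fun x => ENNReal.ofReal (cQ * Real.exp (-(qform Q x)))))
    (hμp : IsProbabilityMeasure μ) (hνp : IsProbabilityMeasure ν)
    (hMA : ∀ x, Real.exp (-V x)
      = cQ * Real.exp (-(qform Q (grad Φ x))) * (hess Φ x).det)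
    (hS : ∀ x, ∀ e : Fin n → ℝ, (∑ k, e k ^ 2) = 1 →
      ((hess V x)⁻¹ * dirHess V e x * dirHess V e x).trace ≤ S) :
    ∀ x, (hnorm Φ (fun i j => calabi Φ i j x) x) ^ 2 ≤ (eOpNorm Q / c) * S := by
  subst hμ hν
  intro x
  rcases Nat.eq_zero_or_pos n with rfl | hn
  · have hq : eOpNorm Q = 0 := by simp [eOpNorm, Subsingleton.elim Q 0]
    simp [hnorm, hq]
  have hcQ : 0 < cQ := by
    have h1 := Real.exp_pos (-V x)
    rw [hMA x, mul_assoc] at h1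
    exact pos_of_mul_pos_left h1 (mul_pos (Real.exp_pos _) (hpos x).det_pos).le
  have hMA' : ∀ x, V x = -Real.log cQ + qform Q (grad Φ x) - Real.log (hess Φ x).det := by
    intro x
    have h1 := congrArg Real.log (hMA x)
    rw [Real.log_exp, Real.log_mul (by positivity) (hpos x).det_pos.ne',
      Real.log_mul hcQ.ne' (Real.exp_pos _).ne', Real.log_exp] at h1
    linarith
  have hVc' : ∀ x d, c * (d ⬝ᵥ d) ≤ d ⬝ᵥ (hess V x).mulVec d := fun x d => by
    have := posSemidef_form_nonneg (hVc x) d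
    simp only [Matrix.sub_mulVec, Matrix.smul_mulVec, Matrix.one_mulVec, dotProduct_sub,
      dotProduct_smul, smul_eq_mul] at this
    linarith
  have hVpos : ∀ x, (hess V x).PosDef := fun x => by
    have := ((Matrix.PosDef.one (n := Fin n) (R := ℝ)).smul hc).add_posSemidef (hVc x)
    rwa [add_sub_cancel] at this
  have hsurj := grad_surjective (hΦ.of_le (by norm_num)) hpos hcQ hμp hνp hMA
  have hq : 0 < eOpNorm Q := by
    have h1 : Pi.single ⟨0, hn⟩ 1 ≠ (0 : Fin n → ℝ) := by simp
    have h2 := hQpos.dotProduct_mulVec_pos h1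
    rw [star_trivial] at h2
    exact pos_of_mul_pos_left (h2.trans_le (form_le_eOpNorm Q _)) (dotProduct_self_nonneg' _)
  set k := √(2 * eOpNorm Q / c) with hkdef
  have hk : 0 < k := Real.sqrt_pos.2 (by positivity)
  have hkq : c * k ^ 2 = 2 * eOpNorm Q := by
    rw [hkdef, Real.sq_sqrt (by positivity)]; field_simp
  have hS0 : 0 ≤ S := by
    refine le_trans ?_ (hS x (Pi.single ⟨0, hn⟩ 1) (by simp [Pi.single_apply]))
    have hB := dirHess_isSymm hV (Pi.single ⟨0, hn⟩ 1) x
    have := trace_mul_nonneg (hVpos x).inv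
      (Matrix.posSemidef_conjTranspose_mul_self (dirHess V (Pi.single ⟨0, hn⟩ 1) x))
    rwa [Matrix.conjTranspose_eq_transpose_of_trivial, hB.eq, ← Matrix.mul_assoc] at this
  have hK := hessian_ge_sharp hΦ hV hQsymm hQpos hpos hc hk hkq hVc' hMA' hsurj
  have hbound := calabiForm_sq_le hΦ hV hQsymm hQpos hpos hVpos hc hk hS0 hkq hVc' hMA' hK
    (fun x => trace_dirHess_le (hS x)) x
  have hJ : S * k ^ 2 / 2 = eOpNorm Q / c * S := by
    have : k ^ 2 = 2 * eOpNorm Q / c := Real.sq_sqrt (by positivity)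
    rw [this]; ring
  rw [hJ] at hbound
  have hJ0 : 0 ≤ eOpNorm Q / c * S := by positivity
  have hform : ∀ v : Fin n → ℝ, ∑ i, ∑ j, pd2 Φ i j x * v i * v j
      = v ⬝ᵥ (hess Φ x).mulVec v := fun v => by
    simp only [dotProduct, Matrix.mulVec, hess, Matrix.of_apply, Finset.mul_sum]
    exact Finset.sum_congr rfl fun i _ => Finset.sum_congr rfl fun j _ => by ring
  have hΦ3 : ContDiff ℝ 3 Φ := hΦ.of_le (by norm_num)
  have hle : hnorm Φ (fun i j => calabi Φ i j x) x ≤ √(eOpNorm Q / c * S) := by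
    refine Real.sSup_le ?_ (Real.sqrt_nonneg _)
    rintro r ⟨v, hv, rfl⟩
    rw [sum_calabi hΦ3 hpos]
    exact Real.le_sqrt_of_sq_le (hbound v (by rw [← hform, hv]))
  have hnn : 0 ≤ hnorm Φ (fun i j => calabi Φ i j x) x := by
    refine Real.sSup_nonneg ?_
    rintro r ⟨v, -, rfl⟩
    rw [sum_calabi hΦ3 hpos]
    exact calabiForm_nonneg hΦ3 hpos x v
  calc _ ≤ √(eOpNorm Q / c * S) ^ 2 := by gcongr
    _ = _ := Real.sq_sqrt hJ0
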